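/- Fix an integer k ≥ 3, λ ∈ (0,1/2) and ε > 0. There exists a constant C = C(k,λ,ε) such that for every n with gcd(n,(k−1)!) = 1 and every integer m with m/n ∈ (λ, 1−λ) the following holds. Let x be the indicator vector of a uniformly random m-element subset of ℤ/nℤ, let μ_k and σ_k be the mean and standard deviation of kAP(x), and set Z_k = (kAP(x) − μ_k)/σ_k. Then sup_{z ∈ (ℤ−μ_k)/σ_k} |σ_k·ℙ[Z_k = z] − 𝒩(z)| ≤ C·n^{ε−1/4}, and Σ_{z ∈ (ℤ−μ_k)/σ_k} |ℙ[Z_k = z] − 𝒩(z)/σ_k| ≤ C·n^{ε−1/4}. -/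

import Mathlib

open MeasureTheory ProbabilityTheory
open scoped ENNReal NNReal

noncomputable section

/-- The standard normal density. -/
def stdNormal (z : ℝ) : ℝ := (Real.sqrt (2 * Real.pi))⁻¹ * Real.exp (-(z ^ 2) / 2)

/-- The uniform probability measure on a subset of a finite type. -/
def finUniform {γ : Type*} [Fintype γ] [MeasurableSpace γ] (s : Set γ) : Measure γ :=
  (Nat.card s : ℝ≥0∞)⁻¹ • ∑ a : γ, s.indicator (fun _ => (1 : ℝ≥0∞)) a • Measure.dirac a

/-- The product Bernoulli(p) measure on `ι → Bool`. -/
def bernoulliPi (ι : Type*) [Fintype ι] [DecidableEq ι] (p : ℝ) : Measure (ι → Bool) :=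
  ∑ x : ι → Bool, (∏ i : ι, ENNReal.ofReal (if x i then p else 1 - p)) • Measure.dirac x

/-- The uniform measure on indicator vectors of `m`-element subsets of `ZMod n`. -/
def uniformSubset (n : ℕ) [NeZero n] (m : ℕ) : Measure (ZMod n → Bool) :=
  finUniform {x | (Finset.univ.filter fun i : ZMod n => x i = true).card = m}

/-- The number of `k`-term arithmetic progressions (with common difference between 1 and n/2)
contained in the subset of `ZMod n` indicated by `x`. -/
def kAPcount (k : ℕ) {n : ℕ} [NeZero n] (x : ZMod n → Bool) : ℕ :=
  ∑ a : ZMod n, ∑ d ∈ Finset.Icc 1 (n / 2), ∏ i ∈ Finset.range k,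
    if x (a + ((i * d : ℕ) : ZMod n)) then 1 else 0

end

set_option linter.unusedSectionVars false
set_option linter.unusedSimpArgs false
set_option linter.unusedVariables false
set_option linter.unnecessarySeqFocus false
section ExBasics
variable {ι : Type*} [Fintype ι] [DecidableEq ι]

/-- Bernoulli weight -/
noncomputable def bw (q : ℝ) (b : Bool) : ℝ := if b then q else 1 - q

/-- total weight -/
noncomputable def tw (q : ι → ℝ) (x : ι → Bool) : ℝ := ∏ i, bw (q i) (x i)

/-- product Bernoulli expectation -/
noncomputable def Ex (q : ι → ℝ) (f : (ι → Bool) → ℝ) : ℝ := ∑ x, tw q x * f x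

/-- admissible probabilities -/
def PQ (q : ι → ℝ) : Prop := ∀ i, 0 ≤ q i ∧ q i ≤ 1

lemma tw_nonneg {q : ι → ℝ} (hq : PQ q) (x) : 0 ≤ tw q x := by
  unfold tw bw
  apply Finset.prod_nonneg
  intro i _
  have := hq i
  split_ifs <;> linarith

lemma sum_tw_mul_prod (q : ι → ℝ) (h : ι → Bool → ℝ) :
    ∑ x, tw q x * ∏ i, h i (x i) = ∏ i, (q i * h i true + (1 - q i) * h i false) := by
  have h1 : ∀ i, q i * h i true + (1 - q i) * h i false = ∑ b, bw (q i) b * h i b := by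
    intro i; simp [bw]
  simp_rw [h1, Finset.prod_univ_sum, tw, ← Finset.prod_mul_distrib]
  rw [Fintype.piFinset_univ]

lemma sum_tw (q : ι → ℝ) : ∑ x, tw q x = 1 := by
  have := sum_tw_mul_prod q (fun _ _ => 1)
  simpa using this

lemma Ex_const (q : ι → ℝ) (c : ℝ) : Ex q (fun _ => c) = c := by
  unfold Ex; rw [← Finset.sum_mul, sum_tw, one_mul]

lemma Ex_add (q : ι → ℝ) (f g) : Ex q (fun x => f x + g x) = Ex q f + Ex q g := by
  simp [Ex, mul_add, Finset.sum_add_distrib]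

lemma Ex_sub (q : ι → ℝ) (f g) : Ex q (fun x => f x - g x) = Ex q f - Ex q g := by
  simp [Ex, mul_sub, Finset.sum_sub_distrib]

lemma Ex_smul (q : ι → ℝ) (c : ℝ) (f) : Ex q (fun x => c * f x) = c * Ex q f := by
  simp only [Ex, Finset.mul_sum]; exact Finset.sum_congr rfl fun _ _ => by ring

lemma Ex_sum {κ : Type*} (q : ι → ℝ) (s : Finset κ) (f : κ → (ι → Bool) → ℝ) :
    Ex q (fun x => ∑ e ∈ s, f e x) = ∑ e ∈ s, Ex q (f e) := by
  simp only [Ex, Finset.mul_sum]; exact Finset.sum_comm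

lemma Ex_mono {q : ι → ℝ} (hq : PQ q) {f g : (ι → Bool) → ℝ} (h : ∀ x, f x ≤ g x) :
    Ex q f ≤ Ex q g :=
  Finset.sum_le_sum fun x _ => mul_le_mul_of_nonneg_left (h x) (tw_nonneg hq x)

lemma Ex_nonneg {q : ι → ℝ} (hq : PQ q) {f : (ι → Bool) → ℝ} (h : ∀ x, 0 ≤ f x) :
    0 ≤ Ex q f :=
  Finset.sum_nonneg fun x _ => mul_nonneg (tw_nonneg hq x) (h x)

lemma Ex_abs_le {q : ι → ℝ} (hq : PQ q) {f : (ι → Bool) → ℝ} {c : ℝ} (h : ∀ x, |f x| ≤ c) :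
    |Ex q f| ≤ c := by
  rw [abs_le]
  constructor
  · rw [← Ex_const q (-c)]; exact Ex_mono hq fun x => (abs_le.1 (h x)).1
  · rw [← Ex_const q c]; exact Ex_mono hq fun x => (abs_le.1 (h x)).2

/-- independence -/
lemma Ex_mul_of_dep (q : ι → ℝ) {f g : (ι → Bool) → ℝ} {S T : Finset ι}
    (hf : DependsOn f (S : Set ι)) (hg : DependsOn g (T : Set ι)) (hST : Disjoint S T) :
    Ex q (fun x => f x * g x) = Ex q f * Ex q g := by
  let mx : (ι → Bool) → (ι → Bool) → (ι → Bool) := fun x y i => if i ∈ S then x i else y i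
  have key : ∑ z : (ι → Bool) × (ι → Bool), tw q z.1 * f z.1 * (tw q z.2 * g z.2)
      = ∑ z : (ι → Bool) × (ι → Bool), tw q z.1 * (f z.1 * g z.1) * tw q z.2 := by
    refine Finset.sum_nbij' (fun z => (mx z.1 z.2, mx z.2 z.1)) (fun z => (mx z.1 z.2, mx z.2 z.1))
      (by simp) (by simp) ?_ ?_ ?_
    · rintro ⟨x, y⟩ _; ext i <;> simp only [mx] <;> split_ifs <;> rfl
    · rintro ⟨x, y⟩ _; ext i <;> simp only [mx] <;> split_ifs <;> rfl
    · rintro ⟨x, y⟩ _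
      have e1 : f (mx x y) = f x := hf fun i hi => by
        have : i ∈ S := hi
        simp [mx, this]
      have e2 : g (mx x y) = g y := hg fun i hi => by
        have : i ∉ S := fun h => Finset.disjoint_left.1 hST h hi
        simp [mx, this]
      have e3 : tw q (mx x y) * tw q (mx y x) = tw q x * tw q y := by
        unfold tw
        rw [← Finset.prod_mul_distrib, ← Finset.prod_mul_distrib]
        refine Finset.prod_congr rfl fun i _ => ?_
        simp only [mx]; split_ifs
        · rfl
        · ring
      simp only [e1, e2]
      calc _ = tw q x * tw q y * (f x * g y) := by ring
        _ = _ := by rw [← e3]; ring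
  rw [Fintype.sum_prod_type, Fintype.sum_prod_type] at key
  simp only [← Finset.mul_sum, ← Finset.sum_mul, sum_tw, mul_one] at key
  unfold Ex
  rw [← key]

lemma Ex_coord (q : ι → ℝ) (i : ι) (h : Bool → ℝ) :
    Ex q (fun x => h (x i)) = q i * h true + (1 - q i) * h false := by
  have := sum_tw_mul_prod q (fun j b => if j = i then h b else 1)
  simp only [Finset.prod_ite_eq', Finset.mem_univ, if_true] at this
  unfold Ex
  rw [this, Finset.prod_eq_single i]
  · simp
  · intro j _ hj; simp [hj]
  · simp

lemma dep_coord {i : ι} (h : Bool → ℝ) : DependsOn (fun x : ι → Bool => h (x i)) (({i} : Finset ι) : Set ι) := by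
  intro x y hxy
  simp only
  rw [hxy i (by simp)]

lemma dep_mul {f g : (ι → Bool) → ℝ} {S T : Finset ι}
    (hf : DependsOn f (S : Set ι)) (hg : DependsOn g (T : Set ι)) :
    DependsOn (fun x => f x * g x) ((S ∪ T : Finset ι) : Set ι) := by
  intro x y hxy
  simp only
  rw [hf (fun i hi => hxy i (by simp at hi ⊢; tauto)), hg (fun i hi => hxy i (by simp at hi ⊢; tauto))]

lemma dep_add {f g : (ι → Bool) → ℝ} {S T : Finset ι}
    (hf : DependsOn f (S : Set ι)) (hg : DependsOn g (T : Set ι)) :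
    DependsOn (fun x => f x + g x) ((S ∪ T : Finset ι) : Set ι) := by
  intro x y hxy
  simp only
  rw [hf (fun i hi => hxy i (by simp at hi ⊢; tauto)), hg (fun i hi => hxy i (by simp at hi ⊢; tauto))]

lemma dep_mono {f : (ι → Bool) → ℝ} {S T : Finset ι}
    (hf : DependsOn f (S : Set ι)) (h : S ⊆ T) : DependsOn f (T : Set ι) :=
  hf.mono (by exact_mod_cast h)

lemma dep_prod {κ : Type*} [DecidableEq κ] (A : Finset κ) (f : κ → (ι → Bool) → ℝ) (S : κ → Finset ι)
    (hf : ∀ a ∈ A, DependsOn (f a) (S a : Set ι)) :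
    DependsOn (fun x => ∏ a ∈ A, f a x) ((A.biUnion S : Finset ι) : Set ι) := by
  intro x y hxy
  refine Finset.prod_congr rfl fun a ha => hf a ha fun i hi => hxy i ?_
  simp only [Finset.coe_biUnion, Set.mem_iUnion]
  exact ⟨a, ha, hi⟩

lemma dep_sum {κ : Type*} [DecidableEq κ] (A : Finset κ) (f : κ → (ι → Bool) → ℝ) (S : κ → Finset ι)
    (hf : ∀ a ∈ A, DependsOn (f a) (S a : Set ι)) :
    DependsOn (fun x => ∑ a ∈ A, f a x) ((A.biUnion S : Finset ι) : Set ι) := by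
  intro x y hxy
  refine Finset.sum_congr rfl fun a ha => hf a ha fun i hi => hxy i ?_
  simp only [Finset.coe_biUnion, Set.mem_iUnion]
  exact ⟨a, ha, hi⟩

/-- independence of a family -/
lemma Ex_prod_of_dep {κ : Type*} [DecidableEq κ] (q : ι → ℝ) (A : Finset κ)
    (f : κ → (ι → Bool) → ℝ) (S : κ → Finset ι)
    (hf : ∀ a ∈ A, DependsOn (f a) (S a : Set ι))
    (hd : ∀ a ∈ A, ∀ b ∈ A, a ≠ b → Disjoint (S a) (S b)) :
    Ex q (fun x => ∏ a ∈ A, f a x) = ∏ a ∈ A, Ex q (f a) := by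
  induction A using Finset.induction_on with
  | empty => simp [Ex_const]
  | insert a A ha ih =>
    simp only [Finset.prod_insert ha]
    rw [Ex_mul_of_dep q (hf a (by simp)) (dep_prod A f S fun b hb => hf b (by simp [hb])), ih]
    · exact fun b hb => hf b (by simp [hb])
    · exact fun b hb c hc => hd b (by simp [hb]) c (by simp [hc])
    · rw [Finset.disjoint_biUnion_right]
      intro b hb
      exact hd a (by simp) b (by simp [hb]) (by rintro rfl; exact ha hb)

/-- fourth moment of sums of independent centred bounded variables -/
lemma Ex_moments {κ : Type*} [DecidableEq κ] (q : ι → ℝ) (hq : PQ q) (A : Finset κ)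
    (f : κ → (ι → Bool) → ℝ) (S : κ → Finset ι)
    (hf : ∀ a ∈ A, DependsOn (f a) (S a : Set ι))
    (hd : ∀ a ∈ A, ∀ b ∈ A, a ≠ b → Disjoint (S a) (S b))
    (h0 : ∀ a ∈ A, Ex q (f a) = 0) (h1 : ∀ a ∈ A, ∀ x, |f a x| ≤ 1) :
    Ex q (fun x => ∑ a ∈ A, f a x) = 0 ∧
    Ex q (fun x => (∑ a ∈ A, f a x) ^ 2) = ∑ a ∈ A, Ex q (fun x => f a x ^ 2) ∧
    Ex q (fun x => (∑ a ∈ A, f a x) ^ 4) ≤ 3 * (A.card : ℝ) ^ 2 := by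
  induction A using Finset.induction_on with
  | empty => simp [Ex_const]
  | insert a A ha ih =>
    obtain ⟨i0, i2, i4⟩ := ih (fun b hb => hf b (by simp [hb]))
      (fun b hb c hc => hd b (by simp [hb]) c (by simp [hc]))
      (fun b hb => h0 b (by simp [hb])) (fun b hb => h1 b (by simp [hb]))
    have hfa := hf a (by simp)
    have hW : DependsOn (fun x => ∑ b ∈ A, f b x) ((A.biUnion S : Finset ι) : Set ι) :=
      dep_sum A f S fun b hb => hf b (by simp [hb])
    have hdis : Disjoint (S a) (A.biUnion S) := by
      rw [Finset.disjoint_biUnion_right]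
      intro b hb
      exact hd a (by simp) b (by simp [hb]) (by rintro rfl; exact ha hb)
    have hz0 := h0 a (by simp)
    have hz1 := h1 a (by simp)
    have ind : ∀ (m l : ℕ), Ex q (fun x => f a x ^ m * (∑ b ∈ A, f b x) ^ l)
        = Ex q (fun x => f a x ^ m) * Ex q (fun x => (∑ b ∈ A, f b x) ^ l) := fun m l =>
      Ex_mul_of_dep q (f := fun x => f a x ^ m) (g := fun x => (∑ b ∈ A, f b x) ^ l)
        (fun x y h => by simp only; rw [hfa h]) (fun x y h => by
          have := hW h
          simp only at this ⊢
          rw [this]) hdis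
    simp only [Finset.sum_insert ha, Finset.card_insert_of_notMem ha]
    have sq_le : ∀ x, f a x ^ 2 ≤ 1 := fun x => by
      have := hz1 x; rw [← sq_abs]; nlinarith [abs_nonneg (f a x)]
    have z2 : Ex q (fun x => f a x ^ 2) ≤ 1 := by
      rw [← Ex_const q 1]; exact Ex_mono hq sq_le
    have z2' : 0 ≤ Ex q (fun x => f a x ^ 2) := Ex_nonneg hq fun x => sq_nonneg _
    have z4 : Ex q (fun x => f a x ^ 4) ≤ 1 := by
      rw [← Ex_const q 1]; exact Ex_mono hq fun x => by
        have := sq_le x; nlinarith [sq_nonneg (f a x)]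
    have w2 : Ex q (fun x => (∑ b ∈ A, f b x) ^ 2) ≤ A.card := by
      rw [i2]
      calc _ ≤ ∑ b ∈ A, (1 : ℝ) := Finset.sum_le_sum fun b hb => by
            rw [← Ex_const q 1]; exact Ex_mono hq fun x => by
              have := h1 b (by simp [hb]) x; rw [← sq_abs]; nlinarith [abs_nonneg (f b x)]
        _ = _ := by simp
    refine ⟨by rw [Ex_add, hz0, i0, add_zero], ?_, ?_⟩
    · have : ∀ x, (f a x + ∑ b ∈ A, f b x) ^ 2 = f a x ^ 2 + 2 * (f a x ^ 1 * (∑ b ∈ A, f b x) ^ 1)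
        + (∑ b ∈ A, f b x) ^ 2 := fun x => by ring
      simp_rw [this]
      rw [Ex_add, Ex_add, Ex_smul, ind, i2]
      simp [hz0]
    · have : ∀ x, (f a x + ∑ b ∈ A, f b x) ^ 4 = f a x ^ 4
        + (4 * (f a x ^ 3 * (∑ b ∈ A, f b x) ^ 1) + (6 * (f a x ^ 2 * (∑ b ∈ A, f b x) ^ 2)
        + (4 * (f a x ^ 1 * (∑ b ∈ A, f b x) ^ 3) + (∑ b ∈ A, f b x) ^ 4))) := fun x => by ring
      simp_rw [this]
      rw [Ex_add, Ex_add, Ex_add, Ex_add, Ex_smul, Ex_smul, Ex_smul, ind, ind, ind]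
      simp only [pow_one, i0, hz0, mul_zero, zero_mul, add_zero, zero_add]
      push_cast
      have := mul_le_mul z2 w2 (Ex_nonneg hq fun x => sq_nonneg _) (by norm_num)
      nlinarith

end ExBasics

section StirlingCmp

lemma stir_bounds (n : ℕ) (hn : 0 < n) :
    Real.sqrt Real.pi * (Real.sqrt (2 * n) * (n / Real.exp 1) ^ n) ≤ (n.factorial : ℝ) ∧
    (n.factorial : ℝ) ≤ (Real.exp 1 / Real.sqrt 2) * (Real.sqrt (2 * n) * (n / Real.exp 1) ^ n) := by
  have hpos : 0 < Real.sqrt (2 * n) * ((n : ℝ) / Real.exp 1) ^ n := by positivity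
  have h1 := Stirling.sqrt_pi_le_stirlingSeq hn.ne'
  have h2 : Stirling.stirlingSeq n ≤ Real.exp 1 / Real.sqrt 2 := by
    have := Stirling.stirlingSeq'_antitone (Nat.zero_le (n - 1))
    simp only [Function.comp] at this
    rw [Nat.succ_eq_add_one, Nat.succ_eq_add_one, Nat.sub_add_cancel hn] at this
    simpa [Stirling.stirlingSeq_one] using this
  unfold Stirling.stirlingSeq at h1 h2
  rw [le_div_iff₀ hpos] at h1
  rw [div_le_iff₀ hpos] at h2
  exact ⟨h1, h2⟩

lemma binom_lower (n m : ℕ) (h0 : 0 < m) (h1 : m < n) :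
    1 ≤ 2 * Real.sqrt n * ((n.choose m : ℝ) * (((m : ℝ) / n) ^ m * (1 - (m : ℝ) / n) ^ (n - m))) := by
  obtain ⟨l, rfl⟩ : ∃ l, n = m + l := ⟨n - m, by omega⟩
  have hl : 0 < l := by omega
  have e : 0 < Real.exp 1 := Real.exp_pos 1
  have hm' : (0:ℝ) < m := by exact_mod_cast h0
  have hl' : (0:ℝ) < l := by exact_mod_cast hl
  have hN : (0:ℝ) < ((m + l : ℕ) : ℝ) := by positivity
  have hch : (((m+l).choose m : ℕ) : ℝ) = ((m+l).factorial : ℝ) / (m.factorial * l.factorial) :=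
    Nat.cast_add_choose ℝ
  have h1p : (1 - (m : ℝ) / ((m + l : ℕ) : ℝ)) = l / ((m + l : ℕ) : ℝ) := by
    rw [eq_div_iff hN.ne', sub_mul, div_mul_cancel₀ _ hN.ne']; push_cast; ring
  have hbn := (stir_bounds (m+l) (by omega)).1
  have hbm := (stir_bounds m h0).2
  have hbl := (stir_bounds l hl).2
  set N : ℝ := ((m + l : ℕ) : ℝ) with hNdef
  have hNe : N = m + l := by rw [hNdef]; push_cast; ring
  rw [hch, h1p, Nat.add_sub_cancel_left, div_pow, div_pow]
  set Q : ℝ := (m:ℝ)^m * (l:ℝ)^l / Real.exp 1 ^ (m+l) with hQ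
  have hQpos : 0 < Q := by positivity
  have hsq : Real.sqrt (2 * m) * Real.sqrt (2 * l) ≤ N := by
    rw [← Real.sqrt_mul (by positivity)]
    apply Real.sqrt_le_iff.2 ⟨hN.le, ?_⟩
    rw [hNe]; nlinarith [sq_nonneg ((m:ℝ) - l)]
  have hs2 : Real.sqrt 2 * Real.sqrt 2 = 2 := Real.mul_self_sqrt (by norm_num)
  have hup : (m.factorial : ℝ) * l.factorial ≤ (Real.exp 1 ^ 2 / 2) * (N * Q) := by
    calc (m.factorial : ℝ) * l.factorial ≤ _ := mul_le_mul hbm hbl (by positivity) (by positivity)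
      _ = (Real.exp 1 ^ 2 / (Real.sqrt 2 * Real.sqrt 2)) * ((Real.sqrt (2 * m) * Real.sqrt (2 * l)) * Q) := by
        rw [hQ]; simp only [div_pow, pow_add]; field_simp
      _ ≤ _ := by rw [hs2]; gcongr
  have hlow : Real.sqrt Real.pi * Real.sqrt 2 * N * Q ≤ Real.sqrt N * ((m+l).factorial : ℝ) * ((m:ℝ)^m * (l:ℝ)^l / N^(m+l)) := by
    have h3 : Real.sqrt N * Real.sqrt (2 * N) = Real.sqrt 2 * N := by
      rw [Real.sqrt_mul (by norm_num)]
      have := Real.mul_self_sqrt hN.le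
      calc _ = Real.sqrt 2 * (Real.sqrt N * Real.sqrt N) := by ring
        _ = _ := by rw [this]
    calc _ = Real.sqrt N * (Real.sqrt Real.pi * (Real.sqrt (2 * N) * (N / Real.exp 1) ^ (m+l))) * ((m:ℝ)^m * (l:ℝ)^l / N^(m+l)) := by
          rw [mul_assoc (Real.sqrt Real.pi), ← h3, hQ, div_pow]; field_simp
      _ ≤ _ := by gcongr
  have hc : Real.exp 1 ^ 2 / 2 ≤ 2 * (Real.sqrt Real.pi * Real.sqrt 2) := by
    have h1 := Real.exp_one_lt_d9
    have h2 : (1.7:ℝ) ≤ Real.sqrt Real.pi := Real.le_sqrt_of_sq_le (by have := Real.pi_gt_three; norm_num; linarith)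
    have h3 : (1.4:ℝ) ≤ Real.sqrt 2 := Real.le_sqrt_of_sq_le (by norm_num)
    have h4 : (1.7 * 1.4 : ℝ) ≤ Real.sqrt Real.pi * Real.sqrt 2 := by gcongr
    nlinarith
  have hfin : (m.factorial : ℝ) * l.factorial ≤ 2 * (Real.sqrt N * ((m+l).factorial : ℝ) * ((m:ℝ)^m * (l:ℝ)^l / N^(m+l))) := by
    calc _ ≤ _ := hup
      _ ≤ 2 * (Real.sqrt Real.pi * Real.sqrt 2) * (N * Q) := by gcongr
      _ = 2 * (Real.sqrt Real.pi * Real.sqrt 2 * N * Q) := by ring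
      _ ≤ _ := by gcongr
  have hf : (0:ℝ) < (m.factorial : ℝ) * l.factorial := by positivity
  rw [← div_le_div_iff_of_pos_right hf, div_self hf.ne'] at hfin
  refine hfin.trans (le_of_eq ?_)
  rw [pow_add]; field_simp
end StirlingCmp

section Slice
variable {G : Type*} [Fintype G] [DecidableEq G]

/-- number of true coordinates -/
def cnt (x : G → Bool) : ℕ := (Finset.univ.filter fun i => x i = true).card

/-- the slice -/
def slc (G : Type*) [Fintype G] [DecidableEq G] (m : ℕ) : Finset (G → Bool) := Finset.univ.filter fun x => cnt x = m

lemma mem_slc {m : ℕ} {x : G → Bool} : x ∈ slc G m ↔ cnt x = m := by simp [slc]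

/-- slice average -/
noncomputable def Esl {E : Type*} [AddCommGroup E] [Module ℝ E] (m : ℕ) (f : (G → Bool) → E) : E :=
  ((slc G m).card : ℝ)⁻¹ • ∑ x ∈ slc G m, f x

lemma card_slc (m : ℕ) : (slc G m).card = (Fintype.card G).choose m := by
  rw [← Finset.card_univ, ← Finset.card_powersetCard]
  refine Finset.card_bij' (fun x _ => Finset.univ.filter fun i => x i = true) (fun s _ => fun i => decide (i ∈ s)) ?_ ?_ ?_ ?_
  · intro x hx; rw [mem_slc] at hx; simpa [Finset.mem_powersetCard, cnt] using hx
  · intro s hs; rw [Finset.mem_powersetCard] at hs; rw [mem_slc]; simpa [cnt] using hs.2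
  · intro x _; ext i; simp
  · intro s _; ext i; simp

section gen
variable {E : Type*} [NormedAddCommGroup E] [NormedSpace ℝ E]

lemma Esl_add (m : ℕ) (f g : (G → Bool) → E) : Esl m (fun x => f x + g x) = Esl m f + Esl m g := by
  simp [Esl, Finset.sum_add_distrib]
lemma Esl_sub (m : ℕ) (f g : (G → Bool) → E) : Esl m (fun x => f x - g x) = Esl m f - Esl m g := by
  simp [Esl, Finset.sum_sub_distrib, smul_sub]
lemma Esl_sum {κ : Type*} (m : ℕ) (s : Finset κ) (f : κ → (G → Bool) → E) :
    Esl m (fun x => ∑ e ∈ s, f e x) = ∑ e ∈ s, Esl m (f e) := by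
  simp only [Esl]; rw [Finset.sum_comm, Finset.smul_sum]
lemma Esl_mul (m : ℕ) (c : ℂ) (f : (G → Bool) → ℂ) : Esl m (fun x => c * f x) = c * Esl m f := by
  simp only [Esl, ← Finset.mul_sum, Complex.real_smul]; ring
lemma Esl_mulR (m : ℕ) (c : ℝ) (f : (G → Bool) → ℝ) : Esl m (fun x => c * f x) = c * Esl m f := by
  simp only [Esl, ← Finset.mul_sum, smul_eq_mul]; ring
lemma Esl_congr {m : ℕ} {f g : (G → Bool) → E} (h : ∀ x, cnt x = m → f x = g x) : Esl m f = Esl m g := by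
  simp only [Esl]; rw [Finset.sum_congr rfl fun x hx => h x (mem_slc.1 hx)]
lemma Esl_mono {m : ℕ} {f g : (G → Bool) → ℝ} (h : ∀ x, cnt x = m → f x ≤ g x) : Esl m f ≤ Esl m g := by
  simp only [Esl, smul_eq_mul]
  exact mul_le_mul_of_nonneg_left (Finset.sum_le_sum fun x hx => h x (mem_slc.1 hx)) (by positivity)
lemma Esl_norm_le (m : ℕ) (f : (G → Bool) → E) : ‖Esl m f‖ ≤ Esl m (fun x => ‖f x‖) := by
  simp only [Esl, smul_eq_mul]
  rw [norm_smul, Real.norm_of_nonneg (by positivity)]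
  gcongr; exact norm_sum_le _ _
lemma Esl_const {m : ℕ} (h : m ≤ Fintype.card G) (c : E) : Esl (G := G) m (fun _ => c) = c := by
  simp only [Esl, Finset.sum_const]
  rw [← Nat.cast_smul_eq_nsmul ℝ, smul_smul, inv_mul_cancel₀, one_smul]
  rw [card_slc]; exact_mod_cast (Nat.choose_pos h).ne'
lemma Esl_ofReal (m : ℕ) (f : (G → Bool) → ℝ) : Esl m (fun x => (f x : ℂ)) = ((Esl m f : ℝ) : ℂ) := by
  simp [Esl]
lemma cnt_comp (σ : Equiv.Perm G) (x : G → Bool) : cnt (x ∘ σ) = cnt x := by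
  unfold cnt
  exact Finset.card_bij (fun i _ => σ i) (by simp) (by simp) (by
    intro b hb; exact ⟨σ.symm b, by simpa using hb, by simp⟩)
lemma Esl_perm (m : ℕ) (σ : Equiv.Perm G) (f : (G → Bool) → E) : Esl m (fun x => f (x ∘ σ)) = Esl m f := by
  simp only [Esl]; congr 1
  refine Finset.sum_nbij' (fun x => x ∘ σ) (fun x => x ∘ σ.symm) ?_ ?_ ?_ ?_ ?_
  · intro x hx; rw [mem_slc] at *; rw [cnt_comp, hx]
  · intro x hx; rw [mem_slc] at *; rw [cnt_comp, hx]
  · intro x _; ext i; simp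
  · intro x _; ext i; simp
  · intro x _; rfl
end gen

lemma Esl_cauchy (m : ℕ) (f g : (G → Bool) → ℝ) : (Esl m (fun x => f x * g x))^2 ≤ Esl m (fun x => f x ^ 2) * Esl m (fun x => g x ^ 2) := by
  simp only [Esl, smul_eq_mul]
  have := Finset.sum_mul_sq_le_sq_mul_sq (slc G m) f g
  calc _ = (((slc G m).card : ℝ)⁻¹)^2 * (∑ x ∈ slc G m, f x * g x)^2 := by ring
    _ ≤ (((slc G m).card : ℝ)⁻¹)^2 * ((∑ x ∈ slc G m, f x ^ 2) * ∑ x ∈ slc G m, g x ^ 2) := by gcongr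
    _ = _ := by ring

lemma Esl_sq_le {m : ℕ} (h : m ≤ Fintype.card G) (f : (G → Bool) → ℝ) : (Esl m f)^2 ≤ Esl m (fun x => f x ^ 2) := by
  have := Esl_cauchy m f (fun _ => 1)
  simpa [Esl_const h] using this

lemma tw_slice (p : ℝ) (x : G → Bool) : tw (fun _ => p) x = p ^ cnt x * (1 - p) ^ (Fintype.card G - cnt x) := by
  unfold tw bw cnt
  rw [Finset.prod_ite, Finset.prod_const, Finset.prod_const]
  congr 2
  have := Finset.card_filter_add_card_filter_not (s := (Finset.univ : Finset G)) (fun i => x i = true)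
  rw [Finset.card_univ] at this
  omega

lemma Esl_le_Ex {m : ℕ} (h0 : 0 < m) (h1 : m < Fintype.card G) (f : (G → Bool) → ℝ) (hf : ∀ x, 0 ≤ f x) :
    Esl m f ≤ 2 * Real.sqrt (Fintype.card G) * Ex (fun _ => (m : ℝ) / Fintype.card G) f := by
  set n := Fintype.card G with hn
  have hn0 : (0:ℝ) < n := by exact_mod_cast (by omega : 0 < n)
  have hq : PQ (fun _ : G => (m : ℝ) / n) := fun i => ⟨by positivity, by
    rw [div_le_one hn0]; exact_mod_cast h1.le⟩
  have e1 : (n.choose m : ℝ) * (((m : ℝ) / n) ^ m * (1 - (m : ℝ) / n) ^ (n - m)) * Esl m f ≤ Ex (fun _ => (m : ℝ) / n) f := by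
    have : (n.choose m : ℝ) * (((m : ℝ) / n) ^ m * (1 - (m : ℝ) / n) ^ (n - m)) * Esl m f = ∑ x ∈ slc G m, tw (fun _ => (m : ℝ) / n) x * f x := by
      simp only [Esl, card_slc, smul_eq_mul]
      rw [← hn]
      have hne : (n.choose m : ℝ) ≠ 0 := by exact_mod_cast (Nat.choose_pos h1.le).ne'
      rw [mul_comm (n.choose m : ℝ), mul_assoc, mul_inv_cancel_left₀ hne, Finset.mul_sum]
      refine Finset.sum_congr rfl fun x hx => ?_
      rw [mem_slc] at hx
      rw [tw_slice, hx]
    rw [this]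
    exact Finset.sum_le_sum_of_subset_of_nonneg (Finset.subset_univ _) fun x _ _ => mul_nonneg (tw_nonneg hq x) (hf x)
  have e2 := binom_lower n m h0 h1
  have e3 : 0 ≤ Esl m f := by
    have := Esl_mono (m := m) (f := fun _ : G → Bool => (0:ℝ)) (g := f) fun x _ => hf x
    rwa [Esl_const h1.le] at this
  calc Esl m f = 1 * Esl m f := (one_mul _).symm
    _ ≤ _ := mul_le_mul_of_nonneg_right e2 e3
    _ = 2 * Real.sqrt n * ((n.choose m : ℝ) * (((m : ℝ) / n) ^ m * (1 - (m : ℝ) / n) ^ (n - m)) * Esl m f) := by ring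
    _ ≤ _ := by gcongr
end Slice

section VarLemma
variable {ι : Type*} [Fintype ι] [DecidableEq ι]

/-- centred coordinate -/
noncomputable def chi (q : ι → ℝ) (i : ι) (x : ι → Bool) : ℝ := (if x i then 1 else 0) - q i

lemma chi_abs {q : ι → ℝ} (hq : PQ q) (i) (x) : |chi q i x| ≤ 1 := by
  have := hq i
  unfold chi; rw [abs_le]; split_ifs <;> constructor <;> linarith

lemma chi_dep (q : ι → ℝ) (i : ι) : DependsOn (chi q i) (({i} : Finset ι) : Set ι) :=
  dep_coord (fun b => (if b then 1 else 0) - q i)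

lemma chi_mean (q : ι → ℝ) (i : ι) : Ex q (chi q i) = 0 := by
  have := Ex_coord q i (fun b => (if b then 1 else 0) - q i)
  unfold chi; rw [this]; simp; ring

lemma chi_sq (q : ι → ℝ) (i : ι) : Ex q (fun x => chi q i x ^ 2) = q i * (1 - q i) := by
  have := Ex_coord q i (fun b => ((if b then 1 else 0) - q i)^2)
  unfold chi; rw [this]; simp; ring

/-- core condition -/
def CoreAt (q : ι → ℝ) (X : (ι → Bool) → ℝ) (s : Finset ι) (e : ι) : Prop :=
  ∃ X' : (ι → Bool) → ℝ, DependsOn X' ((s \ {e} : Finset ι) : Set ι) ∧ ∀ x, X x = chi q e x * X' x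

lemma core_zero {q : ι → ℝ} {X Z : (ι → Bool) → ℝ} {s t : Finset ι} {e : ι}
    (h : CoreAt q X s e) (hZ : DependsOn Z (t : Set ι)) (het : e ∉ t) : Ex q (fun x => X x * Z x) = 0 := by
  obtain ⟨X', h1, h2⟩ := h
  have h3 := Ex_mul_of_dep q (chi_dep q e) (dep_mul h1 hZ) (by simp [het])
  simp only [h2, mul_assoc]
  rw [h3, chi_mean, zero_mul]

lemma core_zero' {q : ι → ℝ} {X : (ι → Bool) → ℝ} {s : Finset ι} {e : ι}
    (h : CoreAt q X s e) : Ex q X = 0 := by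
  have := core_zero h (Z := fun _ => 1) (t := ∅) (fun _ _ _ => rfl) (by simp)
  simpa using this

lemma Ex_var (q : ι → ℝ) (f) : Ex q (fun x => (f x - Ex q f)^2) = Ex q (fun x => f x ^ 2) - (Ex q f)^2 := by
  have : ∀ x, (f x - Ex q f)^2 = f x ^ 2 - (2 * Ex q f) * f x + (Ex q f)^2 := fun x => by ring
  simp_rw [this]
  rw [Ex_add, Ex_sub, Ex_smul, Ex_const]; ring

open Classical in
lemma var_le {τ : Type*} (q : ι → ℝ) (hq : PQ q) (J : Finset τ) (c : τ → ℝ)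
    (X : τ → (ι → Bool) → ℝ) (supp core : τ → Finset ι) (D : τ → Prop)
    (hX : ∀ t ∈ J, ∀ x, |X t x| ≤ 1) (hc : ∀ t ∈ J, |c t| ≤ 1)
    (hdep : ∀ t ∈ J, DependsOn (X t) (supp t : Set ι))
    (hcore : ∀ t ∈ J, D t → ∀ e ∈ core t, CoreAt q (X t) (supp t) e) (M P : ℕ)
    (hM : ∀ t' ∈ J, (J.filter fun t => D t ∧ core t ⊆ supp t').card ≤ M)
    (hP : ∀ t' ∈ J, ¬ D t' → (J.filter fun t => ¬ D t ∧ ¬ Disjoint (supp t') (supp t)).card ≤ P) :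
    Ex q (fun x => (∑ t ∈ J, c t * X t x - Ex q (fun x => ∑ t ∈ J, c t * X t x)) ^ 2)
      ≤ 2 * (2 * (J.card * M) + (J.filter fun t => ¬ D t).card * P : ℕ) := by
  rw [Ex_var]
  have e1 : ∀ x, (∑ t ∈ J, c t * X t x)^2 = ∑ z ∈ J ×ˢ J, (c z.1 * c z.2) * (X z.1 x * X z.2 x) := fun x => by
    rw [sq, Finset.sum_mul_sum, Finset.sum_product]
    exact Finset.sum_congr rfl fun a _ => Finset.sum_congr rfl fun b _ => by ring
  have e2 : (Ex q (fun x => ∑ t ∈ J, c t * X t x))^2 = ∑ z ∈ J ×ˢ J, (c z.1 * c z.2) * (Ex q (X z.1) * Ex q (X z.2)) := by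
    rw [Ex_sum, sq, Finset.sum_mul_sum, Finset.sum_product]
    exact Finset.sum_congr rfl fun a _ => Finset.sum_congr rfl fun b _ => by rw [Ex_smul, Ex_smul]; ring
  simp_rw [e1]
  rw [Ex_sum, e2, ← Finset.sum_sub_distrib]
  set U1 := (J ×ˢ J).filter fun z => D z.1 ∧ core z.1 ⊆ supp z.2
  set U2 := (J ×ˢ J).filter fun z => D z.2 ∧ core z.2 ⊆ supp z.1
  set U3 := (J ×ˢ J).filter fun z => ¬ D z.1 ∧ ¬ D z.2 ∧ ¬ Disjoint (supp z.1) (supp z.2)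
  have hEX : ∀ t ∈ J, |Ex q (X t)| ≤ 1 := fun t ht => Ex_abs_le hq (hX t ht)
  have hb : ∀ z ∈ J ×ˢ J, Ex q (fun x => (c z.1 * c z.2) * (X z.1 x * X z.2 x)) - (c z.1 * c z.2) * (Ex q (X z.1) * Ex q (X z.2))
      ≤ if z ∈ U1 ∪ U2 ∪ U3 then 2 else 0 := by
    rintro ⟨t, t'⟩ hz
    obtain ⟨ht, ht'⟩ := Finset.mem_product.1 hz
    simp only at ht ht'
    rw [Ex_smul, ← mul_sub]
    split_ifs with hU
    · have h1 : |Ex q (fun x => X t x * X t' x)| ≤ 1 := Ex_abs_le hq fun x => by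
        rw [abs_mul]; exact mul_le_one₀ (hX t ht x) (abs_nonneg _) (hX t' ht' x)
      have h2 : |Ex q (X t) * Ex q (X t')| ≤ 1 := by
        rw [abs_mul]; exact mul_le_one₀ (hEX t ht) (abs_nonneg _) (hEX t' ht')
      have h3 : |c t * c t'| ≤ 1 := by
        rw [abs_mul]; exact mul_le_one₀ (hc t ht) (abs_nonneg _) (hc t' ht')
      refine (le_abs_self _).trans ?_
      rw [abs_mul]
      calc _ ≤ 1 * (1 + 1) := mul_le_mul h3 ((abs_sub _ _).trans (add_le_add h1 h2)) (abs_nonneg _) zero_le_one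
        _ = 2 := by norm_num
    · have : Ex q (fun x => X t x * X t' x) = Ex q (X t) * Ex q (X t') := by
        by_cases hD : D t
        · have hns : ¬ core t ⊆ supp t' := fun hs => hU (by simp [U1, ht, ht', hD, hs])
          obtain ⟨e, he, he'⟩ := Finset.not_subset.1 hns
          rw [core_zero (hcore t ht hD e he) (hdep t' ht') he', core_zero' (hcore t ht hD e he), zero_mul]
        · by_cases hD' : D t'
          · have hns : ¬ core t' ⊆ supp t := fun hs => hU (by simp [U2, ht, ht', hD', hs])
            obtain ⟨e, he, he'⟩ := Finset.not_subset.1 hns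
            have := core_zero (hcore t' ht' hD' e he) (hdep t ht) he'
            simp_rw [mul_comm (X t _)]
            rw [this, core_zero' (hcore t' ht' hD' e he), mul_zero]
          · exact Ex_mul_of_dep q (hdep t ht) (hdep t' ht') (by
              by_contra hdj
              exact hU (by simp [U3, ht, ht', hD, hD', hdj]))
      simp only
      rw [this, sub_self, mul_zero]
  refine (Finset.sum_le_sum hb).trans ?_
  rw [← Finset.sum_filter, Finset.sum_const, nsmul_eq_mul, mul_comm]
  gcongr
  have c1 : U1.card ≤ J.card * M := by
    have : U1.card ≤ ∑ t' ∈ J, (J.filter fun t => D t ∧ core t ⊆ supp t').card := by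
      rw [← Finset.card_sigma]
      refine Finset.card_le_card_of_injOn (fun z => ⟨z.2, z.1⟩) ?_ ?_
      · rintro ⟨t, t'⟩ hz; simp [U1] at hz ⊢; tauto
      · rintro ⟨t, t'⟩ _ ⟨s, s'⟩ _ h; simp at h; simp [h]
    exact this.trans (by simpa using Finset.sum_le_card_nsmul J _ M hM)
  have c2 : U2.card ≤ J.card * M := by
    have : U2.card ≤ ∑ t' ∈ J, (J.filter fun t => D t ∧ core t ⊆ supp t').card := by
      rw [← Finset.card_sigma]
      refine Finset.card_le_card_of_injOn (fun z => ⟨z.1, z.2⟩) ?_ ?_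
      · rintro ⟨t, t'⟩ hz; simp [U2] at hz ⊢; tauto
      · rintro ⟨t, t'⟩ _ ⟨s, s'⟩ _ h; simp at h; simp [h]
    exact this.trans (by simpa using Finset.sum_le_card_nsmul J _ M hM)
  have c3 : U3.card ≤ (J.filter fun t => ¬ D t).card * P := by
    have : U3.card ≤ ∑ t' ∈ J.filter (fun t => ¬ D t), (J.filter fun t => ¬ D t ∧ ¬ Disjoint (supp t') (supp t)).card := by
      rw [← Finset.card_sigma]
      refine Finset.card_le_card_of_injOn (fun z => ⟨z.1, z.2⟩) ?_ ?_
      · rintro ⟨t, t'⟩ hz; simp [U3] at hz ⊢; tauto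
      · rintro ⟨t, t'⟩ _ ⟨s, s'⟩ _ h; simp at h; simp [h]
    refine this.trans ?_
    have := Finset.sum_le_card_nsmul (J.filter (fun t => ¬ D t)) (fun t' => (J.filter fun t => ¬ D t ∧ ¬ Disjoint (supp t') (supp t)).card) P
      (fun t' ht' => hP t' (Finset.mem_filter.1 ht').1 (Finset.mem_filter.1 ht').2)
    simpa using this
  have hsub : (Finset.filter (fun a => a ∈ U1 ∪ U2 ∪ U3) (J ×ˢ J)).card ≤ U1.card + U2.card + U3.card := by
    refine (Finset.card_le_card (t := U1 ∪ U2 ∪ U3) fun z hz => (Finset.mem_filter.1 hz).2).trans ?_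
    exact (Finset.card_union_le _ _).trans (by gcongr; exact Finset.card_union_le _ _)
  omega
end VarLemma

section HGraph
variable {G : Type*} [Fintype G] [DecidableEq G] {κ : Type*} [Fintype κ] [DecidableEq κ]

/-- hypergraph with bounded edge sizes and bounded pair degrees -/
structure HG (S : κ → Finset G) (k K : ℕ) : Prop where
  c3 : ∀ e, 3 ≤ (S e).card
  ck : ∀ e, (S e).card ≤ k
  pr : ∀ a b, a ≠ b → (Finset.univ.filter fun e => a ∈ S e ∧ b ∈ S e).card ≤ K

/-- edges through two points -/
def E2 (S : κ → Finset G) (a b : G) : Finset κ := Finset.univ.filter fun e => a ∈ S e ∧ b ∈ S e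

/-- relevant pairs of edges -/
def gd (S : κ → Finset G) (i j : G) (t : κ × κ) : Prop :=
  i ≠ j ∧ i ∈ S t.1 ∧ j ∉ S t.1 ∧ ((i ∈ S t.2 ∧ j ∉ S t.2) ∨ (j ∈ S t.2 ∧ i ∉ S t.2))

/-- disjointness off the two points -/
def Dp (S : κ → Finset G) (i j : G) (t : κ × κ) : Prop := Disjoint (S t.1 \ {i, j}) (S t.2 \ {i, j})

/-- edges meeting Z twice -/
def Q1 (S : κ → Finset G) (Z : Finset G) : Finset κ := Finset.univ.filter fun e => 2 ≤ (S e ∩ Z).card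

variable {S : κ → Finset G} {k K : ℕ}

lemma HG.e2 (h : HG S k K) {a b : G} (hab : a ≠ b) : (E2 S a b).card ≤ K := h.pr a b hab

lemma mem_E2 {a b : G} {e : κ} : e ∈ E2 S a b ↔ a ∈ S e ∧ b ∈ S e := by simp [E2]

lemma HG.q1 (h : HG S k K) (Z : Finset G) : (Q1 S Z).card ≤ Z.card * Z.card * K := by
  have hs : Q1 S Z ⊆ Z.offDiag.biUnion fun z => E2 S z.1 z.2 := by
    intro e he
    simp only [Q1, Finset.mem_filter] at he
    obtain ⟨a, ha, b, hb, hab⟩ := Finset.one_lt_card.1 he.2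
    simp only [Finset.mem_inter] at ha hb
    simp only [Finset.mem_biUnion, Finset.mem_offDiag, mem_E2]
    exact ⟨(a, b), ⟨ha.2, hb.2, hab⟩, ha.1, hb.1⟩
  refine (Finset.card_le_card hs).trans ((Finset.card_biUnion_le_card_mul _ _ K ?_).trans ?_)
  · intro z hz; exact h.e2 (Finset.mem_offDiag.1 hz).2.2
  · gcongr; rw [Finset.offDiag_card]; omega

lemma HG.all (h : HG S k K) : Fintype.card κ ≤ Fintype.card G * Fintype.card G * K := by
  have := h.q1 Finset.univ
  rw [Finset.card_univ] at this
  refine le_trans (le_of_eq ?_) this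
  rw [← Finset.card_univ]; congr 1
  symm; rw [Finset.eq_univ_iff_forall]; intro e
  have := h.c3 e
  simp [Q1]; omega

lemma HG.e1 (h : HG S k K) (a : G) : (Finset.univ.filter fun e => a ∈ S e).card ≤ Fintype.card G * K := by
  have hs : (Finset.univ.filter fun e => a ∈ S e) ⊆ (Finset.univ.erase a).biUnion fun b => E2 S a b := by
    intro e he
    simp only [Finset.mem_filter, Finset.mem_univ, true_and] at he
    have := h.c3 e
    obtain ⟨b, hb, hab⟩ := Finset.exists_mem_ne (by omega : 1 < (S e).card) a
    simp only [Finset.mem_biUnion, Finset.mem_erase, mem_E2]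
    exact ⟨b, ⟨hab, Finset.mem_univ _⟩, he, hb⟩
  refine (Finset.card_le_card hs).trans ((Finset.card_biUnion_le_card_mul _ _ K ?_).trans ?_)
  · intro z hz; exact h.e2 (Finset.mem_erase.1 hz).1.symm
  · gcongr; exact (Finset.card_le_univ _)

open Classical in
lemma HG.p0 (h : HG S k K) (i j : G) : (Finset.univ.filter fun t => gd S i j t).card ≤ 2 * K ^ 2 * Fintype.card G ^ 2 := by
  have hs : (Finset.univ.filter fun t => gd S i j t) ⊆
      (Finset.univ.filter fun e => i ∈ S e) ×ˢ ((Finset.univ.filter fun e => i ∈ S e) ∪ (Finset.univ.filter fun e => j ∈ S e)) := by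
    intro t ht
    replace ht := (Finset.mem_filter.1 ht).2
    simp only [gd, Finset.mem_filter, Finset.mem_univ, true_and, Finset.mem_product, Finset.mem_union] at ht ⊢
    tauto
  refine (Finset.card_le_card hs).trans ?_
  rw [Finset.card_product]
  calc _ ≤ (Fintype.card G * K) * (Fintype.card G * K + Fintype.card G * K) := by
        gcongr
        · exact h.e1 i
        · exact (Finset.card_union_le _ _).trans (by gcongr <;> exact h.e1 _)
    _ = _ := by ring

open Classical in
lemma HG.p2 (h : HG S k K) (i j : G) :
    (Finset.univ.filter fun t => gd S i j t ∧ ¬ Dp S i j t).card ≤ 2 * K ^ 2 * Fintype.card G := by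
  have hs : (Finset.univ.filter fun t => gd S i j t ∧ ¬ Dp S i j t) ⊆
      (Finset.univ \ {i, j}).biUnion fun a => E2 S a i ×ˢ (E2 S a i ∪ E2 S a j) := by
    intro t ht
    replace ht := (Finset.mem_filter.1 ht).2
    simp only [gd, Dp] at ht
    obtain ⟨a, ha1, ha2⟩ := Finset.not_disjoint_iff.1 ht.2
    simp only [Finset.mem_biUnion, Finset.mem_sdiff, Finset.mem_univ, true_and, Finset.mem_product, Finset.mem_union, mem_E2] at *
    exact ⟨a, ha1.2, by tauto⟩
  refine (Finset.card_le_card hs).trans ((Finset.card_biUnion_le_card_mul _ _ (K * (K + K)) ?_).trans ?_)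
  · intro a ha
    simp only [Finset.mem_sdiff, Finset.mem_univ, true_and, Finset.mem_insert, Finset.mem_singleton, not_or] at ha
    rw [Finset.card_product]
    exact Nat.mul_le_mul (h.e2 ha.1) ((Finset.card_union_le _ _).trans (add_le_add (h.e2 ha.1) (h.e2 ha.2)))
  · calc _ ≤ Fintype.card G * (K * (K + K)) := by gcongr; exact Finset.card_le_univ _
      _ = _ := by ring

open Classical in
lemma HG.p3 (h : HG S k K) (i j g : G) (hgi : g ≠ i) (hgj : g ≠ j) :
    (Finset.univ.filter fun t => gd S i j t ∧ ¬ Dp S i j t ∧ g ∈ S t.1 ∪ S t.2).card ≤ 4 * k * K ^ 2 := by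
  have hs : (Finset.univ.filter fun t => gd S i j t ∧ ¬ Dp S i j t ∧ g ∈ S t.1 ∪ S t.2) ⊆
      ((E2 S g i).biUnion fun e => (S e \ {i, j}).biUnion fun a => {e} ×ˢ (E2 S a i ∪ E2 S a j)) ∪
      ((E2 S g i ∪ E2 S g j).biUnion fun e => (S e \ {i, j}).biUnion fun a => (E2 S a i) ×ˢ {e}) := by
    rintro ⟨e, e'⟩ ht
    replace ht := (Finset.mem_filter.1 ht).2
    simp only [gd, Dp] at ht
    obtain ⟨a, ha1, ha2⟩ := Finset.not_disjoint_iff.1 ht.2.1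
    simp only [Finset.mem_biUnion, Finset.mem_sdiff, Finset.mem_univ, true_and, Finset.mem_product, Finset.mem_union, mem_E2, Finset.mem_singleton] at *
    rcases ht.2.2 with hg | hg
    · left; exact ⟨e, ⟨hg, ht.1.2.1⟩, a, ha1, rfl, by tauto⟩
    · right; exact ⟨e', by tauto, a, ha2, by tauto, rfl⟩
  have hsd : ∀ e, (S e \ {i, j}).card ≤ k := fun e => (Finset.card_le_card Finset.sdiff_subset).trans (h.ck e)
  refine (Finset.card_le_card hs).trans ((Finset.card_union_le _ _).trans ?_)
  have b1 : ((E2 S g i).biUnion fun e => (S e \ {i, j}).biUnion fun a => {e} ×ˢ (E2 S a i ∪ E2 S a j)).card ≤ K * (k * (1 * (K + K))) := by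
    refine (Finset.card_biUnion_le_card_mul _ _ (k * (1 * (K + K))) fun e he => ?_).trans (by gcongr; exact h.e2 hgi)
    refine (Finset.card_biUnion_le_card_mul _ _ (1 * (K + K)) fun a ha => ?_).trans (by gcongr; exact hsd e)
    simp only [Finset.mem_sdiff, Finset.mem_insert, Finset.mem_singleton, not_or] at ha
    rw [Finset.card_product, Finset.card_singleton]
    gcongr
    exact ((Finset.card_union_le _ _).trans (add_le_add (h.e2 ha.2.1) (h.e2 ha.2.2)))
  have b2 : ((E2 S g i ∪ E2 S g j).biUnion fun e => (S e \ {i, j}).biUnion fun a => (E2 S a i) ×ˢ {e}).card ≤ (K + K) * (k * (K * 1)) := by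
    refine (Finset.card_biUnion_le_card_mul _ _ (k * (K * 1)) fun e he => ?_).trans (by
      gcongr; exact ((Finset.card_union_le _ _).trans (add_le_add (h.e2 hgi) (h.e2 hgj))))
    refine (Finset.card_biUnion_le_card_mul _ _ (K * 1) fun a ha => ?_).trans (by gcongr; exact hsd e)
    simp only [Finset.mem_sdiff, Finset.mem_insert, Finset.mem_singleton, not_or] at ha
    rw [Finset.card_product, Finset.card_singleton]
    gcongr
    exact (h.e2 ha.2.1)
  calc _ ≤ _ := add_le_add b1 b2
    _ = _ := by ring

lemma two_le_of_sub (h : HG S k K) {i j : G} {e : κ} {Z : Finset G} (h1 : ¬ (i ∈ S e ∧ j ∈ S e))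
    (hZ : S e \ {i, j} ⊆ Z) : e ∈ Q1 S Z := by
  simp only [Q1, Finset.mem_filter, Finset.mem_univ, true_and]
  have h3 := h.c3 e
  have : 2 ≤ (S e \ {i, j}).card := by
    have : S e ∩ {i, j} ⊆ {i} ∨ S e ∩ {i, j} ⊆ {j} := by
      by_cases hi : i ∈ S e
      · left; intro g hg
        simp only [Finset.mem_inter, Finset.mem_insert, Finset.mem_singleton] at hg ⊢
        rcases hg.2 with rfl | rfl
        · rfl
        · exact absurd ⟨hi, hg.1⟩ h1
      · right; intro g hg
        simp only [Finset.mem_inter, Finset.mem_insert, Finset.mem_singleton] at hg ⊢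
        rcases hg.2 with rfl | rfl
        · exact absurd hg.1 hi
        · rfl
    have h4 : (S e ∩ {i, j}).card ≤ 1 := by
      rcases this with h | h <;> simpa using Finset.card_le_card h
    have := Finset.card_sdiff_add_card_inter (S e) {i, j}
    omega
  refine this.trans (Finset.card_le_card ?_)
  intro g hg
  exact Finset.mem_inter.2 ⟨(Finset.mem_sdiff.1 hg).1, hZ hg⟩

/-- monomial -/
noncomputable def mon (p : ℝ) (A : Finset G) (x : G → Bool) : ℝ := ∏ i ∈ A, chi (fun _ => p) i x

variable {p : ℝ}
lemma mon_abs (hp : 0 ≤ p ∧ p ≤ 1) (A : Finset G) (x) : |mon p A x| ≤ 1 := by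
  unfold mon; rw [Finset.abs_prod]
  exact Finset.prod_le_one (fun _ _ => abs_nonneg _) fun i _ => chi_abs (fun _ => hp) i x

lemma mon_dep (A : Finset G) : DependsOn (mon p A) (A : Set G) := by
  have := dep_prod A (fun i => chi (fun _ : G => p) i) (fun i => {i}) fun i _ => chi_dep _ i
  rwa [Finset.biUnion_singleton_eq_self] at this

lemma mon_erase {A : Finset G} {e : G} (he : e ∈ A) (x) : mon p A x = chi (fun _ => p) e x * mon p (A.erase e) x := by
  unfold mon; exact (Finset.mul_prod_erase _ _ he).symm

/-- core condition for products of disjoint monomials with an extra factor -/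
lemma core_mon {A B C : Finset G} {W : (G → Bool) → ℝ} (hAB : Disjoint A B) (hW : DependsOn W (C : Set G))
    (hC : Disjoint C (A ∪ B)) {e : G} (he : e ∈ A ∪ B) :
    CoreAt (fun _ => p) (fun x => W x * (mon p A x * mon p B x)) (C ∪ (A ∪ B)) e := by
  have heC : e ∉ C := fun h => Finset.disjoint_left.1 hC h he
  rcases Finset.mem_union.1 he with h | h
  · refine ⟨fun x => W x * (mon p (A.erase e) x * mon p B x), ?_, fun x => by simp only [mon_erase h]; ring⟩
    refine dep_mono (dep_mul hW (dep_mul (mon_dep _) (mon_dep _))) ?_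
    have : e ∉ B := Finset.disjoint_left.1 hAB h
    intro g hg
    simp only [Finset.mem_union, Finset.mem_erase, Finset.mem_sdiff, Finset.mem_singleton] at hg ⊢
    refine ⟨by tauto, ?_⟩
    rintro rfl; tauto
  · refine ⟨fun x => W x * (mon p A x * mon p (B.erase e) x), ?_, fun x => by simp only [mon_erase h]; ring⟩
    refine dep_mono (dep_mul hW (dep_mul (mon_dep _) (mon_dep _))) ?_
    have : e ∉ A := Finset.disjoint_right.1 hAB h
    intro g hg
    simp only [Finset.mem_union, Finset.mem_erase, Finset.mem_sdiff, Finset.mem_singleton] at hg ⊢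
    refine ⟨by tauto, ?_⟩
    rintro rfl; tauto
end HGraph

section HEst
variable {G : Type*} [Fintype G] [DecidableEq G] {κ : Type*} [Fintype κ] [DecidableEq κ]
variable {S : κ → Finset G} {k K : ℕ} {p : ℝ}

/-- product of two reduced monomials -/
noncomputable def mm (p : ℝ) (S : κ → Finset G) (i j : G) (t : κ × κ) (x : G → Bool) : ℝ :=
  mon p (S t.1 \ {i, j}) x * mon p (S t.2 \ {i, j}) x

lemma mm_abs (hp : 0 ≤ p ∧ p ≤ 1) (i j : G) (t : κ × κ) (x) : |mm p S i j t x| ≤ 1 := by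
  unfold mm; rw [abs_mul]; exact mul_le_one₀ (mon_abs hp _ _) (abs_nonneg _) (mon_abs hp _ _)

lemma mm_core {i j : G} {t : κ × κ} (hD : Dp S i j t) {W : (G → Bool) → ℝ} {C : Finset G} (hW : DependsOn W (C : Set G))
    (hC : C ⊆ {i, j}) {e : G} (he : e ∈ (S t.1 \ {i, j}) ∪ (S t.2 \ {i, j})) :
    CoreAt (fun _ => p) (fun x => W x * mm p S i j t x) (C ∪ ((S t.1 \ {i, j}) ∪ (S t.2 \ {i, j}))) e := by
  refine core_mon hD hW ?_ he
  rw [Finset.disjoint_left]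
  intro g hg hg2
  have := hC hg
  simp only [Finset.mem_union, Finset.mem_sdiff] at hg2
  tauto

lemma gd_mem_q1 (h : HG S k K) {i j : G} {t : κ × κ} (ht : gd S i j t) {Z : Finset G}
    (hZ : (S t.1 \ {i, j}) ∪ (S t.2 \ {i, j}) ⊆ Z) : t.1 ∈ Q1 S Z ∧ t.2 ∈ Q1 S Z := by
  obtain ⟨h1, h2, h3, h4⟩ := ht
  exact ⟨two_le_of_sub h (by tauto) (Finset.union_subset_left hZ), two_le_of_sub h (by tauto) (Finset.union_subset_right hZ)⟩

lemma sd_card (h : HG S k K) (i j : G) (t : κ × κ) : ((S t.1 \ {i, j}) ∪ (S t.2 \ {i, j})).card ≤ 2 * k := by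
  refine (Finset.card_union_le _ _).trans ?_
  have h1 : (S t.1 \ {i, j}).card ≤ k := (Finset.card_le_card Finset.sdiff_subset).trans (h.ck _)
  have h2 : (S t.2 \ {i, j}).card ≤ k := (Finset.card_le_card Finset.sdiff_subset).trans (h.ck _)
  omega

lemma gd_core_ne (h : HG S k K) {i j : G} {t : κ × κ} (ht : gd S i j t) : ((S t.1 \ {i, j}) ∪ (S t.2 \ {i, j})).Nonempty := by
  rw [Finset.nonempty_iff_ne_empty]
  intro h0
  have := (gd_mem_q1 h ht (Z := ∅) (by rw [h0])).1
  simp [Q1] at this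

open Classical in
lemma mean_pair (h : HG S k K) (hp : 0 ≤ p ∧ p ≤ 1) (i j : G) (W : (G → Bool) → ℝ) (hW : DependsOn W (({i, j} : Finset G) : Set G))
    (hW1 : ∀ x, |W x| ≤ 1) (cf : κ × κ → ℝ) (hc : ∀ t, |cf t| ≤ 1) :
    |Ex (fun _ => p) (fun x => ∑ t ∈ Finset.univ.filter (fun t => gd S i j t), cf t * (W x * mm p S i j t x))| ≤ 2 * K ^ 2 * Fintype.card G := by
  rw [Ex_sum]
  have h2 := h.p2 i j
  refine (Finset.abs_sum_le_sum_abs _ _).trans ?_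
  have hb : ∀ t ∈ Finset.univ.filter (fun t => gd S i j t), |Ex (fun _ => p) (fun x => cf t * (W x * mm p S i j t x))| ≤ if ¬ Dp S i j t then 1 else 0 := by
    intro t ht
    replace ht := (Finset.mem_filter.1 ht).2
    by_cases hD : Dp S i j t
    · obtain ⟨e, he⟩ := gd_core_ne h ht
      rw [Ex_smul, core_zero' (mm_core hD hW subset_rfl he), if_neg (not_not.2 hD)]; simp
    · rw [if_pos hD]
      refine Ex_abs_le (fun _ => hp) fun x => ?_
      rw [abs_mul, abs_mul]
      exact mul_le_one₀ (hc t) (by positivity) (mul_le_one₀ (hW1 x) (abs_nonneg _) (mm_abs hp _ _ _ _))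
  refine (Finset.sum_le_sum hb).trans ?_
  rw [← Finset.sum_filter, Finset.filter_filter, Finset.sum_const, nsmul_eq_mul, mul_one]
  exact_mod_cast h2

open Classical in
lemma var_pair (h : HG S k K) (hp : 0 ≤ p ∧ p ≤ 1) (i j : G) (cf : κ × κ → ℝ) (hc : ∀ t, |cf t| ≤ 1) :
    Ex (fun _ => p) (fun x => (∑ t ∈ Finset.univ.filter (fun t => gd S i j t), cf t * mm p S i j t x
      - Ex (fun _ => p) (fun x => ∑ t ∈ Finset.univ.filter (fun t => gd S i j t), cf t * mm p S i j t x)) ^ 2)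
      ≤ 2 * (2 * (2 * K ^ 2 * Fintype.card G ^ 2 * ((2 * k) * (2 * k) * K) ^ 2) + 2 * K ^ 2 * Fintype.card G * (2 * k * (4 * k * K ^ 2)) : ℕ) := by
  refine (var_le (fun _ => p) (fun _ => hp) (Finset.univ.filter (fun t => gd S i j t)) cf (mm p S i j)
    (fun t => (S t.1 \ {i, j}) ∪ (S t.2 \ {i, j})) (fun t => (S t.1 \ {i, j}) ∪ (S t.2 \ {i, j})) (Dp S i j)
    (fun t _ x => mm_abs hp i j t x) (fun t _ => hc t) (fun t _ => dep_mul (mon_dep _) (mon_dep _)) ?_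
    (((2 * k) * (2 * k) * K) ^ 2) (2 * k * (4 * k * K ^ 2)) ?_ ?_).trans ?_
  · intro t _ hD e he
    have := mm_core (p := p) hD (W := fun _ => 1) (C := ∅) (fun _ _ _ => rfl) (by simp) he
    simpa using this
  · intro t' _
    set Z := (S t'.1 \ {i, j}) ∪ (S t'.2 \ {i, j}) with hZ
    have hs : (Finset.univ.filter (fun t => gd S i j t)).filter (fun t => Dp S i j t ∧ (S t.1 \ {i, j}) ∪ (S t.2 \ {i, j}) ⊆ Z) ⊆ Q1 S Z ×ˢ Q1 S Z := by
      intro t ht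
      rw [Finset.filter_filter] at ht
      replace ht := (Finset.mem_filter.1 ht).2
      exact Finset.mem_product.2 (gd_mem_q1 h ht.1 ht.2.2)
    refine (Finset.card_le_card hs).trans ?_
    rw [Finset.card_product, ← sq]
    gcongr
    refine (h.q1 Z).trans ?_
    have := sd_card h i j t'
    gcongr
  · intro t' _ _
    set Z := (S t'.1 \ {i, j}) ∪ (S t'.2 \ {i, j}) with hZ
    have hs : (Finset.univ.filter (fun t => gd S i j t)).filter (fun t => ¬ Dp S i j t ∧ ¬ Disjoint Z ((S t.1 \ {i, j}) ∪ (S t.2 \ {i, j}))) ⊆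
        Z.biUnion fun g => Finset.univ.filter fun t => gd S i j t ∧ ¬ Dp S i j t ∧ g ∈ S t.1 ∪ S t.2 := by
      intro t ht
      rw [Finset.filter_filter] at ht
      replace ht := (Finset.mem_filter.1 ht).2
      obtain ⟨g, hg, hg'⟩ := Finset.not_disjoint_iff.1 ht.2.2
      refine Finset.mem_biUnion.2 ⟨g, hg, Finset.mem_filter.2 ⟨Finset.mem_univ _, ht.1, ht.2.1, ?_⟩⟩
      simp only [Finset.mem_union, Finset.mem_sdiff] at hg' ⊢
      tauto
    refine (Finset.card_le_card hs).trans ((Finset.card_biUnion_le_card_mul _ _ (4 * k * K ^ 2) ?_).trans ?_)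
    · intro g hg
      apply h.p3
      · rintro rfl; simp [hZ] at hg
      · rintro rfl; simp [hZ] at hg
    · gcongr; exact sd_card h i j t'
  · have h0 := h.p0 i j
    have h2 := h.p2 i j
    rw [Finset.filter_filter]
    gcongr

/-- derivative polynomial -/
noncomputable def Ac (p : ℝ) (S : κ → Finset G) (c : κ → ℝ) (i j : G) (x : G → Bool) : ℝ :=
  ∑ e, if i ∈ S e ∧ j ∉ S e then c e * mon p (S e \ {i, j}) x else 0

open Classical in
lemma A_sq_expand (c : κ → ℝ) (i j : G) (hij : i ≠ j) (x) : Ac p S c i j x ^ 2 =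
    ∑ t ∈ Finset.univ.filter (fun t => gd S i j t), (if i ∈ S t.2 then c t.1 * c t.2 else 0) * mm p S i j t x := by
  rw [sq, Ac, Finset.sum_mul_sum, Finset.sum_filter, Fintype.sum_prod_type]
  refine Finset.sum_congr rfl fun e _ => Finset.sum_congr rfl fun e' _ => ?_
  simp only [gd, mm]
  by_cases h1 : i ∈ S e <;> by_cases h2 : j ∈ S e <;> by_cases h3 : i ∈ S e' <;> by_cases h4 : j ∈ S e' <;> simp [h1, h2, h3, h4, hij] <;> ring

lemma A_zero (c : κ → ℝ) (i : G) (x) : Ac p S c i i x = 0 := by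
  unfold Ac; apply Finset.sum_eq_zero; intro e _; rw [if_neg (by tauto)]

lemma A_mom (h : HG S k K) (hp : 0 ≤ p ∧ p ≤ 1) (c : κ → ℝ) (hc : ∀ e, |c e| ≤ 1) (i j : G) :
    Ex (fun _ => p) (fun x => Ac p S c i j x ^ 4) ≤ (8 * K ^ 2 * ((2 * k) * (2 * k) * K) ^ 2 + 4 * K ^ 2 * (2 * k * (4 * k * K ^ 2)) + 4 * K ^ 4 : ℕ) * (Fintype.card G : ℝ) ^ 2 := by
  classical
  by_cases hij : i = j
  · subst hij; simp only [A_zero]; norm_num [Ex_const]; positivity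
  set cf : κ × κ → ℝ := fun t => if i ∈ S t.2 then c t.1 * c t.2 else 0 with hcf
  have hcf1 : ∀ t, |cf t| ≤ 1 := fun t => by
    simp only [hcf]; split_ifs
    · rw [abs_mul]; exact mul_le_one₀ (hc _) (abs_nonneg _) (hc _)
    · simp
  have hv := var_pair h hp i j cf hcf1
  have hm := mean_pair h hp i j (fun _ => 1) (fun _ _ _ => rfl) (by simp) cf hcf1
  simp only [one_mul] at hm
  rw [Ex_var] at hv
  have e1 : ∀ x, Ac p S c i j x ^ 4 = (∑ t ∈ Finset.univ.filter (fun t => gd S i j t), cf t * mm p S i j t x)^2 := fun x => by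
    rw [← A_sq_expand c i j hij]; ring
  simp_rw [e1]
  set m := Ex (fun _ => p) (fun x => ∑ t ∈ Finset.univ.filter (fun t => gd S i j t), cf t * mm p S i j t x)
  have hm2 : m^2 ≤ (2 * K ^ 2 * Fintype.card G)^2 := by rw [← sq_abs]; gcongr
  have hn : (Fintype.card G : ℝ) ≤ (Fintype.card G : ℝ)^2 := by
    exact_mod_cast Nat.le_self_pow (by norm_num) _
  push_cast at hv ⊢
  have hk1 : (4:ℝ) * K ^ 2 * (2 * k * (4 * k * K ^ 2)) * (Fintype.card G : ℝ) ≤ 4 * K ^ 2 * (2 * k * (4 * k * K ^ 2)) * (Fintype.card G : ℝ)^2 := by gcongr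
  nlinarith
end HEst

section GamEst
variable {G : Type*} [Fintype G] [DecidableEq G] {κ : Type*} [Fintype κ] [DecidableEq κ]
variable {S : κ → Finset G} {k K : ℕ} {p : ℝ}

/-- coordinate difference -/
noncomputable def dd (p : ℝ) (i j : G) (x : G → Bool) : ℝ := chi (fun _ => p) i x - chi (fun _ => p) j x

lemma dd_abs (i j : G) (x) : |dd p i j x| ≤ 1 := by
  unfold dd chi; split_ifs <;> simp <;> ring_nf <;> simp

lemma dd_sq_abs (i j : G) (x) : |dd p i j x ^ 2| ≤ 1 := by
  rw [abs_pow]; exact pow_le_one₀ (abs_nonneg _) (dd_abs i j x)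

lemma dd_dep (i j : G) : DependsOn (fun x => dd p i j x ^ 2) (({i, j} : Finset G) : Set G) := by
  intro x y hxy
  have h1 := hxy i (by simp)
  have h2 := hxy j (by simp)
  simp only [dd, chi, h1, h2]

/-- sign -/
def sg (S : κ → Finset G) (i : G) (t : κ × κ) : ℝ := if i ∈ S t.2 then 1 else -1

open Classical in
lemma AA_expand (u y : κ → ℝ) (i j : G) (hij : i ≠ j) (x) : Ac p S u i j x * (Ac p S y i j x - Ac p S y j i x) =
    ∑ t ∈ Finset.univ.filter (fun t => gd S i j t), (sg S i t * (u t.1 * y t.2)) * mm p S i j t x := by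
  unfold Ac
  rw [← Finset.sum_sub_distrib, Finset.sum_mul_sum, Finset.sum_filter, Fintype.sum_prod_type]
  refine Finset.sum_congr rfl fun e _ => Finset.sum_congr rfl fun e' _ => ?_
  simp only [gd, mm, sg, Finset.pair_comm j i]
  by_cases h1 : i ∈ S e <;> by_cases h2 : j ∈ S e <;> by_cases h3 : i ∈ S e' <;> by_cases h4 : j ∈ S e' <;> simp [h1, h2, h3, h4, hij] <;> ring

/-- carre du champ -/
noncomputable def Gam (p : ℝ) (S : κ → Finset G) (u y : κ → ℝ) (x : G → Bool) : ℝ :=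
  ∑ z : G × G, (1/2) * (dd p z.1 z.2 x ^ 2 * (Ac p S u z.1 z.2 x * (Ac p S y z.1 z.2 x - Ac p S y z.2 z.1 x)))

/-- coefficient of the expansion -/
noncomputable def gc (S : κ → Finset G) (u y : κ → ℝ) (τ : (G × G) × (κ × κ)) : ℝ := (1/2) * (sg S τ.1.1 τ.2 * (u τ.2.1 * y τ.2.2))

lemma gc_abs {u y : κ → ℝ} (hu : ∀ e, |u e| ≤ 1) (hy : ∀ e, |y e| ≤ 1) (τ) : |gc S u y τ| ≤ 1 := by
  unfold gc sg
  rw [abs_mul, abs_mul, abs_mul]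
  have : |if τ.1.1 ∈ S τ.2.2 then (1:ℝ) else -1| ≤ 1 := by split_ifs <;> simp
  have h1 := mul_le_one₀ (hu τ.2.1) (abs_nonneg _) (hy τ.2.2)
  have h2 := mul_le_one₀ this (by positivity) h1
  exact mul_le_one₀ (by norm_num) (by positivity) h2

open Classical in
/-- index set of the expansion -/
noncomputable def JJ (S : κ → Finset G) : Finset ((G × G) × (κ × κ)) := Finset.univ.filter fun τ => gd S τ.1.1 τ.1.2 τ.2

lemma mem_JJ {τ : (G × G) × (κ × κ)} : τ ∈ JJ S ↔ gd S τ.1.1 τ.1.2 τ.2 := by simp [JJ]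

open Classical in
lemma Gam_expand0 (u y : κ → ℝ) (x) : Gam p S u y x = ∑ z : G × G, ∑ t ∈ Finset.univ.filter (fun t => gd S z.1 z.2 t),
    gc S u y (z, t) * (dd p z.1 z.2 x ^ 2 * mm p S z.1 z.2 t x) := by
  unfold Gam
  refine Finset.sum_congr rfl fun z _ => ?_
  by_cases hz : z.1 = z.2
  · simp [hz, dd]
  rw [AA_expand _ _ _ _ hz, Finset.mul_sum, Finset.mul_sum]
  refine Finset.sum_congr rfl fun t _ => ?_
  simp only [gc]; ring

lemma Gam_expand (u y : κ → ℝ) (x) : Gam p S u y x = ∑ τ ∈ JJ S, gc S u y τ * (dd p τ.1.1 τ.1.2 x ^ 2 * mm p S τ.1.1 τ.1.2 τ.2 x) := by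
  classical
  rw [Gam_expand0, JJ, Finset.sum_filter, Fintype.sum_prod_type (f := fun τ : (G × G) × (κ × κ) => _)]
  refine Finset.sum_congr rfl fun z _ => ?_
  rw [Finset.sum_filter]

lemma Gam_mean_upper (h : HG S k K) (hp : 0 ≤ p ∧ p ≤ 1) {u y : κ → ℝ} (hu : ∀ e, |u e| ≤ 1) (hy : ∀ e, |y e| ≤ 1) :
    |Ex (fun _ => p) (Gam p S u y)| ≤ 2 * K ^ 2 * (Fintype.card G : ℝ) ^ 3 := by
  classical
  have : Gam p S u y = fun x => _ := funext fun x => Gam_expand0 (p := p) (S := S) u y x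
  rw [this, Ex_sum]
  refine (Finset.abs_sum_le_sum_abs _ _).trans ?_
  refine (Finset.sum_le_card_nsmul _ _ (2 * K ^ 2 * (Fintype.card G : ℝ)) fun z _ => ?_).trans ?_
  · exact mean_pair h hp z.1 z.2 (fun x => dd p z.1 z.2 x ^ 2) (dd_dep _ _) (dd_sq_abs _ _) (fun t => gc S u y (z, t)) fun t => gc_abs hu hy _
  · simp only [nsmul_eq_mul, Finset.card_univ, Fintype.card_prod]; push_cast; apply le_of_eq; ring

open Classical in
lemma card_fib {α β : Type*} [Fintype α] [Fintype β] (P : α → β → Prop) (b : ℕ) (A : Finset α)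
    (h : ∀ a ∈ A, (Finset.univ.filter fun t => P a t).card ≤ b) :
    (Finset.univ.filter fun τ : α × β => τ.1 ∈ A ∧ P τ.1 τ.2).card ≤ A.card * b := by
  have hs : (Finset.univ.filter fun τ : α × β => τ.1 ∈ A ∧ P τ.1 τ.2) ⊆ A.biUnion fun a => {a} ×ˢ (Finset.univ.filter fun t => P a t) := by
    rintro ⟨a, t⟩ ht
    simp only [Finset.mem_filter, Finset.mem_univ, true_and] at ht
    simp [ht]
  refine (Finset.card_le_card hs).trans (Finset.card_biUnion_le_card_mul _ _ _ fun a ha => ?_)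
  rw [Finset.card_product, Finset.card_singleton, one_mul]; exact h a ha

/-- full support -/
def fs (S : κ → Finset G) (τ : (G × G) × (κ × κ)) : Finset G :=
  {τ.1.1, τ.1.2} ∪ ((S τ.2.1 \ {τ.1.1, τ.1.2}) ∪ (S τ.2.2 \ {τ.1.1, τ.1.2}))

lemma fs_card (h : HG S k K) (τ) : (fs S τ).card ≤ 2 * k + 2 := by
  unfold fs
  refine (Finset.card_union_le _ _).trans ?_
  have := sd_card h τ.1.1 τ.1.2 τ.2
  have h2 : ({τ.1.1, τ.1.2} : Finset G).card ≤ 2 := Finset.card_le_two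
  omega

open Classical in
lemma Gam_var (h : HG S k K) (hp : 0 ≤ p ∧ p ≤ 1) {u y : κ → ℝ} (hu : ∀ e, |u e| ≤ 1) (hy : ∀ e, |y e| ≤ 1) :
    Ex (fun _ => p) (fun x => (Gam p S u y x - Ex (fun _ => p) (Gam p S u y)) ^ 2)
      ≤ (2 * (2 * (2 * K ^ 2 * (((2 * k + 2) * (2 * k + 2) * K) ^ 2 * k)) + 2 * K ^ 2 * ((2 * k + 2) * (4 * k * K ^ 2 + 4 * K ^ 2))) : ℕ) * (Fintype.card G : ℝ) ^ 5 := by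
  have hG : Gam p S u y = fun x => _ := funext fun x => Gam_expand (p := p) (S := S) u y x
  rw [hG]
  set n := Fintype.card G with hn
  refine (var_le (fun _ => p) (fun _ => hp) (JJ S) (gc S u y) (fun τ x => dd p τ.1.1 τ.1.2 x ^ 2 * mm p S τ.1.1 τ.1.2 τ.2 x)
    (fs S) (fun τ => (S τ.2.1 \ {τ.1.1, τ.1.2}) ∪ (S τ.2.2 \ {τ.1.1, τ.1.2})) (fun τ => Dp S τ.1.1 τ.1.2 τ.2)
    ?_ (fun t _ => gc_abs hu hy t) ?_ ?_
    (((2 * k + 2) * (2 * k + 2) * K) ^ 2 * (k * n)) ((2 * k + 2) * ((4 * k * K ^ 2 + 4 * K ^ 2) * n ^ 2)) ?_ ?_).trans ?_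
  · intro τ _ x
    rw [abs_mul]; exact mul_le_one₀ (dd_sq_abs _ _ _) (abs_nonneg _) (mm_abs hp _ _ _ _)
  · intro τ _
    exact dep_mul (dd_dep _ _) (dep_mul (mon_dep _) (mon_dep _))
  · intro τ _ hD e he
    exact mm_core hD (dd_dep _ _) subset_rfl he
  · intro τ' _
    set Z := fs S τ' with hZ
    have hs : (JJ S).filter (fun τ => Dp S τ.1.1 τ.1.2 τ.2 ∧ (S τ.2.1 \ {τ.1.1, τ.1.2}) ∪ (S τ.2.2 \ {τ.1.1, τ.1.2}) ⊆ Z) ⊆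
        (Q1 S Z ×ˢ Q1 S Z).biUnion fun t => (S t.1 ×ˢ (Finset.univ : Finset G)) ×ˢ {t} := by
      rintro ⟨⟨i, j⟩, t⟩ ht
      obtain ⟨h1, h2, h3⟩ := Finset.mem_filter.1 ht
      rw [mem_JJ] at h1
      refine Finset.mem_biUnion.2 ⟨t, Finset.mem_product.2 (gd_mem_q1 h h1 h3), ?_⟩
      simp only [Finset.mem_product, Finset.mem_univ, Finset.mem_singleton, and_true]
      exact h1.2.1
    refine (Finset.card_le_card hs).trans ((Finset.card_biUnion_le_card_mul _ _ (k * n) ?_).trans ?_)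
    · intro t _
      rw [Finset.card_product, Finset.card_product, Finset.card_singleton, mul_one, Finset.card_univ]
      gcongr; exact h.ck _
    · rw [Finset.card_product, ← sq]
      gcongr
      refine (h.q1 Z).trans ?_
      have := fs_card h τ'
      gcongr
  · intro τ' _ _
    set Z := fs S τ' with hZ
    have hs : (JJ S).filter (fun τ => ¬ Dp S τ.1.1 τ.1.2 τ.2 ∧ ¬ Disjoint Z (fs S τ)) ⊆
        Z.biUnion fun g => 
          (Finset.univ.filter fun τ : (G × G) × (κ × κ) => τ.1 ∈ (Finset.univ.filter fun z : G × G => g ≠ z.1 ∧ g ≠ z.2) ∧ (gd S τ.1.1 τ.1.2 τ.2 ∧ ¬ Dp S τ.1.1 τ.1.2 τ.2 ∧ g ∈ S τ.2.1 ∪ S τ.2.2)) ∪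
          (Finset.univ.filter fun τ : (G × G) × (κ × κ) => τ.1 ∈ (({g} : Finset G) ×ˢ (Finset.univ : Finset G) ∪ (Finset.univ : Finset G) ×ˢ ({g} : Finset G)) ∧ (gd S τ.1.1 τ.1.2 τ.2 ∧ ¬ Dp S τ.1.1 τ.1.2 τ.2)) := by
      rintro ⟨⟨i, j⟩, t⟩ ht
      obtain ⟨h1, h2, h3⟩ := Finset.mem_filter.1 ht
      rw [mem_JJ] at h1
      obtain ⟨g, hg, hg'⟩ := Finset.not_disjoint_iff.1 h3
      refine Finset.mem_biUnion.2 ⟨g, hg, ?_⟩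
      rw [Finset.mem_union, Finset.mem_filter, Finset.mem_filter]
      simp only [fs, Finset.mem_union, Finset.mem_sdiff, Finset.mem_insert, Finset.mem_singleton] at hg'
      simp only at h1 h2
      simp only [Finset.mem_univ, true_and, Finset.mem_filter, Finset.mem_union, Finset.mem_product, Finset.mem_singleton, and_true, h1, h2, not_false_eq_true]
      by_cases hgi : g = i
      · right; left; exact hgi.symm
      · by_cases hgj : g = j
        · right; right; exact hgj.symm
        · left; exact ⟨⟨hgi, hgj⟩, by tauto⟩
    refine (Finset.card_le_card hs).trans ((Finset.card_biUnion_le_card_mul _ _ ((4 * k * K ^ 2 + 4 * K ^ 2) * n ^ 2) ?_).trans ?_)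
    · intro g _
      refine (Finset.card_union_le _ _).trans ?_
      have b1 := card_fib (fun (z : G × G) t => gd S z.1 z.2 t ∧ ¬ Dp S z.1 z.2 t ∧ g ∈ S t.1 ∪ S t.2) (4 * k * K ^ 2)
        (Finset.univ.filter fun z : G × G => g ≠ z.1 ∧ g ≠ z.2) fun z hz => by
          have := (Finset.mem_filter.1 hz).2
          convert h.p3 z.1 z.2 g this.1 this.2
      have b2 := card_fib (fun (z : G × G) t => gd S z.1 z.2 t ∧ ¬ Dp S z.1 z.2 t) (2 * K ^ 2 * n)
        (({g} : Finset G) ×ˢ (Finset.univ : Finset G) ∪ (Finset.univ : Finset G) ×ˢ ({g} : Finset G)) fun z hz => by convert h.p2 z.1 z.2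
      have c1 : (Finset.univ.filter fun z : G × G => g ≠ z.1 ∧ g ≠ z.2).card ≤ n * n := by
        refine (Finset.card_le_univ _).trans ?_
        rw [Fintype.card_prod]
      have c2 : (({g} : Finset G) ×ˢ (Finset.univ : Finset G) ∪ (Finset.univ : Finset G) ×ˢ ({g} : Finset G)).card ≤ n + n := by
        refine (Finset.card_union_le _ _).trans ?_
        simp [Finset.card_product, hn]
      have b3 := b1.trans (Nat.mul_le_mul_right _ c1)
      have b4 := b2.trans (Nat.mul_le_mul_right _ c2)
      have b5 : (4 * k * K ^ 2 + 4 * K ^ 2) * n ^ 2 = n * n * (4 * k * K ^ 2) + (n + n) * (2 * K ^ 2 * n) := by ring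
      rw [b5]
      refine add_le_add ?_ ?_
      · convert b3
      · convert b4
    · gcongr; exact fs_card h τ'
  · have c0 : (JJ S).card ≤ n * n * (2 * K ^ 2 * n ^ 2) := by
      have := card_fib (fun (z : G × G) t => gd S z.1 z.2 t) (2 * K ^ 2 * n ^ 2) Finset.univ fun z _ => h.p0 z.1 z.2
      simp only [Finset.mem_univ, true_and, Finset.card_univ, Fintype.card_prod] at this
      exact this
    have c2 : ((JJ S).filter fun τ => ¬ Dp S τ.1.1 τ.1.2 τ.2).card ≤ n * n * (2 * K ^ 2 * n) := by
      have := card_fib (fun (z : G × G) t => gd S z.1 z.2 t ∧ ¬ Dp S z.1 z.2 t) (2 * K ^ 2 * n) Finset.univ fun z _ => by convert h.p2 z.1 z.2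
      simp only [Finset.mem_univ, true_and, Finset.card_univ, Fintype.card_prod] at this
      rw [JJ, Finset.filter_filter]
      exact this
    have := add_le_add (Nat.mul_le_mul_left 2 (Nat.mul_le_mul_right (((2 * k + 2) * (2 * k + 2) * K) ^ 2 * (k * n)) c0)) (Nat.mul_le_mul_right ((2 * k + 2) * ((4 * k * K ^ 2 + 4 * K ^ 2) * n ^ 2)) c2)
    have h3 : 2 * (2 * ((JJ S).card * (((2 * k + 2) * (2 * k + 2) * K) ^ 2 * (k * n))) + ((JJ S).filter fun τ => ¬ Dp S τ.1.1 τ.1.2 τ.2).card * ((2 * k + 2) * ((4 * k * K ^ 2 + 4 * K ^ 2) * n ^ 2)))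
       ≤ (2 * (2 * (2 * K ^ 2 * (((2 * k + 2) * (2 * k + 2) * K) ^ 2 * k)) + 2 * K ^ 2 * ((2 * k + 2) * (4 * k * K ^ 2 + 4 * K ^ 2)))) * n ^ 5 := by
      refine (Nat.mul_le_mul_left 2 this).trans (le_of_eq ?_)
      ring
    exact_mod_cast h3

end GamEst

section REst
variable {G : Type*} [Fintype G] [DecidableEq G] {κ : Type*} [Fintype κ] [DecidableEq κ]
variable {S : κ → Finset G} {k K : ℕ} {p : ℝ}

/-- index set for the remainder -/
def JR (S : κ → Finset G) : Finset ((G × G) × κ) := Finset.univ.filter fun τ => τ.1.1 ≠ τ.1.2 ∧ τ.1.1 ∈ S τ.2 ∧ τ.1.2 ∈ S τ.2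

/-- remainder terms -/
noncomputable def RX (p : ℝ) (S : κ → Finset G) (τ : (G × G) × κ) (x : G → Bool) : ℝ :=
  (dd p τ.1.1 τ.1.2 x * chi (fun _ => p) τ.1.2 x) * mon p (S τ.2 \ {τ.1.1, τ.1.2}) x

/-- remainder -/
noncomputable def Rr (p : ℝ) (S : κ → Finset G) (u : κ → ℝ) (x : G → Bool) : ℝ := ∑ τ ∈ JR S, u τ.2 * RX p S τ x

lemma dc_dep (i j : G) : DependsOn (fun x => dd p i j x * chi (fun _ => p) j x) (({i, j} : Finset G) : Set G) := by
  intro x y hxy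
  have h1 := hxy i (by simp)
  have h2 := hxy j (by simp)
  simp only [dd, chi, h1, h2]

lemma RX_zero (h : HG S k K) {τ : (G × G) × κ} (hτ : τ ∈ JR S) : Ex (fun _ => p) (RX p S τ) = 0 := by
  obtain ⟨⟨i, j⟩, e⟩ := τ
  have h3 := h.c3 e
  have : (S e \ {i, j}).Nonempty := by
    rw [← Finset.card_pos]
    have h2 : ({i, j} : Finset G).card ≤ 2 := Finset.card_le_two
    have := Finset.le_card_sdiff {i, j} (S e)
    omega
  obtain ⟨g, hg⟩ := this
  have := core_mon (p := p) (A := S e \ {i, j}) (B := ∅) (Finset.disjoint_empty_right _) (dc_dep (p := p) i j) (by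
    rw [Finset.union_empty]; exact Finset.disjoint_sdiff) (e := g) (by simpa using hg)
  have h4 := core_zero' this
  have h5 : RX p S ((i, j), e) = fun x => dd p i j x * chi (fun _ => p) j x * mon p (S e \ {i, j}) x := rfl
  rw [h5]; simpa [mon] using h4

open Classical in
lemma Rr_bound (h : HG S k K) (hp : 0 ≤ p ∧ p ≤ 1) {u : κ → ℝ} (hu : ∀ e, |u e| ≤ 1) :
    Ex (fun _ => p) (fun x => Rr p S u x ^ 2) ≤ (2 * k ^ 5 * K ^ 2 : ℕ) * (Fintype.card G : ℝ) ^ 3 := by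
  set n := Fintype.card G with hn
  have hcard : ∀ A : Finset κ, ((JR S).filter fun τ => τ.2 ∈ A).card ≤ A.card * (k * k) := by
    intro A
    have hs : ((JR S).filter fun τ => τ.2 ∈ A) ⊆ A.biUnion fun e => (S e ×ˢ S e) ×ˢ {e} := by
      rintro ⟨⟨i, j⟩, e⟩ ht
      simp only [JR, Finset.mem_filter, Finset.mem_univ, true_and] at ht
      simp only [Finset.mem_biUnion, Finset.mem_product, Finset.mem_singleton]
      exact ⟨e, ht.2, ht.1.2, rfl⟩
    refine (Finset.card_le_card hs).trans (Finset.card_biUnion_le_card_mul _ _ _ fun e _ => ?_)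
    rw [Finset.card_product, Finset.card_product, Finset.card_singleton, mul_one]
    exact Nat.mul_le_mul (h.ck e) (h.ck e)
  have hJ : (JR S).card ≤ n * n * K * (k * k) := by
    have := hcard Finset.univ
    simp only [Finset.mem_univ, Finset.filter_true, Finset.card_univ] at this
    exact this.trans (Nat.mul_le_mul_right _ h.all)
  have hmean : Ex (fun _ => p) (fun x => ∑ τ ∈ JR S, u τ.2 * RX p S τ x) = 0 := by
    rw [Ex_sum]
    apply Finset.sum_eq_zero; intro τ hτ
    rw [Ex_smul, RX_zero h hτ, mul_zero]
  have hv := var_le (fun _ => p) (fun _ => hp) (JR S) (fun τ => u τ.2) (RX p S) (fun τ => S τ.2) (fun _ => ∅) (fun _ => False)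
    (fun τ _ x => by
      unfold RX
      rw [abs_mul, abs_mul]
      exact mul_le_one₀ (mul_le_one₀ (dd_abs _ _ _) (abs_nonneg _) (chi_abs (fun _ => hp) _ _)) (abs_nonneg _) (mon_abs hp _ _))
    (fun τ _ => hu _)
    (fun τ hτ => by
      refine dep_mono (dep_mul (dc_dep _ _) (mon_dep _)) ?_
      simp only [JR, Finset.mem_filter, Finset.mem_univ, true_and] at hτ
      intro g hg
      simp only [Finset.mem_union, Finset.mem_insert, Finset.mem_singleton, Finset.mem_sdiff] at hg
      rcases hg with (rfl | rfl) | hg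
      · exact hτ.2.1
      · exact hτ.2.2
      · exact hg.1)
    (fun _ _ hf => hf.elim) 0 (k * ((n * K) * (k * k))) (fun _ _ => by simp) (fun τ' _ _ => by
      refine (Finset.card_le_card (t := (S τ'.2).biUnion fun g => (JR S).filter fun τ => τ.2 ∈ Finset.univ.filter fun e => g ∈ S e) (by
        intro τ hτ
        obtain ⟨h1, _, h2⟩ := (@Finset.mem_filter _ _ (_) _ _).1 hτ
        obtain ⟨g, hg, hg'⟩ := Finset.not_disjoint_iff.1 h2
        refine Finset.mem_biUnion.2 ⟨g, hg, Finset.mem_filter.2 ⟨h1, ?_⟩⟩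
        simpa using hg')).trans ((Finset.card_biUnion_le_card_mul _ _ ((n * K) * (k * k)) fun g _ => ?_).trans ?_)
      · refine (hcard _).trans ?_
        gcongr
        exact h.e1 g
      · gcongr; exact h.ck _)
  rw [hmean] at hv
  simp only [sub_zero] at hv
  refine hv.trans ?_
  have h3 : 2 * (2 * ((JR S).card * 0) + ((JR S).filter fun τ => ¬ False).card * (k * ((n * K) * (k * k)))) ≤ 2 * k ^ 5 * K ^ 2 * n ^ 3 := by
    have : ((JR S).filter fun τ => ¬ False).card ≤ n * n * K * (k * k) := (Finset.card_filter_le _ _).trans hJ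
    calc _ ≤ 2 * (2 * ((JR S).card * 0) + (n * n * K * (k * k)) * (k * ((n * K) * (k * k)))) := by gcongr
      _ = _ := by ring
  refine le_trans (le_of_eq ?_) (Nat.cast_le.2 h3 |>.trans (le_of_eq (by push_cast; ring)))
  push_cast
  congr!

lemma Ex_mon_mon (A B : Finset G) : Ex (fun _ => p) (fun x => mon p A x * mon p B x) = if A = B then (p * (1 - p)) ^ A.card else 0 := by
  split_ifs with hAB
  · subst hAB
    have : ∀ x, mon p A x * mon p A x = ∏ i ∈ A, chi (fun _ => p) i x ^ 2 := fun x => by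
      unfold mon; rw [← Finset.prod_mul_distrib]; exact Finset.prod_congr rfl fun _ _ => by ring
    simp_rw [this]
    rw [Ex_prod_of_dep _ A (fun i x => chi (fun _ => p) i x ^ 2) (fun i => {i})]
    · simp [chi_sq]
    · intro i _ x y h; simp only; rw [chi_dep _ i h]
    · intro i _ j _ hij; simpa using hij
  · have key : ∀ A B : Finset G, ∀ e, e ∈ A → e ∉ B → Ex (fun _ => p) (fun x => mon p A x * mon p B x) = 0 := by
      intro A B e he he'
      refine core_zero (s := A) (e := e) ⟨mon p (A.erase e), ?_, fun x => mon_erase he x⟩ (mon_dep B) he'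
      rw [← Finset.erase_eq]; exact mon_dep _
    by_cases hs : A ⊆ B
    · have : ¬ B ⊆ A := fun h => hAB (Finset.Subset.antisymm hs h)
      obtain ⟨e, he, he'⟩ := Finset.not_subset.1 this
      simp_rw [mul_comm (mon p A _)]; exact key B A e he he'
    · obtain ⟨e, he, he'⟩ := Finset.not_subset.1 hs
      exact key A B e he he'

lemma Ex_dd {i j : G} (hij : i ≠ j) : Ex (fun _ => p) (fun x => dd p i j x ^ 2) = 2 * (p * (1 - p)) := by
  have : ∀ x, dd p i j x ^ 2 = chi (fun _ => p) i x ^ 2 + (chi (fun _ => p) j x ^ 2 - 2 * (chi (fun _ => p) i x * chi (fun _ => p) j x)) := fun x => by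
    unfold dd; ring
  simp_rw [this]
  rw [Ex_add, Ex_sub, Ex_smul, chi_sq, chi_sq, Ex_mul_of_dep _ (chi_dep _ i) (chi_dep _ j) (by simpa using hij), chi_mean]
  ring

lemma Ex_dd_mm {i j : G} (hij : i ≠ j) (t : κ × κ) : Ex (fun _ => p) (fun x => dd p i j x ^ 2 * mm p S i j t x) =
    if S t.1 \ {i, j} = S t.2 \ {i, j} then 2 * (p * (1 - p)) ^ ((S t.1 \ {i, j}).card + 1) else 0 := by
  unfold mm
  rw [Ex_mul_of_dep (T := (S t.1 \ {i, j}) ∪ (S t.2 \ {i, j})) _ (dd_dep i j) (dep_mul (mon_dep _) (mon_dep _)), Ex_dd hij, Ex_mon_mon]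
  · split_ifs <;> ring
  · rw [Finset.disjoint_left]; intro g hg hg'
    simp only [Finset.mem_union, Finset.mem_sdiff] at hg'
    tauto

lemma Gam_mean_lower (h : HG S k K) (hp : 0 ≤ p ∧ p ≤ 1) {y : κ → ℝ} (hy : ∀ e, 0 ≤ y e ∧ y e ≤ 1) :
    ((Fintype.card G : ℝ) - k) * (p * (1 - p)) ^ k * ∑ e, y e ^ 2 - (K ^ 2 * k ^ 4 : ℕ) * (Fintype.card G : ℝ) ^ 2
      ≤ Ex (fun _ => p) (Gam p S (fun e => y e / (S e).card) y) := by
  classical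
  set n := Fintype.card G with hn
  set u : κ → ℝ := fun e => y e / (S e).card with hu
  have hu0 : ∀ e, 0 ≤ u e ∧ u e ≤ 1 := fun e => by
    have := h.c3 e
    have h1 : (1:ℝ) ≤ (S e).card := by exact_mod_cast (by omega : 1 ≤ (S e).card)
    refine ⟨div_nonneg (hy e).1 (by positivity), ?_⟩
    exact (div_le_self (hy e).1 h1).trans (hy e).2
  have hpq : 0 ≤ p * (1 - p) := mul_nonneg hp.1 (by linarith [hp.2])
  have hpq1 : p * (1 - p) ≤ 1 := mul_le_one₀ hp.2 (by linarith [hp.2]) (by linarith [hp.1])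
  have hG : Gam p S u y = fun x => ∑ τ ∈ JJ S, gc S u y τ * (dd p τ.1.1 τ.1.2 x ^ 2 * mm p S τ.1.1 τ.1.2 τ.2 x) := funext fun x => Gam_expand (p := p) (S := S) u y x
  rw [hG, Ex_sum]
  set bad : Finset ((G × G) × (κ × κ)) := (JJ S).filter fun τ => τ.1.2 ∈ S τ.2.2 ∧ S τ.2.1 \ {τ.1.1, τ.1.2} = S τ.2.2 \ {τ.1.1, τ.1.2} with hbad
  have hbadc : bad.card ≤ (n * n * K) * (k * (k * k * K) * k) := by
    have hs : bad ⊆ (Finset.univ : Finset κ).biUnion fun e => (S e).biUnion fun i => (Q1 S (S e)).biUnion fun e' => (S e').biUnion fun j => {((i, j), (e, e'))} := by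
      rintro ⟨⟨i, j⟩, e, e'⟩ hτ
      simp only [hbad, Finset.mem_filter, mem_JJ] at hτ
      simp only [Finset.mem_biUnion, Finset.mem_univ, true_and, Finset.mem_singleton]
      refine ⟨e, i, hτ.1.2.1, e', ?_, j, hτ.2.1, rfl⟩
      refine two_le_of_sub h (i := i) (j := j) ?_ ?_
      · have := hτ.1.2.2.2
        simp only at this
        tauto
      · rw [← hτ.2.2]; exact Finset.sdiff_subset
    refine (Finset.card_le_card hs).trans ((Finset.card_biUnion_le_card_mul _ _ (k * (k * k * K) * k) fun e _ => ?_).trans ?_)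
    · rw [mul_assoc]
      refine (Finset.card_biUnion_le_card_mul _ _ ((k * k * K) * k) fun i _ => ?_).trans (by gcongr; exact h.ck e)
      refine (Finset.card_biUnion_le_card_mul _ _ k fun e' _ => ?_).trans ?_
      · refine (Finset.card_biUnion_le_card_mul _ _ 1 fun e' _ => ?_).trans ?_
        · simp
        · rw [mul_one]; exact h.ck e'
      · gcongr
        refine (h.q1 _).trans ?_
        have := h.ck e
        gcongr
    · gcongr; exact h.all
  have hterm : ∀ τ ∈ JJ S, (if τ.2.1 = τ.2.2 then u τ.2.1 * y τ.2.1 * (p * (1 - p)) ^ (S τ.2.1).card else 0) - (if τ ∈ bad then 1 else 0) ≤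
      Ex (fun _ => p) (fun x => gc S u y τ * (dd p τ.1.1 τ.1.2 x ^ 2 * mm p S τ.1.1 τ.1.2 τ.2 x)) := by
    rintro ⟨⟨i, j⟩, e, e'⟩ hτ
    have hb : ((i, j), e, e') ∈ bad ↔ j ∈ S e' ∧ S e \ {i, j} = S e' \ {i, j} := by
      rw [hbad, Finset.mem_filter]; exact and_iff_right hτ
    rw [mem_JJ] at hτ
    obtain ⟨hij, h1, h2, h3⟩ := hτ
    simp only at hij h1 h2 h3
    simp only [hb]
    rw [Ex_smul, Ex_dd_mm hij]
    have hue := hu0 e; have hye := hy e'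
    have huy : 0 ≤ u e * y e' := mul_nonneg hue.1 hye.1
    have huy1 : u e * y e' ≤ 1 := mul_le_one₀ hue.2 hye.1 hye.2
    have hpp : ∀ l : ℕ, 0 ≤ (p * (1 - p)) ^ l ∧ (p * (1 - p)) ^ l ≤ 1 := fun l => ⟨by positivity, pow_le_one₀ hpq hpq1⟩
    simp only [gc, sg]
    by_cases hee : e = e'
    · subst hee
      have hc : (S e \ {i, j}).card + 1 = (S e).card := by
        have : S e \ {i, j} = (S e).erase i := by
          ext g; simp only [Finset.mem_sdiff, Finset.mem_insert, Finset.mem_singleton, Finset.mem_erase]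
          constructor
          · tauto
          · rintro ⟨h5, h6⟩; refine ⟨h6, ?_⟩
            rintro (rfl | rfl)
            · exact h5 rfl
            · exact h2 h6
        rw [this]; exact Finset.card_erase_add_one h1
      simp only [if_true, h2, false_and, if_false, h1, hc]
      apply le_of_eq; ring
    · rw [if_neg hee]
      by_cases hi : i ∈ S e'
      · have hj : j ∉ S e' := by tauto
        simp only [hj, false_and, if_false, hi, if_true]
        split_ifs
        · have := (hpp ((S e \ {i, j}).card + 1)).1
          nlinarith [mul_nonneg huy this]
        · simp
      · have hj : j ∈ S e' := by tauto
        simp only [hj, true_and, if_false, hi]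
        split_ifs
        · obtain ⟨q1, q2⟩ := (hpp ((S e \ {i, j}).card + 1))
          nlinarith [mul_le_one₀ huy1 q1 q2]
        · simp
  refine le_trans ?_ (Finset.sum_le_sum hterm)
  rw [Finset.sum_sub_distrib]
  have hb2 : ∑ τ ∈ JJ S, (if τ ∈ bad then (1:ℝ) else 0) ≤ (K ^ 2 * k ^ 4 : ℕ) * (n : ℝ) ^ 2 := by
    rw [← Finset.sum_filter, Finset.sum_const, nsmul_eq_mul, mul_one]
    have : ((JJ S).filter fun τ => τ ∈ bad).card ≤ (K ^ 2 * k ^ 4) * n ^ 2 := by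
      refine (Finset.card_le_card (t := bad) fun τ hτ => (Finset.mem_filter.1 hτ).2).trans (hbadc.trans (le_of_eq ?_))
      ring
    exact_mod_cast this
  refine sub_le_sub ?_ hb2
  have e1 : ∑ τ ∈ JJ S, (if τ.2.1 = τ.2.2 then u τ.2.1 * y τ.2.1 * (p * (1 - p)) ^ (S τ.2.1).card else 0)
      = ∑ e, (S e).card * ((n : ℝ) - (S e).card) * (u e * y e * (p * (1 - p)) ^ (S e).card) := by
    have : ∀ e, ((S e).card : ℝ) * ((n : ℝ) - (S e).card) = ∑ z : G × G, if z.1 ∈ S e ∧ z.2 ∉ S e then 1 else 0 := by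
      intro e
      rw [← Finset.sum_filter, Finset.sum_const, nsmul_eq_mul, mul_one]
      have : (Finset.univ.filter fun z : G × G => z.1 ∈ S e ∧ z.2 ∉ S e) = S e ×ˢ (S e)ᶜ := by ext; simp
      rw [this, Finset.card_product, Finset.card_compl]
      rw [Nat.cast_mul, Nat.cast_sub (Finset.card_le_univ _)]
    simp_rw [this, Finset.sum_mul]
    rw [Finset.sum_comm, JJ, Finset.sum_filter, Fintype.sum_prod_type]
    refine Finset.sum_congr rfl fun z _ => ?_
    rw [Fintype.sum_prod_type]
    refine Finset.sum_congr rfl fun e _ => ?_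
    rw [Finset.sum_eq_single e]
    · simp only [if_true, gd]
      by_cases h1 : z.1 ∈ S e <;> by_cases h2 : z.2 ∈ S e <;> simp [h1, h2]
      intro h5; rw [h5] at h1; exact absurd h1 h2
    · intro e' _ hne; rw [if_neg hne.symm]; simp
    · simp
  rw [e1, Finset.mul_sum]
  refine Finset.sum_le_sum fun e _ => ?_
  have hcn : (S e).card ≠ 0 := by have := h.c3 e; omega
  have hcn' : ((S e).card : ℝ) ≠ 0 := by exact_mod_cast hcn
  have hle : ((S e).card : ℝ) ≤ k := by exact_mod_cast h.ck e
  have hle2 : ((S e).card : ℝ) ≤ n := by exact_mod_cast Finset.card_le_univ _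
  have : (S e).card * ((n : ℝ) - (S e).card) * (u e * y e * (p * (1 - p)) ^ (S e).card) = ((n : ℝ) - (S e).card) * (p * (1 - p)) ^ (S e).card * y e ^ 2 := by
    simp only [hu]; field_simp
  rw [this]
  gcongr ?_ * _
  have hpw : (p * (1 - p)) ^ k ≤ (p * (1 - p)) ^ (S e).card := pow_le_pow_of_le_one hpq hpq1 (h.ck e)
  calc ((n : ℝ) - k) * (p * (1 - p)) ^ k ≤ ((n : ℝ) - (S e).card) * (p * (1 - p)) ^ k := by gcongr
    _ ≤ _ := by
      apply mul_le_mul_of_nonneg_left hpw; linarith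
end REst

section Stein
variable {G : Type*} [Fintype G] [DecidableEq G] {κ : Type*} [Fintype κ] [DecidableEq κ]
variable {S : κ → Finset G} {k K : ℕ} {p : ℝ}

/-- the polynomial -/
noncomputable def Yp (p : ℝ) (S : κ → Finset G) (y : κ → ℝ) (x : G → Bool) : ℝ := ∑ e, y e * mon p (S e) x

/-- swap two coordinates -/
def sw (z : G × G) (x : G → Bool) : G → Bool := x ∘ (Equiv.swap z.1 z.2)

lemma sum_chi [Nonempty G] {m : ℕ} {x : G → Bool} (hx : cnt x = m) (hp : p = (m : ℝ) / Fintype.card G) : ∑ j, chi (fun _ => p) j x = 0 := by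
  unfold chi
  rw [Finset.sum_sub_distrib, Finset.sum_const, Finset.card_univ, nsmul_eq_mul, hp, mul_div_cancel₀ _ (by simp)]
  rw [← hx, cnt]; simp

lemma mon_pair {i j : G} (hij : i ≠ j) (A : Finset G) (x) : mon p A x =
    (if i ∈ A then chi (fun _ => p) i x else 1) * (if j ∈ A then chi (fun _ => p) j x else 1) * mon p (A \ {i, j}) x := by
  have h : ∀ B : Finset G, ∀ i, mon p B x = (if i ∈ B then chi (fun _ => p) i x else 1) * mon p (B.erase i) x := by
    intro B i
    split_ifs with h
    · exact mon_erase h x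
    · rw [Finset.erase_eq_of_notMem h, one_mul]
  rw [h A i, h (A.erase i) j, mul_assoc]
  have e1 : (A.erase i).erase j = A \ {i, j} := by ext; simp; tauto
  rw [e1]
  simp [hij.symm]

lemma mon_sw {i j : G} (A : Finset G) (x) : mon p (A \ {i, j}) (sw (i, j) x) = mon p (A \ {i, j}) x := by
  apply mon_dep
  intro g hg
  simp only [Finset.coe_sdiff, Finset.coe_insert, Finset.coe_singleton, Set.mem_sdiff, Finset.mem_coe, Set.mem_insert_iff, Set.mem_singleton_iff, not_or] at hg
  simp [sw, Equiv.swap_apply_of_ne_of_ne hg.2.1 hg.2.2]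

lemma chi_sw (z : G × G) (x) : chi (fun _ => p) z.1 (sw z x) = chi (fun _ => p) z.2 x ∧ chi (fun _ => p) z.2 (sw z x) = chi (fun _ => p) z.1 x := by
  simp [chi, sw]

lemma dd_sw (z : G × G) (x) : dd p z.1 z.2 (sw z x) = - dd p z.1 z.2 x := by
  unfold dd; rw [(chi_sw z x).1, (chi_sw z x).2]; ring

lemma Ac_sw (c : κ → ℝ) (i j : G) (x) : Ac p S c i j (sw (i, j) x) = Ac p S c i j x := by
  unfold Ac; simp only [mon_sw]

lemma sw_swap (i j : G) (x : G → Bool) : sw (i, j) x = sw (j, i) x := by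
  simp [sw, Equiv.swap_comm]

lemma Ac_sw' (c : κ → ℝ) (i j : G) (x) : Ac p S c j i (sw (i, j) x) = Ac p S c j i x := by
  rw [sw_swap, Ac_sw]

lemma Y_sw (y : κ → ℝ) (z : G × G) (x) : Yp p S y x - Yp p S y (sw z x) = dd p z.1 z.2 x * (Ac p S y z.1 z.2 x - Ac p S y z.2 z.1 x) := by
  obtain ⟨i, j⟩ := z
  simp only
  by_cases hij : i = j
  · subst hij; simp [sw, dd]
  · unfold Yp Ac
    rw [← Finset.sum_sub_distrib, ← Finset.sum_sub_distrib, Finset.mul_sum]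
    refine Finset.sum_congr rfl fun e _ => ?_
    rw [mon_pair hij (S e) x, mon_pair hij (S e) (sw (i, j) x), mon_sw]
    have h := chi_sw (p := p) (i, j) x
    simp only at h
    rw [h.1, h.2, Finset.pair_comm j i]
    unfold dd
    by_cases h1 : i ∈ S e <;> by_cases h2 : j ∈ S e <;> simp [h1, h2] <;> ring

lemma nY [Nonempty G] (h : HG S k K) {m : ℕ} {x : G → Bool} (hx : cnt x = m) (hp : p = (m : ℝ) / Fintype.card G) (y : κ → ℝ) :
    (Fintype.card G : ℝ) * Yp p S y x = ∑ z : G × G, dd p z.1 z.2 x * Ac p S (fun e => y e / (S e).card) z.1 z.2 x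
      + Rr p S (fun e => y e / (S e).card) x := by
  set u : κ → ℝ := fun e => y e / (S e).card with hu
  have h0 := sum_chi hx hp
  have h1 : (Fintype.card G : ℝ) * Yp p S y x = ∑ z : G × G, dd p z.1 z.2 x * ∑ e, if z.1 ∈ S e then u e * mon p ((S e).erase z.1) x else 0 := by
    rw [Fintype.sum_prod_type]
    have : ∀ i : G, ∑ j : G, dd p i j x * (∑ e, if i ∈ S e then u e * mon p ((S e).erase i) x else 0) =
        (Fintype.card G : ℝ) * ∑ e, if i ∈ S e then u e * mon p (S e) x else 0 := by
      intro i
      rw [← Finset.sum_mul]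
      have : ∑ j : G, dd p i j x = Fintype.card G * chi (fun _ => p) i x := by
        unfold dd; rw [Finset.sum_sub_distrib, h0]; simp
      rw [this, mul_assoc, Finset.mul_sum]
      congr 1
      refine Finset.sum_congr rfl fun e _ => ?_
      split_ifs with hi
      · rw [mon_erase hi x]; ring
      · simp
    simp only [this]
    rw [← Finset.mul_sum, Finset.sum_comm]
    congr 1
    unfold Yp
    refine Finset.sum_congr rfl fun e _ => ?_
    have hc : ((S e).card : ℝ) ≠ 0 := by have := h.c3 e; exact_mod_cast (by omega)
    rw [Finset.sum_ite_mem, Finset.univ_inter, Finset.sum_const, nsmul_eq_mul, hu]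
    field_simp
  have h2 : Rr p S u x = ∑ z : G × G, dd p z.1 z.2 x * ∑ e, if z.1 ∈ S e ∧ z.2 ∈ S e then u e * (chi (fun _ => p) z.2 x * mon p (S e \ {z.1, z.2}) x) else 0 := by
    unfold Rr JR RX
    rw [Finset.sum_filter, Fintype.sum_prod_type]
    refine Finset.sum_congr rfl fun z _ => ?_
    rw [Finset.mul_sum]
    refine Finset.sum_congr rfl fun e _ => ?_
    by_cases hz : z.1 = z.2
    · simp [dd, hz]
    · simp only [ne_eq, hz, not_false_eq_true, true_and]
      split_ifs <;> ring
  rw [h1, h2, ← Finset.sum_add_distrib]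
  refine Finset.sum_congr rfl fun z _ => ?_
  rw [← mul_add]
  by_cases hz : z.1 = z.2
  · simp [dd, hz]
  · congr 1
    unfold Ac
    rw [← Finset.sum_add_distrib]
    refine Finset.sum_congr rfl fun e _ => ?_
    rw [mon_pair hz ((S e).erase z.1) x]
    have e1 : (S e).erase z.1 \ {z.1, z.2} = S e \ {z.1, z.2} := by ext; simp; tauto
    rw [e1]
    by_cases h1 : z.1 ∈ S e <;> by_cases h2 : z.2 ∈ S e <;> simp [h1, h2, Ne.symm hz]

lemma stein_id [Nonempty G] (h : HG S k K) {m : ℕ} (hp : p = (m : ℝ) / Fintype.card G) (y : κ → ℝ) (g : (G → Bool) → ℂ) :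
    (Fintype.card G : ℂ) * Esl m (fun x => (Yp p S y x : ℂ) * g x) =
      ∑ z : G × G, Esl m (fun x => ((1 / 2 * (dd p z.1 z.2 x * Ac p S (fun e => y e / (S e).card) z.1 z.2 x) : ℝ) : ℂ) * (g x - g (sw z x)))
      + Esl m (fun x => (Rr p S (fun e => y e / (S e).card) x : ℂ) * g x) := by
  rw [← Esl_mul]
  have e1 : Esl m (fun x => (Fintype.card G : ℂ) * ((Yp p S y x : ℂ) * g x)) = Esl m (fun x => (∑ z : G × G, ((dd p z.1 z.2 x * Ac p S (fun e => y e / (S e).card) z.1 z.2 x : ℝ) : ℂ) * g x) + (Rr p S (fun e => y e / (S e).card) x : ℂ) * g x) := by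
    refine Esl_congr fun x hx => ?_
    have := nY h hx hp y
    rw [← Finset.sum_mul, ← add_mul, ← mul_assoc]
    congr 1
    exact_mod_cast this
  rw [e1, Esl_add, Esl_sum]
  congr 1
  refine Finset.sum_congr rfl fun z _ => ?_
  have e2 := Esl_perm m (Equiv.swap z.1 z.2) (fun x => ((dd p z.1 z.2 x * Ac p S (fun e => y e / (S e).card) z.1 z.2 x : ℝ) : ℂ) * g x)
  have e3 : Esl m (fun x => ((dd p z.1 z.2 x * Ac p S (fun e => y e / (S e).card) z.1 z.2 x : ℝ) : ℂ) * g x) = - Esl m (fun x => ((dd p z.1 z.2 x * Ac p S (fun e => y e / (S e).card) z.1 z.2 x : ℝ) : ℂ) * g (sw z x)) := by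
    rw [← e2, neg_eq_neg_one_mul, ← Esl_mul]
    congr 1; funext x
    have a1 := dd_sw (p := p) z x
    have a2 := Ac_sw (p := p) (S := S) (fun e => y e / (S e).card) z.1 z.2 x
    rw [show x ∘ (Equiv.swap z.1 z.2) = sw z x from rfl, a1]
    rw [show (z.1, z.2) = z from rfl] at a2
    rw [a2]; push_cast; ring
  have e4 : Esl m (fun x => ((1 / 2 * (dd p z.1 z.2 x * Ac p S (fun e => y e / (S e).card) z.1 z.2 x) : ℝ) : ℂ) * (g x - g (sw z x))) =
      (1/2 : ℂ) * (Esl m (fun x => ((dd p z.1 z.2 x * Ac p S (fun e => y e / (S e).card) z.1 z.2 x : ℝ) : ℂ) * g x) - Esl m (fun x => ((dd p z.1 z.2 x * Ac p S (fun e => y e / (S e).card) z.1 z.2 x : ℝ) : ℂ) * g (sw z x))) := by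
    rw [← Esl_sub, ← Esl_mul]; congr 1; funext x; push_cast; ring
  rw [e4]
  linear_combination (1/2 : ℂ) * e3

lemma trap (t : ℝ) : ‖Complex.exp (t * Complex.I) - 1 - (t * Complex.I) * ((1 + Complex.exp (t * Complex.I)) / 2)‖ ≤ |t| ^ 3 := by
  set a : ℝ := t / 2 with ha
  have ht : t = 2 * a := by rw [ha]; ring
  have e1 : Complex.exp (t * Complex.I) - 1 - (t * Complex.I) * ((1 + Complex.exp (t * Complex.I)) / 2) =
      Complex.exp (a * Complex.I) * (Complex.I * ((2 * (Real.sin a - a * Real.cos a) : ℝ) : ℂ)) := by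
    have h1 : Complex.exp (t * Complex.I) = Complex.exp (a * Complex.I) ^ 2 := by
      rw [← Complex.exp_nat_mul, ht]; congr 1; push_cast; ring
    rw [h1]
    have hb := Complex.exp_mul_I (a : ℂ)
    have hI := Complex.I_sq
    have hsc := Complex.sin_sq_add_cos_sq (a : ℂ)
    push_cast
    rw [hb, ht]
    push_cast
    generalize Complex.sin a = s at *
    generalize Complex.cos a = c at *
    linear_combination ((1:ℂ) + a * Complex.I) * hsc - (s^2 + Complex.I * s^2 * a) * hI
  rw [e1, norm_mul, norm_mul, Complex.norm_exp_ofReal_mul_I, Complex.norm_I, one_mul, one_mul, Complex.norm_real, Real.norm_eq_abs, ht, abs_mul, abs_mul]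
  rw [mul_pow, abs_two]
  have key : ∀ b : ℝ, 0 ≤ b → |Real.sin b - b * Real.cos b| ≤ 2 * b ^ 3 := by
    intro b hb
    by_cases h1 : b ≤ 1
    · rcases hb.eq_or_lt with rfl | hb'
      · simp
      have s1 := Real.sin_gt_sub_cube hb'
      have s2 := Real.sin_lt hb'
      have c1 := Real.one_sub_sq_div_two_le_cos (x := b)
      have c2 := Real.cos_le_one b
      have hb3 : 0 < b ^ 3 := by positivity
      rw [abs_le]; constructor <;> nlinarith
    · push Not at h1
      have s1 := Real.sin_le_one b
      have s2 := Real.neg_one_le_sin b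
      have c1 := Real.neg_one_le_cos b
      have c2 := Real.cos_le_one b
      have hb3 : b ≤ b ^ 3 := by nlinarith [sq_nonneg b]
      rw [abs_le]; constructor <;> nlinarith
  have : |Real.sin a - a * Real.cos a| ≤ 2 * |a| ^ 3 := by
    rcases abs_cases a with ⟨h, _⟩ | ⟨h, _⟩
    · rw [h]; exact key a (by linarith)
    · rw [h]; have := key (-a) (by linarith)
      rw [Real.sin_neg, Real.cos_neg] at this
      rw [← abs_neg]; convert this using 2; ring
  have h3 : 0 ≤ |a| ^ 3 := by positivity
  linarith
end Stein

section LF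
variable {G : Type*} [Fintype G] [DecidableEq G] {κ : Type*} [Fintype κ] [DecidableEq κ]
variable {S : κ → Finset G} {k K : ℕ} {p : ℝ}

/-- constant -/
def cA (k K : ℕ) : ℕ := 8 * K ^ 2 * ((2 * k) * (2 * k) * K) ^ 2 + 4 * K ^ 2 * (2 * k * (4 * k * K ^ 2)) + 4 * K ^ 4
/-- constant -/
def cG (k K : ℕ) : ℕ := 2 * (2 * (2 * K ^ 2 * (((2 * k + 2) * (2 * k + 2) * K) ^ 2 * k)) + 2 * K ^ 2 * ((2 * k + 2) * (4 * k * K ^ 2 + 4 * K ^ 2)))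
/-- constant -/
def cR (k K : ℕ) : ℕ := 2 * k ^ 5 * K ^ 2

/-- setup data for a slice -/
structure SL (G : Type*) [Fintype G] (m : ℕ) (p q : ℝ) : Prop where
  m0 : 0 < m
  m1 : m < Fintype.card G
  hp : p = (m : ℝ) / Fintype.card G
  q0 : 0 < q
  hq : q ^ 4 = Fintype.card G

variable {m : ℕ} {q : ℝ}

lemma SL.p01 (s : SL G m p q) : 0 ≤ p ∧ p ≤ 1 := by
  have h1 : (m : ℝ) < Fintype.card G := by exact_mod_cast s.m1
  have h0 : (0:ℝ) ≤ m := by positivity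
  rw [s.hp]
  exact ⟨by positivity, (div_le_one (by linarith)).2 h1.le⟩

lemma SL.cmp (s : SL G m p q) (f : (G → Bool) → ℝ) (hf : ∀ x, 0 ≤ f x) : Esl m f ≤ 2 * q ^ 2 * Ex (fun _ => p) f := by
  have := Esl_le_Ex s.m0 s.m1 f hf
  rw [← s.hq] at this
  have e : Real.sqrt (q ^ 4) = q ^ 2 := by
    rw [show q ^ 4 = (q ^ 2) ^ 2 by ring]; exact Real.sqrt_sq (by positivity)
  rw [e] at this
  rw [s.hp, ← s.hq]; exact this

lemma SL.ne (s : SL G m p q) : Nonempty G := by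
  rw [← Fintype.card_pos_iff]; have := s.m1; omega

lemma SL.L1 (s : SL G m p q) (f : (G → Bool) → ℝ) {c : ℝ} (hc : 0 ≤ c) (a : ℕ) (h : Ex (fun _ => p) (fun x => f x ^ 2) ≤ c * q ^ (2 * a)) :
    Esl m (fun x => f x ^ 2) ≤ ((2 * c + 1) * q ^ (a + 1)) ^ 2 ∧ Esl m (fun x => |f x|) ≤ (2 * c + 1) * q ^ (a + 1) := by
  have hq := s.q0
  have h2 : Esl m (fun x => f x ^ 2) ≤ ((2 * c + 1) * q ^ (a + 1)) ^ 2 := by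
    refine (s.cmp _ fun x => sq_nonneg _).trans ?_
    calc 2 * q ^ 2 * Ex (fun _ => p) (fun x => f x ^ 2) ≤ 2 * q ^ 2 * (c * q ^ (2 * a)) := by gcongr
      _ = (2 * c) * (q ^ (a+1)) ^ 2 := by ring
      _ ≤ (2 * c + 1) ^ 2 * (q ^ (a+1)) ^ 2 := by gcongr; nlinarith
      _ = _ := by ring
  refine ⟨h2, ?_⟩
  apply le_of_abs_le
  apply abs_le_of_sq_le_sq _ (by positivity)
  refine (Esl_sq_le s.m1.le _).trans ?_
  simpa using h2

/-- characteristic function -/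
noncomputable def gf (f : (G → Bool) → ℝ) (t : ℝ) (x : G → Bool) : ℂ := Complex.exp ((t * f x : ℝ) * Complex.I)

lemma gf_norm (f : (G → Bool) → ℝ) (t : ℝ) (x) : ‖gf f t x‖ = 1 := Complex.norm_exp_ofReal_mul_I _

lemma quart (a b c : ℝ) : |a| * |b - c| ^ 3 ≤ a ^ 4 + 8 * b ^ 4 + 8 * c ^ 4 := by
  have h1 : |a| * |b - c| ^ 3 ≤ |a| ^ 4 + |b - c| ^ 4 := by
    have ha := abs_nonneg a; have hb := abs_nonneg (b - c)
    generalize |a| = u at *; generalize |b - c| = v at *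
    rcases le_total u v with h | h
    · nlinarith [mul_le_mul_of_nonneg_right h (pow_nonneg hb 3), pow_nonneg ha 4]
    · nlinarith [mul_le_mul_of_nonneg_left (pow_le_pow_left₀ hb h 3) ha, pow_nonneg hb 4]
  have e1 : |a| ^ 4 = a ^ 4 := by rw [← abs_pow]; exact abs_of_nonneg (by positivity)
  have e2 : |b - c| ^ 4 = (b - c) ^ 4 := by rw [← abs_pow]; exact abs_of_nonneg (by positivity)
  rw [e1, e2] at h1
  have h2 : (b - c) ^ 2 ≤ 2 * b ^ 2 + 2 * c ^ 2 := by nlinarith [sq_nonneg (b + c)]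
  have h3 : (b - c) ^ 4 ≤ (2 * b ^ 2 + 2 * c ^ 2) ^ 2 := by
    rw [show (b - c) ^ 4 = ((b - c) ^ 2) ^ 2 by ring]; gcongr
  nlinarith [sq_nonneg (b ^ 2 - c ^ 2)]

lemma pair_err (s : SL G m p q) (h : HG S k K) {u y : κ → ℝ} (hu : ∀ e, |u e| ≤ 1) (hy : ∀ e, |y e| ≤ 1) (t : ℝ) (z : G × G) :
    ‖Esl m (fun x => ((1 / 2 * (dd p z.1 z.2 x * Ac p S u z.1 z.2 x) : ℝ) : ℂ) * (gf (Yp p S y) t x - gf (Yp p S y) t (sw z x)))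
      - Complex.I * t * Esl m (fun x => (((1/2) * (dd p z.1 z.2 x ^ 2 * (Ac p S u z.1 z.2 x * (Ac p S y z.1 z.2 x - Ac p S y z.2 z.1 x))) : ℝ) : ℂ) * gf (Yp p S y) t x)‖
    ≤ |t| ^ 3 * (17 * cA k K * q ^ 10) := by
  set g := gf (Yp p S y) t with hg
  set W : (G → Bool) → ℝ := fun x => (1/2) * (dd p z.1 z.2 x ^ 2 * (Ac p S u z.1 z.2 x * (Ac p S y z.1 z.2 x - Ac p S y z.2 z.1 x))) with hW
  have hWs : ∀ x, W (sw z x) = W x := fun x => by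
    simp only [hW]
    have a1 := dd_sw (p := p) z x
    have a2 := Ac_sw (p := p) (S := S) u z.1 z.2 x
    have a3 := Ac_sw (p := p) (S := S) y z.1 z.2 x
    have a4 := Ac_sw' (p := p) (S := S) y z.1 z.2 x
    simp only [Prod.mk.eta] at a2 a3 a4
    rw [a1, a2, a3, a4]; ring
  have e1 : Esl m (fun x => (W x : ℂ) * g (sw z x)) = Esl m (fun x => (W x : ℂ) * g x) := by
    rw [← Esl_perm m (Equiv.swap z.1 z.2) (fun x => (W x : ℂ) * g x)]
    congr 1; funext x
    rw [show x ∘ (Equiv.swap z.1 z.2) = sw z x from rfl, hWs]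
  set δ : (G → Bool) → ℝ := fun x => dd p z.1 z.2 x * (Ac p S y z.1 z.2 x - Ac p S y z.2 z.1 x) with hδ
  have e2 : Complex.I * t * Esl m (fun x => (W x : ℂ) * g x) = Esl m (fun x => Complex.I * t * ((W x : ℂ) * ((g x + g (sw z x)) / 2))) := by
    have : Esl m (fun x => (W x : ℂ) * g x) = (1/2 : ℂ) * (Esl m (fun x => (W x : ℂ) * g x) + Esl m (fun x => (W x : ℂ) * g (sw z x))) := by
      rw [e1]; ring
    rw [this, ← Esl_add, ← Esl_mul, ← Esl_mul]
    congr 1; funext x; ring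
  rw [e2, ← Esl_sub]
  refine (Esl_norm_le _ _).trans ?_
  have hpt : ∀ x, ‖((1 / 2 * (dd p z.1 z.2 x * Ac p S u z.1 z.2 x) : ℝ) : ℂ) * (g x - g (sw z x)) - Complex.I * t * ((W x : ℂ) * ((g x + g (sw z x)) / 2))‖
      ≤ |t| ^ 3 * (1/2) * (Ac p S u z.1 z.2 x ^ 4 + 8 * Ac p S y z.1 z.2 x ^ 4 + 8 * Ac p S y z.2 z.1 x ^ 4) := by
    intro x
    have hgx : g x = g (sw z x) * Complex.exp ((t * δ x : ℝ) * Complex.I) := by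
      simp only [hg, gf, ← Complex.exp_add]
      congr 1
      have := Y_sw (p := p) (S := S) y z x
      rw [← add_mul, ← Complex.ofReal_add, ← mul_add, hδ]
      simp only
      rw [← this]; congr 3; ring
    have hWd : (W x : ℂ) = ((1 / 2 * (dd p z.1 z.2 x * Ac p S u z.1 z.2 x) : ℝ) : ℂ) * (δ x : ℂ) := by
      rw [← Complex.ofReal_mul]; congr 1; simp only [hW, hδ]; ring
    have e3 : ((1 / 2 * (dd p z.1 z.2 x * Ac p S u z.1 z.2 x) : ℝ) : ℂ) * (g x - g (sw z x)) - Complex.I * t * ((W x : ℂ) * ((g x + g (sw z x)) / 2)) =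
      ((1 / 2 * (dd p z.1 z.2 x * Ac p S u z.1 z.2 x) : ℝ) : ℂ) * (g (sw z x) * (Complex.exp ((t * δ x : ℝ) * Complex.I) - 1 - ((t * δ x : ℝ) * Complex.I) * ((1 + Complex.exp ((t * δ x : ℝ) * Complex.I)) / 2))) := by
      rw [hWd, hgx]; push_cast; ring
    rw [e3, norm_mul, norm_mul, hg, gf_norm, one_mul, Complex.norm_real, Real.norm_eq_abs]
    have ht := trap (t * δ x)
    have hd := dd_abs (p := p) z.1 z.2 x
    have hd0 := abs_nonneg (dd p z.1 z.2 x)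
    have hq4 := quart (Ac p S u z.1 z.2 x) (Ac p S y z.1 z.2 x) (Ac p S y z.2 z.1 x)
    calc _ ≤ |1 / 2 * (dd p z.1 z.2 x * Ac p S u z.1 z.2 x)| * |t * δ x| ^ 3 := by gcongr
      _ = |t| ^ 3 * (1/2) * (|dd p z.1 z.2 x| ^ 4 * (|Ac p S u z.1 z.2 x| * |Ac p S y z.1 z.2 x - Ac p S y z.2 z.1 x| ^ 3)) := by
        simp only [hδ, abs_mul]; rw [abs_of_pos (by norm_num : (0:ℝ) < 1/2)]; ring
      _ ≤ |t| ^ 3 * (1/2) * (1 * (Ac p S u z.1 z.2 x ^ 4 + 8 * Ac p S y z.1 z.2 x ^ 4 + 8 * Ac p S y z.2 z.1 x ^ 4)) := by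
        gcongr
        exact pow_le_one₀ hd0 hd
      _ = _ := by ring
  refine (Esl_mono fun x _ => hpt x).trans ?_
  have a1 : ∀ (c : κ → ℝ) (hc : ∀ e, |c e| ≤ 1) (i j), Esl m (fun x => Ac p S c i j x ^ 4) ≤ 2 * q ^ 2 * (cA k K * q ^ 8) := by
    intro c hc i j
    refine (s.cmp _ fun x => by positivity).trans ?_
    have := A_mom h s.p01 c hc i j
    rw [← s.hq, ← pow_mul] at this
    have hq := s.q0
    gcongr
    exact this
  rw [Esl_mulR, Esl_add, Esl_add, Esl_mulR, Esl_mulR]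
  have b1 := a1 u hu z.1 z.2
  have b2 := a1 y hy z.1 z.2
  have b3 := a1 y hy z.2 z.1
  calc _ ≤ |t| ^ 3 * (1/2) * (17 * (2 * q ^ 2 * (cA k K * q ^ 8))) := by gcongr; linarith
    _ = _ := by ring

lemma stein_est (s : SL G m p q) (h : HG S k K) {y : κ → ℝ} (hy : ∀ e, |y e| ≤ 1) (t : ℝ) :
    ‖(q ^ 4 : ℂ) * Esl m (fun x => (Yp p S y x : ℂ) * gf (Yp p S y) t x)
       - Complex.I * t * (Ex (fun _ => p) (Gam p S (fun e => y e / (S e).card) y) : ℂ) * Esl m (gf (Yp p S y) t)‖ ≤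
     (2 * cR k K + 1) * q ^ 7 + |t| * ((2 * cG k K + 1) * q ^ 11) + |t| ^ 3 * (17 * cA k K * q ^ 18) := by
  have := s.ne
  set u : κ → ℝ := fun e => y e / (S e).card with hu
  have hu1 : ∀ e, |u e| ≤ 1 := fun e => by
    have h3 := h.c3 e
    have h1 : (1:ℝ) ≤ (S e).card := by exact_mod_cast (by omega : 1 ≤ (S e).card)
    simp only [hu]; rw [abs_div, Nat.abs_cast]
    exact (div_le_self (abs_nonneg _) h1).trans (hy e)
  have hid := stein_id (p := p) h s.hp y (gf (Yp p S y) t)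
  rw [← hu] at hid
  have hqc : (q ^ 4 : ℂ) = (Fintype.card G : ℂ) := by
    have := s.hq; exact_mod_cast this
  rw [hqc, hid]
  set g := gf (Yp p S y) t with hg
  set EG := Ex (fun _ => p) (Gam p S u y) with hEG
  have hGam : Esl m (fun x => (Gam p S u y x : ℂ) * g x) = ∑ z : G × G, Esl m (fun x => (((1/2) * (dd p z.1 z.2 x ^ 2 * (Ac p S u z.1 z.2 x * (Ac p S y z.1 z.2 x - Ac p S y z.2 z.1 x))) : ℝ) : ℂ) * g x) := by
    rw [← Esl_sum]; congr 1; funext x; rw [← Finset.sum_mul]; congr 1; simp only [Gam]; push_cast; rfl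
  have hr := (s.L1 (Rr p S u) (c := cR k K) (by positivity) 6 (by
    have := Rr_bound h s.p01 hu1
    rw [← s.hq, ← pow_mul] at this
    exact this)).2
  have hga := (s.L1 (fun x => Gam p S u y x - EG) (c := cG k K) (by positivity) 10 (by
    have := Gam_var h s.p01 hu1 hy
    rw [← s.hq, ← pow_mul] at this
    exact this)).2
  have hdec : ∀ A B C D E : ℂ, A + B - E = (A - C) + (C - E) + B := by intros; ring
  have n1 : ‖Esl m (fun x => (Rr p S u x : ℂ) * g x)‖ ≤ (2 * cR k K + 1) * q ^ 7 := by
    refine (Esl_norm_le _ _).trans (le_trans (le_of_eq ?_) hr)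
    congr 1; funext x; rw [norm_mul, hg, gf_norm, mul_one, Complex.norm_real, Real.norm_eq_abs]
  have n2 : ‖Complex.I * t * Esl m (fun x => (Gam p S u y x : ℂ) * g x) - Complex.I * t * (EG : ℂ) * Esl m g‖ ≤ |t| * ((2 * cG k K + 1) * q ^ 11) := by
    have : Complex.I * t * Esl m (fun x => (Gam p S u y x : ℂ) * g x) - Complex.I * t * (EG : ℂ) * Esl m g = Complex.I * t * Esl m (fun x => ((Gam p S u y x - EG : ℝ) : ℂ) * g x) := by
      rw [mul_assoc _ (EG : ℂ), ← mul_sub, ← Esl_mul m (EG : ℂ), ← Esl_sub]; congr 2; funext x; push_cast; ring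
    rw [this, norm_mul, norm_mul, Complex.norm_I, one_mul, Complex.norm_real, Real.norm_eq_abs]
    gcongr
    refine (Esl_norm_le _ _).trans (le_trans (le_of_eq ?_) hga)
    congr 1; funext x; rw [norm_mul, hg, gf_norm, mul_one, Complex.norm_real, Real.norm_eq_abs]
  have n3 : ‖∑ z : G × G, Esl m (fun x => ((1 / 2 * (dd p z.1 z.2 x * Ac p S u z.1 z.2 x) : ℝ) : ℂ) * (g x - g (sw z x)))
      - Complex.I * t * Esl m (fun x => (Gam p S u y x : ℂ) * g x)‖ ≤ |t| ^ 3 * (17 * cA k K * q ^ 18) := by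
    rw [hGam, Finset.mul_sum, ← Finset.sum_sub_distrib]
    refine (norm_sum_le _ _).trans ((Finset.sum_le_sum fun z _ => pair_err s h hu1 hy t z).trans ?_)
    rw [Finset.sum_const, Finset.card_univ, Fintype.card_prod, nsmul_eq_mul]
    push_cast
    rw [← s.hq]
    apply le_of_eq; ring
  rw [hdec _ _ (Complex.I * t * Esl m (fun x => (Gam p S u y x : ℂ) * g x)) 0]
  refine (norm_add_le _ _).trans ?_
  have := norm_add_le (∑ z : G × G, Esl m (fun x => ((1 / 2 * (dd p z.1 z.2 x * Ac p S u z.1 z.2 x) : ℝ) : ℂ) * (g x - g (sw z x)))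
      - Complex.I * t * Esl m (fun x => (Gam p S u y x : ℂ) * g x)) (Complex.I * t * Esl m (fun x => (Gam p S u y x : ℂ) * g x) - Complex.I * t * (EG : ℂ) * Esl m g)
  linarith
end LF

section LF2
variable {G : Type*} [Fintype G] [DecidableEq G] {κ : Type*} [Fintype κ] [DecidableEq κ]
variable {S : κ → Finset G} {k K : ℕ} {p : ℝ} {m : ℕ} {q : ℝ}

/-- approximate variance -/
noncomputable def vv (p q : ℝ) (S : κ → Finset G) (y : κ → ℝ) : ℝ := Ex (fun _ => p) (Gam p S (fun e => y e / (S e).card) y) / q ^ 4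

/-- constant -/
def cL (k K : ℕ) : ℕ := (2 * cR k K + 1) + (2 * cG k K + 1) + 17 * cA k K
/-- constant -/
def cW (k K : ℕ) : ℕ := 4 * K ^ 2 + 2 * (2 * cG k K + 1) + (2 * cR k K + 1) ^ 2
/-- constant -/
def cV (k K : ℕ) : ℕ := (2 * cG k K + 1) + (2 * cR k K + 1) * (cW k K + 1) + (2 * cR k K + 1) ^ 2

lemma SL.q1 (s : SL G m p q) : 1 ≤ q := by
  by_contra h
  push Not at h
  have h1 := pow_lt_one₀ s.q0.le h (by norm_num : 4 ≠ 0)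
  rw [s.hq] at h1
  have := s.m1
  have h2 : (1:ℝ) ≤ Fintype.card G := by exact_mod_cast (by omega)
  linarith

lemma u_le (h : HG S k K) {y : κ → ℝ} (hy : ∀ e, |y e| ≤ 1) : ∀ e, |y e / ((S e).card : ℝ)| ≤ 1 := fun e => by
  have h3 := h.c3 e
  have h1 : (1:ℝ) ≤ (S e).card := by exact_mod_cast (by omega : 1 ≤ (S e).card)
  rw [abs_div, Nat.abs_cast]
  exact (div_le_self (abs_nonneg _) h1).trans (hy e)

lemma stein_div (s : SL G m p q) (h : HG S k K) {y : κ → ℝ} (hy : ∀ e, |y e| ≤ 1) (t : ℝ) :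
    ‖Esl m (fun x => (Yp p S y x : ℂ) * gf (Yp p S y) t x) - Complex.I * t * (vv p q S y : ℂ) * Esl m (gf (Yp p S y) t)‖ ≤
     (2 * cR k K + 1) * q ^ 3 + |t| * ((2 * cG k K + 1) * q ^ 7) + |t| ^ 3 * (17 * cA k K * q ^ 14) := by
  have h1 := stein_est s h hy t
  have hq := s.q0
  have hqc : (q : ℂ) ≠ 0 := by exact_mod_cast hq.ne'
  have e1 : (q ^ 4 : ℂ) * Esl m (fun x => (Yp p S y x : ℂ) * gf (Yp p S y) t x)
       - Complex.I * t * (Ex (fun _ => p) (Gam p S (fun e => y e / (S e).card) y) : ℂ) * Esl m (gf (Yp p S y) t) =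
    ((q ^ 4 : ℝ) : ℂ) * (Esl m (fun x => (Yp p S y x : ℂ) * gf (Yp p S y) t x) - Complex.I * t * (vv p q S y : ℂ) * Esl m (gf (Yp p S y) t)) := by
    unfold vv; push_cast; rw [mul_sub]; congr 1; field_simp
  rw [e1, norm_mul, Complex.norm_real, Real.norm_of_nonneg (by positivity)] at h1
  have h4 : 0 < q ^ 4 := by positivity
  rw [← mul_le_mul_iff_right₀ h4]
  refine h1.trans (le_of_eq ?_)
  ring

lemma Y_mean (s : SL G m p q) (h : HG S k K) {y : κ → ℝ} (hy : ∀ e, |y e| ≤ 1) : |Esl m (Yp p S y)| ≤ (2 * cR k K + 1) * q ^ 3 := by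
  have := stein_div s h hy 0
  have e : (fun x => (Yp p S y x : ℂ) * gf (Yp p S y) 0 x) = fun x => (Yp p S y x : ℂ) := by funext x; simp [gf]
  rw [e, Esl_ofReal] at this
  simpa using this

lemma LF_phi (s : SL G m p q) (h : HG S k K) {y : κ → ℝ} (hy : ∀ e, |y e| ≤ 1) (hv : 0 ≤ vv p q S y) (θ : ℝ) :
    ‖Esl m (gf (Yp p S y) θ) - (Real.exp (-(vv p q S y * θ ^ 2 / 2)) : ℂ)‖ ≤ cL k K * (|θ| * (q ^ 3 + |θ| * q ^ 7 + |θ| ^ 3 * q ^ 14)) := by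
  set v := vv p q S y with hvd
  have hq := s.q0
  set B : ℝ := cL k K * (q ^ 3 + |θ| * q ^ 7 + |θ| ^ 3 * q ^ 14) with hB
  -- derivative of char fn
  have d1 : ∀ t : ℝ, HasDerivAt (fun t : ℝ => Esl m (gf (Yp p S y) t)) (Complex.I * Esl m (fun x => (Yp p S y x : ℂ) * gf (Yp p S y) t x)) t := by
    intro t
    have : Complex.I * Esl m (fun x => (Yp p S y x : ℂ) * gf (Yp p S y) t x) = ((slc G m).card : ℝ)⁻¹ • ∑ x ∈ slc G m, gf (Yp p S y) t x * ((Yp p S y x : ℂ) * Complex.I) := by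
      rw [← Esl_mul]; unfold Esl; congr 1; refine Finset.sum_congr rfl fun x _ => by ring
    rw [this]
    unfold Esl
    refine HasDerivAt.const_smul _ ?_
    refine HasDerivAt.fun_sum fun x _ => ?_
    unfold gf
    have hl : HasDerivAt (fun t : ℝ => ((t * Yp p S y x : ℝ) : ℂ) * Complex.I) ((Yp p S y x : ℂ) * Complex.I) t := by
      have := ((hasDerivAt_id t).mul_const (Yp p S y x)).ofReal_comp.mul_const Complex.I
      simpa using this
    exact hl.cexp
  have d2 : ∀ t : ℝ, HasDerivAt (fun t : ℝ => ((Real.exp (v * t ^ 2 / 2) : ℝ) : ℂ)) (((Real.exp (v * t ^ 2 / 2) * (v * t) : ℝ)) : ℂ) t := by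
    intro t
    have : HasDerivAt (fun t : ℝ => v * t ^ 2 / 2) (v * t) t := by
      refine (((hasDerivAt_pow 2 t).const_mul v).div_const 2).congr_deriv ?_
      norm_num; ring
    exact this.exp.ofReal_comp
  have d3 : ∀ t : ℝ, HasDerivAt (fun t : ℝ => Esl m (gf (Yp p S y) t) * ((Real.exp (v * t ^ 2 / 2) : ℝ) : ℂ))
      (((Real.exp (v * t ^ 2 / 2) : ℝ) : ℂ) * (Complex.I * (Esl m (fun x => (Yp p S y x : ℂ) * gf (Yp p S y) t x) - Complex.I * t * (v : ℂ) * Esl m (gf (Yp p S y) t)))) t := by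
    intro t
    refine ((d1 t).mul (d2 t)).congr_deriv ?_
    push_cast
    have hI := Complex.I_mul_I
    linear_combination ((t * v * Complex.exp (v * t ^ 2 / 2) * Esl m (gf (Yp p S y) t)) : ℂ) * hI
  have bd : ∀ t : ℝ, |t| ≤ |θ| → ‖(((Real.exp (v * t ^ 2 / 2) : ℝ) : ℂ) * (Complex.I * (Esl m (fun x => (Yp p S y x : ℂ) * gf (Yp p S y) t x) - Complex.I * t * (v : ℂ) * Esl m (gf (Yp p S y) t))))‖ ≤ Real.exp (v * θ ^ 2 / 2) * B := by
    intro t ht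
    rw [norm_mul, norm_mul, Complex.norm_I, one_mul, Complex.norm_real, Real.norm_of_nonneg (Real.exp_pos _).le]
    have h2 : t ^ 2 ≤ θ ^ 2 := sq_le_sq.2 ht
    have hs := stein_div s h hy t
    have hb : (2 * cR k K + 1) * q ^ 3 + |t| * ((2 * cG k K + 1) * q ^ 7) + |t| ^ 3 * (17 * cA k K * q ^ 14) ≤ B := by
      have : B = (2 * cR k K + 1) * q ^ 3 + |θ| * ((2 * cG k K + 1) * q ^ 7) + |θ| ^ 3 * (17 * cA k K * q ^ 14) +
         (((2 * cG k K + 1) + 17 * cA k K) * q ^ 3 + ((2 * cR k K + 1) + 17 * cA k K) * (|θ| * q ^ 7) + ((2 * cR k K + 1) + (2 * cG k K + 1)) * (|θ| ^ 3 * q ^ 14)) := by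
        rw [hB, cL]; push_cast; ring
      rw [this]
      refine le_add_of_le_of_nonneg ?_ (by positivity)
      gcongr
    gcongr
    exact hs.trans hb
  have mv := Convex.norm_image_sub_le_of_norm_hasDerivWithin_le (s := Set.uIcc 0 θ) (x := 0) (y := θ) (C := Real.exp (v * θ ^ 2 / 2) * B)
    (fun t _ => (d3 t).hasDerivWithinAt) (fun t ht => bd t (by
      have := Set.abs_sub_left_of_mem_uIcc ht
      simpa using this)) (convex_uIcc 0 θ) Set.left_mem_uIcc Set.right_mem_uIcc
  have g0 : Esl m (gf (Yp p S y) 0) = 1 := by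
    have : gf (Yp p S y) 0 = fun _ => (1:ℂ) := by funext x; simp [gf]
    rw [this]; exact Esl_const s.m1.le _
  simp only [g0] at mv
  have e5 : Esl m (gf (Yp p S y) θ) - (Real.exp (-(v * θ ^ 2 / 2)) : ℂ) = (Real.exp (-(v * θ ^ 2 / 2)) : ℂ) * (Esl m (gf (Yp p S y) θ) * ((Real.exp (v * θ ^ 2 / 2) : ℝ) : ℂ) - 1 * ((Real.exp (v * 0 ^ 2 / 2) : ℝ) : ℂ)) := by
    have : ((Real.exp (-(v * θ ^ 2 / 2)) : ℝ) : ℂ) * ((Real.exp (v * θ ^ 2 / 2) : ℝ) : ℂ) = 1 := by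
      rw [← Complex.ofReal_mul, ← Real.exp_add]; simp
    have h0 : ((Real.exp (v * 0 ^ 2 / 2) : ℝ) : ℂ) = 1 := by simp
    rw [h0]
    linear_combination -(Esl m (gf (Yp p S y) θ)) * this
  rw [e5, norm_mul, Complex.norm_real, Real.norm_of_nonneg (Real.exp_pos _).le]
  calc _ ≤ Real.exp (-(v * θ ^ 2 / 2)) * (Real.exp (v * θ ^ 2 / 2) * B * ‖θ - 0‖) := by gcongr
    _ = (Real.exp (-(v * θ ^ 2 / 2)) * Real.exp (v * θ ^ 2 / 2)) * (B * |θ|) := by rw [sub_zero, Real.norm_eq_abs]; ring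
    _ = _ := by rw [← Real.exp_add, neg_add_cancel, Real.exp_zero, hB]; ring

lemma Y_var (s : SL G m p q) (h : HG S k K) {y : κ → ℝ} (hy : ∀ e, |y e| ≤ 1) :
    |Esl m (fun x => (Yp p S y x - Esl m (Yp p S y)) ^ 2) - vv p q S y| ≤ cV k K * q ^ 7 := by
  have := s.ne
  have hq := s.q0
  have hq1 := s.q1
  set u : κ → ℝ := fun e => y e / (S e).card with hu
  have hu1 : ∀ e, |u e| ≤ 1 := u_le h hy
  have hid := stein_id (p := p) h s.hp y (fun x => (Yp p S y x : ℂ))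
  rw [← hu] at hid
  have hid2 : q ^ 4 * Esl m (fun x => Yp p S y x ^ 2) = Esl m (Gam p S u y) + Esl m (fun x => Rr p S u x * Yp p S y x) := by
    have e1 : Esl m (Gam p S u y) = ∑ z : G × G, Esl m (fun x => 1 / 2 * (dd p z.1 z.2 x * Ac p S u z.1 z.2 x) * (Yp p S y x - Yp p S y (sw z x))) := by
      rw [← Esl_sum]; congr 1; funext x; unfold Gam
      refine Finset.sum_congr rfl fun z _ => ?_
      rw [Y_sw]; ring
    rw [e1, s.hq]
    apply Complex.ofReal_injective
    push_cast
    simp only [← Esl_ofReal]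
    push_cast
    push_cast at hid
    rw [← hid]
    congr 2; funext x; ring
  set w := Esl m (fun x => Yp p S y x ^ 2) with hw
  set EG := Ex (fun _ => p) (Gam p S u y) with hEG
  set v := vv p q S y with hvd
  have hv : EG = v * q ^ 4 := by rw [hvd, vv, ← hu, ← hEG]; field_simp
  have hga := (s.L1 (fun x => Gam p S u y x - EG) (c := cG k K) (by positivity) 10 (by
    have := Gam_var h s.p01 hu1 hy
    rw [← s.hq, ← pow_mul] at this
    exact this)).2
  have hga2 : |Esl m (Gam p S u y) - EG| ≤ (2 * cG k K + 1) * q ^ 11 := by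
    have e : Esl m (Gam p S u y) - EG = Esl m (fun x => Gam p S u y x - EG) := by rw [Esl_sub, Esl_const s.m1.le]
    rw [e]; exact (Esl_norm_le m (fun x => Gam p S u y x - EG)).trans hga
  have hr := (s.L1 (Rr p S u) (c := cR k K) (by positivity) 6 (by
    have := Rr_bound h s.p01 hu1
    rw [← s.hq, ← pow_mul] at this
    exact this)).1
  have hw0 : 0 ≤ w := by
    have := Esl_mono (m := m) (f := fun _ => 0) (g := fun x => Yp p S y x ^ 2) (fun x _ => by positivity)
    rwa [Esl_const s.m1.le] at this
  set r := Real.sqrt w with hrd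
  have hr2 : r ^ 2 = w := Real.sq_sqrt hw0
  have hr0 : 0 ≤ r := Real.sqrt_nonneg _
  have hry : |Esl m (fun x => Rr p S u x * Yp p S y x)| ≤ (2 * cR k K + 1) * q ^ 7 * r := by
    apply abs_le_of_sq_le_sq _ (by positivity)
    refine (Esl_cauchy m _ _).trans ?_
    rw [mul_pow, hr2]
    gcongr
  set a : ℝ := 2 * cR k K + 1 with ha
  set b : ℝ := 2 * cG k K + 1 with hb
  have ha0 : 0 < a := by positivity
  have hb0 : 0 < b := by positivity
  have key : |w - v| ≤ b * q ^ 7 + a * q ^ 3 * r := by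
    have h4 : 0 < q ^ 4 := by positivity
    rw [← mul_le_mul_iff_right₀ h4]
    calc q ^ 4 * |w - v| = |q ^ 4 * (w - v)| := by rw [abs_mul, abs_of_pos h4]
      _ = |(Esl m (Gam p S u y) - EG) + Esl m (fun x => Rr p S u x * Yp p S y x)| := by
        congr 1; rw [mul_sub, hid2, hv]; ring
      _ ≤ b * q ^ 11 + a * q ^ 7 * r := (abs_add_le _ _).trans (add_le_add hga2 hry)
      _ = _ := by ring
  have hvu : v ≤ 2 * K ^ 2 * q ^ 8 := by
    have := le_of_abs_le (Gam_mean_upper h s.p01 hu1 hy)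
    rw [← hEG, hv, ← s.hq] at this
    have h4 : 0 < q ^ 4 := by positivity
    rw [← mul_le_mul_iff_left₀ h4]
    refine this.trans (le_of_eq ?_); ring
  have q78 : q ^ 7 ≤ q ^ 8 := pow_le_pow_right₀ hq1 (by norm_num)
  have q68 : q ^ 6 ≤ q ^ 8 := pow_le_pow_right₀ hq1 (by norm_num)
  have q67 : q ^ 6 ≤ q ^ 7 := pow_le_pow_right₀ hq1 (by norm_num)
  have hwb : w ≤ cW k K * q ^ 8 := by
    have h1 : w - v ≤ b * q ^ 7 + a * q ^ 3 * r := le_of_abs_le key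
    have h2 : a * q ^ 3 * r ≤ w / 2 + a ^ 2 * q ^ 6 / 2 := by
      rw [← hr2]; nlinarith [sq_nonneg (a * q ^ 3 - r)]
    have h3 : (cW k K : ℝ) = 4 * K ^ 2 + 2 * b + a ^ 2 := by rw [cW]; push_cast; rw [ha, hb]
    have h5 := mul_le_mul_of_nonneg_left q78 hb0.le
    have h6 := mul_le_mul_of_nonneg_left q68 (sq_nonneg a)
    rw [h3]
    linarith
  have hrb : r ≤ (cW k K + 1) * q ^ 4 := by
    apply le_of_abs_le
    apply abs_le_of_sq_le_sq _ (by positivity)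
    rw [hr2]
    refine hwb.trans ?_
    have : (cW k K : ℝ) ≤ (cW k K + 1) ^ 2 := by nlinarith [(Nat.cast_nonneg (cW k K) : (0:ℝ) ≤ _)]
    calc (cW k K : ℝ) * q ^ 8 ≤ (cW k K + 1) ^ 2 * q ^ 8 := by gcongr
      _ = _ := by ring
  have hmean := Y_mean s h hy
  rw [← ha] at hmean
  have e6 : Esl m (fun x => (Yp p S y x - Esl m (Yp p S y)) ^ 2) = w - (Esl m (Yp p S y)) ^ 2 := by
    have : (fun x => (Yp p S y x - Esl m (Yp p S y)) ^ 2) = fun x => Yp p S y x ^ 2 - (2 * Esl m (Yp p S y) * Yp p S y x - (Esl m (Yp p S y)) ^ 2) := by funext x; ring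
    rw [this, Esl_sub, Esl_sub, Esl_mulR, Esl_const s.m1.le]; ring
  rw [e6]
  have hm2 : (Esl m (Yp p S y)) ^ 2 ≤ a ^ 2 * q ^ 6 := by
    have := sq_le_sq' (by linarith [abs_nonneg (Esl m (Yp p S y)), neg_abs_le (Esl m (Yp p S y))]) (le_of_abs_le hmean)
    calc _ ≤ _ := this
      _ = _ := by ring
  have hcv : (cV k K : ℝ) = b + a * (cW k K + 1) + a ^ 2 := by rw [cV]; push_cast; rw [ha, hb]
  rw [hcv]
  calc |w - Esl m (Yp p S y) ^ 2 - v| = |(w - v) + (-(Esl m (Yp p S y) ^ 2))| := by congr 1; ring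
    _ ≤ |w - v| + |(-(Esl m (Yp p S y) ^ 2))| := abs_add_le _ _
    _ ≤ (b * q ^ 7 + a * q ^ 3 * ((cW k K + 1) * q ^ 4)) + a ^ 2 * q ^ 7 := by
      rw [abs_neg, abs_of_nonneg (sq_nonneg (Esl m (Yp p S y)))]
      gcongr ?_ + ?_
      · refine key.trans ?_; gcongr
      · refine hm2.trans ?_; gcongr
    _ = _ := by ring
end LF2

section CS
/-- uniform average over a finite type -/
noncomputable def av {α E : Type*} [Fintype α] [AddCommGroup E] [Module ℝ E] (f : α → E) : E := (Fintype.card α : ℝ)⁻¹ • ∑ x, f x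

variable {α β : Type*} [Fintype α] [Fintype β] {E : Type*} [NormedAddCommGroup E] [NormedSpace ℝ E]

lemma av_comm (f : α → β → E) : av (fun a => av (fun b => f a b)) = av (fun b => av (fun a => f a b)) := by
  simp only [av, ← Finset.smul_sum]; rw [Finset.sum_comm, smul_comm]
lemma av_norm (f : α → E) : ‖av f‖ ≤ av (fun x => ‖f x‖) := by
  simp only [av, smul_eq_mul]
  rw [norm_smul, Real.norm_of_nonneg (by positivity)]
  gcongr; exact norm_sum_le _ _
lemma av_mono {f g : α → ℝ} (h : ∀ x, f x ≤ g x) : av f ≤ av g := by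
  simp only [av, smul_eq_mul]
  exact mul_le_mul_of_nonneg_left (Finset.sum_le_sum fun x _ => h x) (by positivity)
lemma av_pow [Nonempty α] (f : α → ℝ) (hf : ∀ x, 0 ≤ f x) (N : ℕ) : (av f) ^ N ≤ av (fun x => f x ^ N) := by
  simp only [av, smul_eq_mul, Finset.mul_sum]
  exact Real.pow_arith_mean_le_arith_mean_pow Finset.univ (fun _ => (Fintype.card α : ℝ)⁻¹) f (fun _ _ => by positivity) (by
    rw [Finset.sum_const, Finset.card_univ, nsmul_eq_mul, mul_inv_cancel₀ (by simp)]) (fun x _ => hf x) N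
lemma av_ofReal (f : α → ℝ) : av (fun x => (f x : ℂ)) = ((av f : ℝ) : ℂ) := by simp [av]
lemma av_mul (c : ℂ) (f : α → ℂ) : av (fun x => c * f x) = c * av f := by
  simp only [av, ← Finset.mul_sum, Complex.real_smul]; ring
lemma av_mul' (c : ℂ) (f : α → ℂ) : av (fun x => f x * c) = av f * c := by
  simp only [av, ← Finset.sum_mul, Complex.real_smul]; ring
lemma av_equiv (e : α ≃ β) (f : β → E) : av (fun x => f (e x)) = av f := by
  simp only [av]; rw [Fintype.card_congr e, Equiv.sum_comp e f]
lemma av_prod (f : α × β → E) : av f = av (fun a => av (fun b => f (a, b))) := by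
  simp only [av, ← Finset.smul_sum]; rw [Fintype.sum_prod_type, Fintype.card_prod, smul_smul]; push_cast; rw [mul_inv]
lemma av_cons {r : ℕ} (f : (Fin (r + 1) → β) → E) : av f = av (fun b0 : β => av (fun b : Fin r → β => f (Fin.cons b0 b))) := by
  rw [← av_prod (fun z : β × (Fin r → β) => f (Fin.cons z.1 z.2)), ← av_equiv (Fin.consEquiv fun _ => β) f]; rfl

/-- the phase -/
noncomputable def ep (t : ℝ) : ℂ := Complex.exp (t * Complex.I)
lemma ep_norm (t : ℝ) : ‖ep t‖ = 1 := Complex.norm_exp_ofReal_mul_I t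
lemma ep_add (s t : ℝ) : ep (s + t) = ep s * ep t := by unfold ep; rw [← Complex.exp_add]; congr 1; push_cast; ring
lemma ep_conj (t : ℝ) : (starRingEnd ℂ) (ep t) = ep (-t) := by
  unfold ep; rw [← Complex.exp_conj]; congr 1; simp
lemma ep_sub (s t : ℝ) : ep (s - t) = ep s * (starRingEnd ℂ) (ep t) := by
  rw [ep_conj, ← ep_add, sub_eq_add_neg]

lemma av_ep_sq (f : β → ℝ) : ((‖av (fun b => ep (f b))‖ ^ 2 : ℝ) : ℂ) = av (fun b => av (fun b' => ep (f b - f b'))) := by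
  have h1 : ∀ b, av (fun b' => ep (f b - f b')) = ep (f b) * (starRingEnd ℂ) (av (fun b' => ep (f b'))) := by
    intro b
    simp only [ep_sub]
    rw [av_mul]
    congr 1
    simp [av]
  simp only [h1]
  rw [av_mul', Complex.mul_conj, Complex.normSq_eq_norm_sq]

lemma CS_main {A B ι : Type*} [Fintype A] [Nonempty A] [Fintype B] [Nonempty B] [Fintype ι] (r : ℕ) :
    ∀ (c : ι → A → ℝ) (h : ι → Fin r → B → ℝ),
    ‖av (fun b : Fin r → B => av (fun a : A => ep (∑ P, c P a * ∏ j, h P j (b j))))‖ ^ (2 ^ r) ≤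
      av (fun b : Fin r → B => av (fun b' : Fin r → B => ‖av (fun a : A => ep (∑ P, c P a * ∏ j, (h P j (b j) - h P j (b' j))))‖)) := by
  induction r with
  | zero =>
    intro c h
    simp [av]
  | succ r ih =>
    intro c h
    set D : B → B → ℝ := fun b0 b0' => ‖av (fun b : Fin r → B => av (fun a : A => ep (∑ P, (c P a * (h P 0 b0 - h P 0 b0')) * ∏ j : Fin r, h P j.succ (b j))))‖ with hD
    have h1 : ‖av (fun b : Fin (r+1) → B => av (fun a : A => ep (∑ P, c P a * ∏ j, h P j (b j))))‖ ^ 2 ≤ av (fun b0 => av (fun b0' => D b0 b0')) := by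
      rw [av_cons, av_comm]
      have e1 : ∀ b : Fin r → B, av (fun b0 : B => av (fun a : A => ep (∑ P, c P a * ∏ j, h P j ((Fin.cons b0 b : Fin (r+1) → B) j)))) =
          av (fun a : A => av (fun b0 : B => ep (∑ P, (c P a * h P 0 b0) * ∏ j : Fin r, h P j.succ (b j)))) := by
        intro b
        rw [av_comm]
        congr 1; funext a; congr 1; funext b0; congr 1
        refine Finset.sum_congr rfl fun P _ => ?_
        rw [Fin.prod_univ_succ]; simp [mul_assoc]
      simp only [e1]
      set g : (Fin r → B) → A → B → ℝ := fun b a b0 => ∑ P, (c P a * h P 0 b0) * ∏ j : Fin r, h P j.succ (b j) with hg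
      have s1 : ‖av (fun b : Fin r → B => av (fun a : A => av (fun b0 : B => ep (g b a b0))))‖ ^ 2 ≤ av (fun b : Fin r → B => av (fun a : A => ‖av (fun b0 : B => ep (g b a b0))‖ ^ 2)) := by
        rw [← av_prod (fun z : (Fin r → B) × A => av (fun b0 : B => ep (g z.1 z.2 b0))), ← av_prod (fun z : (Fin r → B) × A => ‖av (fun b0 : B => ep (g z.1 z.2 b0))‖ ^ 2)]
        exact (pow_le_pow_left₀ (norm_nonneg _) (av_norm _) 2).trans (av_pow _ (fun _ => norm_nonneg _) 2)
      refine s1.trans ?_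
      have s2 : ((av (fun b : Fin r → B => av (fun a : A => ‖av (fun b0 : B => ep (g b a b0))‖ ^ 2)) : ℝ) : ℂ) =
          av (fun b0 => av (fun b0' => av (fun b : Fin r → B => av (fun a : A => ep (g b a b0 - g b a b0'))))) := by
        simp only [← av_ofReal, av_ep_sq]
        have t1 : ∀ b : Fin r → B, av (fun a : A => av (fun b0 => av (fun b0' => ep (g b a b0 - g b a b0')))) =
           av (fun b0 => av (fun b0' => av (fun a : A => ep (g b a b0 - g b a b0')))) := by
          intro b; rw [av_comm]; congr 1; funext b0; rw [av_comm]
        simp only [t1]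
        rw [av_comm]; congr 1; funext b0; rw [av_comm]
      have s3 : av (fun b : Fin r → B => av (fun a : A => ‖av (fun b0 : B => ep (g b a b0))‖ ^ 2)) ≤
          ‖av (fun b0 => av (fun b0' => av (fun b : Fin r → B => av (fun a : A => ep (g b a b0 - g b a b0')))))‖ := by
        rw [← s2, Complex.norm_real]; exact le_abs_self _
      refine s3.trans ((av_norm _).trans (av_mono fun b0 => (av_norm _).trans (av_mono fun b0' => le_of_eq ?_)))
      rw [hD]
      simp only [hg, ← Finset.sum_sub_distrib]
      congr 2; funext b; congr 1; funext a; congr 1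
      refine Finset.sum_congr rfl fun P _ => by ring
    rw [pow_succ' 2 r, pow_mul]
    refine (pow_le_pow_left₀ (by positivity) h1 _).trans ?_
    have j1 : (av (fun b0 => av (fun b0' => D b0 b0'))) ^ (2 ^ r) ≤ av (fun b0 => av (fun b0' => D b0 b0' ^ (2 ^ r))) := by
      rw [← av_prod (fun z : B × B => D z.1 z.2), ← av_prod (fun z : B × B => D z.1 z.2 ^ (2 ^ r))]
      exact av_pow _ (fun _ => norm_nonneg _) _
    refine j1.trans ?_
    have j2 : ∀ b0 b0', D b0 b0' ^ (2 ^ r) ≤ _ := fun b0 b0' => ih (fun P a => c P a * (h P 0 b0 - h P 0 b0')) (fun P j => h P j.succ)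
    refine (av_mono fun b0 => av_mono fun b0' => j2 b0 b0').trans (le_of_eq ?_)
    rw [av_cons]
    congr 1; funext b0
    rw [av_comm]
    rw [av_comm]
    have : ∀ b : Fin r → B, av (fun b' : Fin (r+1) → B => ‖av (fun a : A => ep (∑ P, c P a * ∏ j, (h P j ((Fin.cons b0 b : Fin (r+1) → B) j) - h P j (b' j))))‖) =
       av (fun b0' : B => av (fun b' : Fin r → B => ‖av (fun a : A => ep (∑ P, (c P a * (h P 0 b0 - h P 0 b0')) * ∏ j : Fin r, (h P j.succ (b j) - h P j.succ (b' j))))‖)) := by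
      intro b
      rw [av_cons]
      congr 1; funext b0'; congr 1; funext b'; congr 2; funext a; congr 1
      refine Finset.sum_congr rfl fun P _ => ?_
      rw [Fin.prod_univ_succ]; simp [mul_assoc]
    simp only [this]
    rw [av_comm]
end CS

section HF
variable {G T ι : Type*} [Fintype G] [DecidableEq G] [Fintype T] [DecidableEq T] [Fintype ι] [DecidableEq ι] {r : ℕ}

/-- bit to real -/
noncomputable def bt (b : Bool) : ℝ := if b then 1 else 0

/-- edge count -/
noncomputable def pX (pt : ι → Fin (r+1) → G) (x : G → Bool) : ℝ := ∑ P, ∏ i, bt (x (pt P i))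

/-- flipping permutation -/
def flp (β : Fin (r+1) → T → Bool) : Equiv.Perm (Fin (r+1) × T × Bool) where
  toFun z := (z.1, z.2.1, xor z.2.2 (β z.1 z.2.1))
  invFun z := (z.1, z.2.1, xor z.2.2 (β z.1 z.2.1))
  left_inv z := by simp
  right_inv z := by simp

/-- flipped configuration -/
noncomputable def xb (pos : Fin (r+1) × T × Bool ↪ G) (β : Fin (r+1) → T → Bool) (y : G → Bool) : G → Bool := y ∘ ((flp β).viaEmbedding pos)

lemma xb_pos (pos : Fin (r+1) × T × Bool ↪ G) (β : Fin (r+1) → T → Bool) (y : G → Bool) (j t e) :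
    xb pos β y (pos (j,t,e)) = y (pos (j,t,xor e (β j t))) := by
  simp [xb, Equiv.Perm.viaEmbedding_apply, flp]
lemma xb_out (pos : Fin (r+1) × T × Bool ↪ G) (β : Fin (r+1) → T → Bool) (y : G → Bool) {g : G} (h : g ∉ Set.range pos) :
    xb pos β y g = y g := by
  simp only [xb, Function.comp]; rw [Equiv.Perm.viaEmbedding_apply_of_notMem _ _ _ h]

/-- membership in a group -/
def ing (pos : Fin (r+1) × T × Bool ↪ G) (j : Fin (r+1)) (g : G) : Prop := ∃ t e, g = pos (j,t,e)

lemma ing_unique {pos : Fin (r+1) × T × Bool ↪ G} {j j' : Fin (r+1)} {g : G} (h : ing pos j g) (h' : ing pos j' g) : j = j' := by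
  obtain ⟨t, e, rfl⟩ := h; obtain ⟨t', e', h'⟩ := h'
  have := pos.injective h'
  simp at this; exact this.1

lemma xb_grp {pos : Fin (r+1) × T × Bool ↪ G} {β β' : Fin (r+1) → T → Bool} {y : G → Bool} {g : G} (h : ∀ j, ing pos j g → β j = β' j) :
    xb pos β y g = xb pos β' y g := by
  by_cases hg : g ∈ Set.range pos
  · obtain ⟨⟨j, t, e⟩, rfl⟩ := hg
    rw [xb_pos, xb_pos, h j ⟨t, e, rfl⟩]
  · rw [xb_out _ _ _ hg, xb_out _ _ _ hg]

/-- full edges -/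
structure HFS (pt : ι → Fin (r+1) → G) (pos : Fin (r+1) × T × Bool ↪ G) (Fu : Finset ι) (tt : ι → Fin (r+1) → T) : Prop where
  mem : ∀ P ∈ Fu, ∀ i, pt P i = pos (i, tt P i, false)
  out : ∀ P, P ∉ Fu → ∃ j, ∀ i, ¬ ing pos j (pt P i)

/-- increments -/
noncomputable def Del (pos : Fin (r+1) × T × Bool ↪ G) (y : G → Bool) (b b' : Fin r → T → Bool) (j : Fin r) (t : T) : ℝ :=
  bt (y (pos (j.succ,t,b j t))) - bt (y (pos (j.succ,t,b' j t)))
/-- linear form coefficient -/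
noncomputable def Ww (Fu : Finset ι) (tt : ι → Fin (r+1) → T) (pos : Fin (r+1) × T × Bool ↪ G) (y : G → Bool) (b b' : Fin r → T → Bool) (t : T) : ℝ :=
  ∑ P ∈ Fu.filter (fun P => tt P 0 = t), ∏ j, Del pos y b b' j (tt P j.succ)
/-- base increment -/
noncomputable def gam (pos : Fin (r+1) × T × Bool ↪ G) (y : G → Bool) (t : T) : ℝ :=
  bt (y (pos (0,t,true))) - bt (y (pos (0,t,false)))

lemma av_const {α E : Type*} [Fintype α] [Nonempty α] [NormedAddCommGroup E] [NormedSpace ℝ E] (c : E) : av (fun _ : α => c) = c := by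
  simp only [av, Finset.sum_const, Finset.card_univ]
  rw [← Nat.cast_smul_eq_nsmul ℝ, smul_smul, inv_mul_cancel₀ (by simp), one_smul]

lemma Esl_av {α : Type*} [Fintype α] (m : ℕ) (f : α → (G → Bool) → ℂ) : Esl m (fun y => av (fun a => f a y)) = av (fun a => Esl m (f a)) := by
  simp only [Esl, av, ← Finset.smul_sum]; rw [Finset.sum_comm, smul_comm]

lemma Esl_pow {m : ℕ} (hm : m ≤ Fintype.card G) (f : (G → Bool) → ℝ) (hf : ∀ x, 0 ≤ f x) (N : ℕ) : (Esl m f) ^ N ≤ Esl m (fun x => f x ^ N) := by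
  simp only [Esl, smul_eq_mul, Finset.mul_sum]
  refine Real.pow_arith_mean_le_arith_mean_pow (slc G m) (fun _ => ((slc G m).card : ℝ)⁻¹) f (fun _ _ => by positivity) ?_ (fun x _ => hf x) N
  rw [Finset.sum_const, nsmul_eq_mul, mul_inv_cancel₀]
  rw [card_slc]; exact_mod_cast (Nat.choose_pos hm).ne'

lemma av_bits (g : T → Bool → ℝ) (C : ℝ) : ‖av (fun a : T → Bool => ep (C + ∑ t, g t (a t)))‖ = ∏ t, |Real.cos ((g t true - g t false) / 2)| := by
  have e : ∀ a : T → Bool, ep (C + ∑ t, g t (a t)) = ep C * ∏ t, ep (g t (a t)) := by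
    intro a; rw [ep_add]; congr 1
    unfold ep; rw [← Complex.exp_sum, ← Finset.sum_mul]; push_cast; rfl
  simp only [e]
  rw [av_mul, norm_mul, ep_norm, one_mul, av, norm_smul, ← Fintype.piFinset_univ, ← Finset.prod_univ_sum (fun _ => Finset.univ) (fun t b => ep (g t b)), norm_prod]
  have e2 : ∀ t, ‖∑ b, ep (g t b)‖ = 2 * |Real.cos ((g t true - g t false) / 2)| := by
    intro t
    have : ∑ b, ep (g t b) = ep ((g t true + g t false) / 2) * ((2 * Real.cos ((g t true - g t false) / 2) : ℝ) : ℂ) := by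
      rw [Fintype.sum_bool]
      have h1 : ep (g t true) = ep ((g t true + g t false) / 2) * ep ((g t true - g t false) / 2) := by rw [← ep_add]; congr 1; ring
      have h2 : ep (g t false) = ep ((g t true + g t false) / 2) * ep (-((g t true - g t false) / 2)) := by rw [← ep_add]; congr 1; ring
      rw [h1, h2, ← mul_add]; congr 1
      push_cast
      rw [Complex.two_cos]; unfold ep; push_cast; rfl
    rw [this, norm_mul, ep_norm, one_mul, Complex.norm_real, Real.norm_eq_abs, abs_mul]; norm_num
  simp only [e2, Finset.prod_mul_distrib, Finset.prod_const, Finset.card_univ]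
  simp

open Classical in
lemma HF1 {pt : ι → Fin (r+1) → G} {pos : Fin (r+1) × T × Bool ↪ G} {Fu : Finset ι} {tt : ι → Fin (r+1) → T}
    (H : HFS pt pos Fu tt) {m : ℕ} (hm : m ≤ Fintype.card G) (θ : ℝ) :
    ‖Esl m (gf (pX pt) θ)‖ ^ (2 ^ r) ≤ Esl m (fun y => av (fun b : Fin r → T → Bool => av (fun b' : Fin r → T → Bool =>
      ∏ t, |Real.cos (θ * gam pos y t * Ww Fu tt pos y b b' t / 2)|))) := by
  have s0 : Esl m (gf (pX pt) θ) = Esl m (fun y => av (fun b : Fin r → T → Bool => av (fun a : T → Bool => ep (θ * pX pt (xb pos (Fin.cons a b) y))))) := by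
    rw [Esl_av]
    have : ∀ (b : Fin r → T → Bool), Esl m (fun y => av (fun a : T → Bool => ep (θ * pX pt (xb pos (Fin.cons a b) y)))) = Esl m (gf (pX pt) θ) := by
      intro b
      rw [Esl_av]
      have : ∀ a : T → Bool, Esl m (fun y => ep (θ * pX pt (xb pos (Fin.cons a b) y))) = Esl m (gf (pX pt) θ) := by
        intro a
        exact Esl_perm m ((flp (Fin.cons a b : Fin (r+1) → T → Bool)).viaEmbedding pos) (gf (pX pt) θ)
      simp only [this, av_const]
    simp only [this, av_const]
  rw [s0]
  refine (pow_le_pow_left₀ (norm_nonneg _) (Esl_norm_le m _) _).trans ((Esl_pow hm _ (fun _ => norm_nonneg _) _).trans (Esl_mono fun y _ => ?_))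
  -- fixed y
  let X1 : (T → Bool) → G → ℝ := fun a g => bt (xb pos (fun _ => a) y g)
  let cf : ι → (T → Bool) → ℝ := fun P a => ∏ i, if (∃ j : Fin r, ing pos j.succ (pt P i)) then 1 else X1 a (pt P i)
  let hf : ι → Fin r → (T → Bool) → ℝ := fun P j b => ∏ i, if ing pos j.succ (pt P i) then X1 b (pt P i) else 1
  have e1 : ∀ (b : Fin r → T → Bool) (a : T → Bool), θ * pX pt (xb pos (Fin.cons a b) y) = ∑ P, (θ * cf P a) * ∏ j, hf P j (b j) := by
    intro b a
    unfold pX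
    rw [Finset.mul_sum]
    refine Finset.sum_congr rfl fun P _ => ?_
    rw [mul_assoc]; congr 1
    simp only [cf, hf]
    rw [Finset.prod_comm, ← Finset.prod_mul_distrib]
    refine Finset.prod_congr rfl fun i _ => ?_
    by_cases h : ∃ j : Fin r, ing pos j.succ (pt P i)
    · obtain ⟨j, hj⟩ := h
      rw [if_pos ⟨j, hj⟩, one_mul, Finset.prod_eq_single j]
      · rw [if_pos hj]; simp only [X1]; congr 1
        refine xb_grp fun j' hj' => ?_
        rw [ing_unique hj' hj]; simp
      · intro j' _ hne
        rw [if_neg]; intro h'; exact hne (Fin.succ_injective _ (ing_unique h' hj))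
      · simp
    · rw [if_neg h, Finset.prod_eq_one, mul_one]
      · simp only [X1]; congr 1
        refine xb_grp fun j' hj' => ?_
        rcases Fin.eq_zero_or_eq_succ j' with rfl | ⟨j, rfl⟩
        · simp
        · exact absurd ⟨j, hj'⟩ h
      · intro j _; rw [if_neg]; intro h'; exact h ⟨j, h'⟩
  simp only [e1]
  refine (CS_main r (fun P a => θ * cf P a) hf).trans (av_mono fun b => av_mono fun b' => le_of_eq ?_)
  -- compute
  have e2 : ∀ P ∈ Fu, ∀ a, cf P a = bt (y (pos (0, tt P 0, a (tt P 0)))) := by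
    intro P hP a
    simp only [cf]
    rw [Finset.prod_eq_single 0]
    · rw [if_neg]
      · simp only [X1]; rw [H.mem P hP, xb_pos]; simp
      · rintro ⟨j, hj⟩
        have := ing_unique hj ⟨_, _, H.mem P hP 0⟩
        exact Fin.succ_ne_zero _ this
    · intro i _ hi
      obtain ⟨j, rfl⟩ := Fin.exists_succ_eq_of_ne_zero hi
      rw [if_pos ⟨j, _, _, H.mem P hP _⟩]
    · simp
  have e3 : ∀ P ∈ Fu, ∀ j b, hf P j b = bt (y (pos (j.succ, tt P j.succ, b (tt P j.succ)))) := by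
    intro P hP j b
    simp only [hf]
    rw [Finset.prod_eq_single j.succ]
    · rw [if_pos ⟨_, _, H.mem P hP _⟩]
      simp only [X1]; rw [H.mem P hP, xb_pos]; simp
    · intro i _ hi
      rw [if_neg]; intro h
      exact hi (ing_unique ⟨_, _, H.mem P hP i⟩ h)
    · simp
  have e4 : ∀ P, P ∉ Fu → ∀ a, cf P a * ∏ j, (hf P j (b j) - hf P j (b' j)) = cf P (fun _ => false) * ∏ j, (hf P j (b j) - hf P j (b' j)) := by
    intro P hP a
    obtain ⟨j, hj⟩ := H.out P hP
    rcases Fin.eq_zero_or_eq_succ j with rfl | ⟨j, rfl⟩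
    · congr 1
      simp only [cf]
      refine Finset.prod_congr rfl fun i _ => ?_
      split_ifs with h
      · rfl
      · simp only [X1]; congr 1
        refine xb_grp fun j' hj' => ?_
        rcases Fin.eq_zero_or_eq_succ j' with rfl | ⟨j, rfl⟩
        · exact absurd hj' (hj i)
        · exact absurd ⟨j, hj'⟩ h
    · have : ∏ j, (hf P j (b j) - hf P j (b' j)) = 0 := by
        refine Finset.prod_eq_zero (Finset.mem_univ j) ?_
        simp [hf, hj]
      rw [this]; simp
  have e5 : ∀ a : T → Bool, ∑ P, θ * cf P a * ∏ j, (hf P j (b j) - hf P j (b' j)) =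
     (∑ P ∈ Fuᶜ, θ * (cf P (fun _ => false) * ∏ j, (hf P j (b j) - hf P j (b' j)))) + ∑ t, (fun t e => θ * bt (y (pos (0, t, e))) * Ww Fu tt pos y b b' t) t (a t) := by
    intro a
    rw [← Finset.sum_add_sum_compl Fu, add_comm]
    congr 1
    · refine Finset.sum_congr rfl fun P hP => ?_
      rw [mul_assoc, e4 P (by simpa using hP) a]
    · simp only [Ww, Finset.mul_sum]
      rw [← Finset.sum_fiberwise_of_maps_to (t := Finset.univ) (g := fun P => tt P 0) (fun _ _ => Finset.mem_univ _)]
      refine Finset.sum_congr rfl fun t _ => Finset.sum_congr ?_ fun P hP => ?_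
      · ext; simp
      · rw [Finset.mem_filter] at hP
        rw [e2 P hP.1 a, hP.2]
        congr 1
        refine Finset.prod_congr rfl fun j _ => ?_
        rw [e3 P hP.1, e3 P hP.1]; rfl
  simp only [e5]
  rw [av_bits (fun t e => θ * bt (y (pos (0, t, e))) * Ww Fu tt pos y b b' t)]
  refine Finset.prod_congr rfl fun t _ => ?_
  congr 2
  simp only [gam]; ring
end HF

section ExSum
variable {α β : Type*} [Fintype α] [DecidableEq α] [Fintype β] [DecidableEq β]

lemma Ex_sumElim (q : α → ℝ) (q' : β → ℝ) (f : (α ⊕ β → Bool) → ℝ) :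
    Ex (Sum.elim q q') f = Ex q (fun x => Ex q' (fun x' => f (Sum.elim x x'))) := by
  simp only [Ex, Finset.mul_sum]
  rw [← Fintype.sum_prod_type (f := fun z : (α → Bool) × (β → Bool) => tw q z.1 * (tw q' z.2 * f (Sum.elim z.1 z.2)))]
  rw [← (Equiv.sumArrowEquivProdArrow α β Bool).symm.sum_comp]
  refine Finset.sum_congr rfl fun z _ => ?_
  have : (Equiv.sumArrowEquivProdArrow α β Bool).symm z = Sum.elim z.1 z.2 := rfl
  rw [this, ← mul_assoc]
  congr 1
  simp only [tw, Fintype.prod_sum_type, Sum.elim_inl, Sum.elim_inr]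

lemma av_eq_Ex (f : (α → Bool) → ℝ) : av f = Ex (fun _ => 1 / 2) f := by
  have : ∀ x : α → Bool, tw (fun _ => (1 / 2 : ℝ)) x = (1/2)^(Fintype.card α) := by
    intro x; unfold tw bw
    rw [Finset.prod_congr rfl (g := fun _ => (1/2:ℝ))]
    · simp
    · intro i _; split_ifs <;> norm_num
  simp only [Ex, this, av, ← Finset.mul_sum, smul_eq_mul]
  simp

lemma Ex_dsq (q : α → ℝ) {i j : α} (hij : i ≠ j) {s : ℝ} (hi : q i = s) (hj : q j = s) :
    Ex q (fun x => bt (x i) - bt (x j)) = 0 ∧ Ex q (fun x => (bt (x i) - bt (x j)) ^ 2) = 2 * (s * (1 - s)) := by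
  have c : ∀ i, Ex q (fun x => bt (x i)) = q i := by intro i; rw [Ex_coord q i bt]; simp [bt]
  constructor
  · rw [Ex_sub, c, c, hi, hj, sub_self]
  · have e : ∀ x : α → Bool, (bt (x i) - bt (x j)) ^ 2 = bt (x i) + bt (x j) - 2 * (bt (x i) * bt (x j)) := by
      intro x; unfold bt; split_ifs <;> norm_num
    simp only [e]
    rw [Ex_sub, Ex_add, Ex_smul, Ex_mul_of_dep q (dep_coord (i := i) bt) (dep_coord (i := j) bt) (by simpa using hij), c, c, hi, hj]
    ring
end ExSum

lemma prod_cos_le {U : Type*} [Fintype U] (z : U → ℝ) :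
    ∏ u, |Real.cos (z u)| ≤ 1 - ∑ u, z u ^ 2 / 2 + ∑ u, z u ^ 4 / 2 + (Fintype.card U : ℝ) * ∑ u, z u ^ 4 / 8 := by
  have a1 : ∀ x : ℝ, 1 - |Real.cos x| ≤ x ^ 2 / 2 := fun x => by
    have := Real.one_sub_sq_div_two_le_cos (x := x)
    have := le_abs_self (Real.cos x); linarith
  have a0 : ∀ x : ℝ, 0 ≤ 1 - |Real.cos x| := fun x => by have := Real.abs_cos_le_one x; linarith
  have a2 : ∀ x : ℝ, (x ^ 2 - x ^ 4) / 2 ≤ 1 - |Real.cos x| := by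
    have h : ∀ x : ℝ, 0 ≤ x → (x ^ 2 - x ^ 4) / 2 ≤ 1 - |Real.cos x| := by
      intro x hx
      have t1 : Real.sin x ^ 2 / 2 ≤ 1 - |Real.cos x| := by
        have := Real.sin_sq_add_cos_sq x
        have h2 : Real.cos x ^ 2 = |Real.cos x| ^ 2 := (sq_abs _).symm
        nlinarith [a0 x, abs_nonneg (Real.cos x)]
      refine le_trans ?_ t1
      rcases le_or_gt x 1 with h1 | h1
      · rcases hx.eq_or_lt with rfl | h0
        · simp
        have := Real.sin_gt_sub_cube h0
        have t2 : 0 ≤ x - x ^ 3 / 6 := by nlinarith [mul_nonneg hx hx, mul_nonneg (mul_nonneg hx hx) hx, mul_le_one₀ h1 hx h1]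
        have t3 := pow_le_pow_left₀ t2 this.le 2
        nlinarith [pow_nonneg hx 6, pow_nonneg hx 4]
      · nlinarith [sq_nonneg (Real.sin x), mul_pos (by linarith : (0:ℝ) < x) (by linarith : (0:ℝ) < x), mul_nonneg (sq_nonneg x) (by nlinarith : (0:ℝ) ≤ x ^ 2 - 1)]
    intro x
    rcases le_total 0 x with hx | hx
    · exact h x hx
    · have := h (-x) (by linarith); rw [Real.cos_neg] at this
      convert this using 2; ring
  set v : U → ℝ := fun u => 1 - |Real.cos (z u)| with hv
  have b1 : ∏ u, |Real.cos (z u)| ≤ Real.exp (-(∑ u, v u)) := by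
    rw [← Finset.sum_neg_distrib, Real.exp_sum]
    refine Finset.prod_le_prod (fun _ _ => abs_nonneg _) fun u _ => ?_
    have := Real.add_one_le_exp (-(v u)); simp only [hv] at this ⊢; linarith
  have hV0 : 0 ≤ ∑ u, v u := Finset.sum_nonneg fun u _ => a0 _
  have b2 : Real.exp (-(∑ u, v u)) ≤ 1 - ∑ u, v u + (∑ u, v u) ^ 2 / 2 := by
    have hq : ∀ x : ℝ, 0 ≤ x → Real.exp (-x) ≤ 1 - x + x ^ 2 / 2 := by
      intro x hx
      have := Real.quadratic_le_exp_of_nonneg hx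
      rw [Real.exp_neg]
      have h2 : 0 < 1 + x + x ^ 2 / 2 := by positivity
      calc (Real.exp x)⁻¹ ≤ (1 + x + x ^ 2 / 2)⁻¹ := inv_anti₀ h2 this
        _ ≤ _ := by
          rw [inv_le_iff_one_le_mul₀ h2]
          nlinarith [pow_nonneg hx 4]
    exact hq _ hV0
  have b3 : (∑ u, v u) ^ 2 ≤ (Fintype.card U : ℝ) * ∑ u, z u ^ 4 / 4 := by
    have := sq_sum_le_card_mul_sum_sq (s := (Finset.univ : Finset U)) (f := v)
    refine this.trans ?_
    rw [Finset.card_univ]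
    gcongr with u
    have h1 := pow_le_pow_left₀ (a0 (z u)) (a1 (z u)) 2
    simp only [hv]; linarith [show (z u ^ 2 / 2) ^ 2 = z u ^ 4 / 4 by ring]
  have b4 : ∑ u, z u ^ 2 / 2 - ∑ u, z u ^ 4 / 2 ≤ ∑ u, v u := by
    rw [← Finset.sum_sub_distrib]
    refine Finset.sum_le_sum fun u _ => ?_
    have := a2 (z u); simp only [hv]; linarith
  have b5 : ∑ u, z u ^ 4 / 4 = 2 * ∑ u, z u ^ 4 / 8 := by
    rw [Finset.mul_sum]; exact Finset.sum_congr rfl fun _ _ => by ring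
  rw [b5] at b3
  linarith

section HFw
variable {G T ι : Type*} [Fintype G] [DecidableEq G] [Fintype T] [DecidableEq T] [Fintype ι] [DecidableEq ι] {r : ℕ}

/-- enlarged index set -/
abbrev Om (G T : Type*) (r : ℕ) := G ⊕ ((Fin r × T) ⊕ (Fin r × T))
/-- probabilities -/
noncomputable def qq (p : ℝ) : Om G T r → ℝ := Sum.elim (fun _ => p) (Sum.elim (fun _ => 1 / 2) (fun _ => 1 / 2))
lemma qq_PQ {p : ℝ} (hp : 0 ≤ p ∧ p ≤ 1) : PQ (qq p : Om G T r → ℝ) := by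
  rintro (i | i | i) <;> simp [qq, hp] <;> norm_num
/-- first component -/
def oy (ω : Om G T r → Bool) : G → Bool := fun g => ω (Sum.inl g)
/-- second component -/
def ob (ω : Om G T r → Bool) : Fin r → T → Bool := fun j t => ω (Sum.inr (Sum.inl (j, t)))
/-- third component -/
def oc (ω : Om G T r → Bool) : Fin r → T → Bool := fun j t => ω (Sum.inr (Sum.inr (j, t)))

lemma HF2 {m : ℕ} (h0 : 0 < m) (h1 : m < Fintype.card G) (f : (G → Bool) → (Fin r → T → Bool) → (Fin r → T → Bool) → ℝ) (hf : ∀ y b b', 0 ≤ f y b b') :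
    Esl m (fun y => av (fun b => av (fun b' => f y b b'))) ≤ 2 * Real.sqrt (Fintype.card G) * Ex (qq ((m : ℝ) / Fintype.card G)) (fun ω : Om G T r → Bool => f (oy ω) (ob ω) (oc ω)) := by
  have e : ∀ F : (Fin r → T → Bool) → ℝ, av F = Ex (fun _ => 1 / 2) (fun z : Fin r × T → Bool => F (fun j t => z (j, t))) := by
    intro F
    rw [← av_eq_Ex]
    exact (av_equiv (Equiv.curry (Fin r) T Bool) F).symm
  refine (Esl_le_Ex h0 h1 _ fun y => ?_).trans (le_of_eq ?_)
  · have : ∀ {α : Type _} [Fintype α] (g : α → ℝ), (∀ x, 0 ≤ g x) → 0 ≤ av g := by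
      intro α _ g hg; unfold av; exact smul_nonneg (by positivity) (Finset.sum_nonneg fun x _ => hg x)
    exact this _ fun b => this _ fun b' => hf y b b'
  · congr 1
    unfold qq
    rw [Ex_sumElim]
    congr 1; funext y
    rw [Ex_sumElim, e]
    congr 1; funext z
    rw [e]; rfl

variable {pos : Fin (r+1) × T × Bool ↪ G}

/-- blocks -/
def blk (pos : Fin (r+1) × T × Bool ↪ G) (j : Fin r) (t : T) : Finset (Om G T r) :=
  ({Sum.inr (Sum.inl (j,t))} ∪ {Sum.inr (Sum.inr (j,t))}) ∪ ({Sum.inl (pos (j.succ,t,true))} ∪ {Sum.inl (pos (j.succ,t,false))})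
/-- base blocks -/
def blk0 (pos : Fin (r+1) × T × Bool ↪ G) (t : T) : Finset (Om G T r) :=
  {Sum.inl (pos (0,t,true))} ∪ {Sum.inl (pos (0,t,false))}

lemma blk_disj {j j' : Fin r} {t t' : T} (h : ¬ (j = j' ∧ t = t')) : Disjoint (blk pos j t) (blk pos j' t') := by
  rw [Finset.disjoint_left]
  intro a ha hb
  simp only [blk, Finset.mem_union, Finset.mem_singleton] at ha hb
  apply h
  rcases ha with (ha | ha) | (ha | ha) <;> rcases hb with (hb | hb) | (hb | hb) <;> rw [ha] at hb <;> simp at hb <;> tauto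
lemma blk0_disj {j : Fin r} {t t' : T} : Disjoint (blk0 pos t') (blk pos j t) := by
  rw [Finset.disjoint_left]
  intro a ha hb
  simp only [blk, blk0, Finset.mem_union, Finset.mem_singleton] at ha hb
  rcases ha with (ha | ha) <;> rcases hb with (hb | hb) | (hb | hb) <;> rw [ha] at hb <;> simp at hb <;> exact absurd hb.1 (by simp [Fin.ext_iff])

/-- product form of increments -/
noncomputable def Dw (pos : Fin (r+1) × T × Bool ↪ G) (j : Fin r) (t : T) (ω : Om G T r → Bool) : ℝ :=
  (bt (ω (Sum.inr (Sum.inl (j,t)))) - bt (ω (Sum.inr (Sum.inr (j,t))))) * (bt (ω (Sum.inl (pos (j.succ,t,true)))) - bt (ω (Sum.inl (pos (j.succ,t,false)))))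

lemma Del_eq (ω : Om G T r → Bool) (j t) : Del pos (oy ω) (ob ω) (oc ω) j t = Dw pos j t ω := by
  unfold Del Dw ob oc oy
  cases hb : ω (Sum.inr (Sum.inl (j,t))) <;> cases hc : ω (Sum.inr (Sum.inr (j,t))) <;> simp [bt]

lemma bt_sub_abs (a b : Bool) : |bt a - bt b| ≤ 1 := by cases a <;> cases b <;> simp [bt]

lemma dep_dif {α : Type*} [Fintype α] [DecidableEq α] (i j : α) : DependsOn (fun x : α → Bool => bt (x i) - bt (x j)) (({i} ∪ {j} : Finset α) : Set α) := by
  intro x y h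
  simp only
  rw [h i (by simp), h j (by simp)]

lemma Dw_dep (j : Fin r) (t : T) : DependsOn (Dw pos j t) (blk pos j t : Set (Om G T r)) := dep_mul (dep_dif _ _) (dep_dif _ _)
lemma Dw_abs (j : Fin r) (t : T) (ω) : |Dw pos j t ω| ≤ 1 := by
  unfold Dw; rw [abs_mul]; exact mul_le_one₀ (bt_sub_abs _ _) (abs_nonneg _) (bt_sub_abs _ _)

lemma Dw_dd {j : Fin r} {t : T} : Disjoint (({Sum.inr (Sum.inl (j,t))} ∪ {Sum.inr (Sum.inr (j,t))} : Finset (Om G T r))) ({Sum.inl (pos (j.succ,t,true))} ∪ {Sum.inl (pos (j.succ,t,false))}) := by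
  rw [Finset.disjoint_left]; intro a ha hb
  simp only [Finset.mem_union, Finset.mem_singleton] at ha hb
  rcases ha with (ha | ha) <;> rcases hb with (hb | hb) <;> rw [ha] at hb <;> simp at hb
lemma Dw_mean (p : ℝ) (j : Fin r) (t : T) : Ex (qq p) (Dw pos j t) = 0 := by
  unfold Dw
  rw [Ex_mul_of_dep _ (dep_dif _ _) (dep_dif _ _) Dw_dd, (Ex_dsq (qq p) (s := 1/2) (by simp) rfl rfl).1, zero_mul]
lemma Dw_sq (p : ℝ) (j : Fin r) (t : T) : Ex (qq p) (fun ω => Dw pos j t ω ^ 2) = p * (1 - p) := by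
  simp only [Dw, mul_pow]
  have d : ∀ i j : Om G T r, DependsOn (fun x : Om G T r → Bool => (bt (x i) - bt (x j))^2) (({i} ∪ {j} : Finset (Om G T r)) : Set (Om G T r)) := by
    intro i j x y h; simp only; rw [h i (by simp), h j (by simp)]
  rw [Ex_mul_of_dep _ (d _ _) (d _ _) Dw_dd, (Ex_dsq (qq p) (s := 1/2) (by simp) rfl rfl).2, (Ex_dsq (qq p) (s := p) (by simp) rfl rfl).2]
  ring

/-- edge monomial -/
noncomputable def Zw (pos : Fin (r+1) × T × Bool ↪ G) (tp : Fin (r+1) → T) (ω : Om G T r → Bool) : ℝ := ∏ j : Fin r, Dw pos j (tp j.succ) ω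
/-- edge support -/
def SZ (pos : Fin (r+1) × T × Bool ↪ G) (tp : Fin (r+1) → T) : Finset (Om G T r) := Finset.univ.biUnion fun j : Fin r => blk pos j (tp j.succ)

lemma Zw_dep (tp : Fin (r+1) → T) : DependsOn (Zw pos tp) (SZ pos tp : Set (Om G T r)) :=
  dep_prod Finset.univ (fun j => Dw pos j (tp j.succ)) _ fun j _ => Dw_dep _ _
lemma Zw_abs (tp : Fin (r+1) → T) (ω) : |Zw pos tp ω| ≤ 1 := by
  unfold Zw; rw [Finset.abs_prod]; exact Finset.prod_le_one (fun _ _ => abs_nonneg _) fun j _ => Dw_abs _ _ _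
lemma Zw_mean (hr : 0 < r) (p : ℝ) (tp : Fin (r+1) → T) : Ex (qq p) (Zw pos tp) = 0 := by
  unfold Zw
  rw [Ex_prod_of_dep (qq p) Finset.univ (fun j => Dw pos j (tp j.succ)) (fun j => blk pos j (tp j.succ)) (fun j _ => Dw_dep _ _) (fun a _ b _ hab => blk_disj fun h => hab h.1)]
  exact Finset.prod_eq_zero (Finset.mem_univ ⟨0, hr⟩) (Dw_mean _ _ _)
lemma Zw_sq (p : ℝ) (tp : Fin (r+1) → T) : Ex (qq p) (fun ω => Zw pos tp ω ^ 2) = (p * (1 - p)) ^ r := by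
  simp only [Zw, ← Finset.prod_pow]
  rw [Ex_prod_of_dep (qq p) Finset.univ (fun j ω => Dw pos j (tp j.succ) ω ^ 2) (fun j => blk pos j (tp j.succ)) (fun j _ => ?_) (fun a _ b _ hab => blk_disj fun h => hab h.1)]
  · simp [Dw_sq]
  · intro x y h; simp only; rw [Dw_dep _ _ h]

/-- window structure -/
structure HFL (Fu : Finset ι) (tt : ι → Fin (r+1) → T) : Prop where
  lin : ∀ P ∈ Fu, ∀ P' ∈ Fu, tt P 0 = tt P' 0 → ∀ j : Fin r, tt P j.succ = tt P' j.succ → P = P'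

lemma Ww_moments (hr : 0 < r) {Fu : Finset ι} {tt : ι → Fin (r+1) → T} (L : HFL Fu tt) {p : ℝ} (hp : 0 ≤ p ∧ p ≤ 1) (t : T) :
    Ex (qq p) (fun ω => (gam pos (oy ω) t * Ww Fu tt pos (oy ω) (ob ω) (oc ω) t) ^ 2) = 2 * ((Fu.filter fun P => tt P 0 = t).card : ℝ) * (p * (1 - p)) ^ (r + 1) ∧
    Ex (qq p) (fun ω => (gam pos (oy ω) t * Ww Fu tt pos (oy ω) (ob ω) (oc ω) t) ^ 4) ≤ 3 * ((Fu.filter fun P => tt P 0 = t).card : ℝ) ^ 2 := by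
  set A := Fu.filter fun P => tt P 0 = t with hA
  have eW : ∀ ω, Ww Fu tt pos (oy ω) (ob ω) (oc ω) t = ∑ P ∈ A, Zw pos (tt P) ω := by
    intro ω; simp only [Ww, Zw, Del_eq]; rfl
  have dj : ∀ a ∈ A, ∀ b ∈ A, a ≠ b → Disjoint (SZ pos (tt a)) (SZ pos (tt b)) := by
    intro a ha b hb hab
    rw [hA, Finset.mem_filter] at ha hb
    unfold SZ
    rw [Finset.disjoint_biUnion_left]; intro j _
    rw [Finset.disjoint_biUnion_right]; intro j' _
    refine blk_disj ?_
    rintro ⟨rfl, h⟩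
    exact hab (L.lin a ha.1 b hb.1 (ha.2.trans hb.2.symm) j h)
  obtain ⟨-, m2, m4⟩ := Ex_moments (qq p) (qq_PQ hp) A (fun P => Zw pos (tt P)) (fun P => SZ pos (tt P)) (fun P _ => Zw_dep _) dj (fun P _ => Zw_mean hr p _) (fun P _ ω => Zw_abs _ ω)
  simp only [eW, mul_pow]
  constructor
  · have d1 : DependsOn (fun ω : Om G T r → Bool => gam pos (oy ω) t ^ 2) (blk0 pos t : Set (Om G T r)) := by
      intro x y h
      have := dep_dif (Sum.inl (pos (0,t,true)) : Om G T r) (Sum.inl (pos (0,t,false))) h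
      simp only [gam, oy] at this ⊢; rw [this]
    have d2 : DependsOn (fun ω : Om G T r → Bool => (∑ P ∈ A, Zw pos (tt P) ω) ^ 2) ((A.biUnion fun P => SZ pos (tt P) : Finset (Om G T r)) : Set (Om G T r)) := by
      intro x y h
      have := dep_sum A (fun P => Zw pos (tt P)) (fun P => SZ pos (tt P)) (fun P _ => Zw_dep _) h
      simp only at this ⊢; rw [this]
    rw [Ex_mul_of_dep (qq p) d1 d2, m2]
    · have : Ex (qq p) (fun ω : Om G T r → Bool => gam pos (oy ω) t ^ 2) = 2 * (p * (1 - p)) :=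
        (Ex_dsq (qq p) (i := (Sum.inl (pos (0,t,true)) : Om G T r)) (j := Sum.inl (pos (0,t,false))) (s := p) (by simp) rfl rfl).2
      rw [this]
      simp only [Zw_sq, Finset.sum_const, nsmul_eq_mul, mul_pow]; ring
    · rw [Finset.disjoint_biUnion_right]; intro P _
      unfold SZ
      rw [Finset.disjoint_biUnion_right]; intro j _
      exact blk0_disj
  · refine le_trans (Ex_mono (qq_PQ hp) fun ω => ?_) m4
    have : gam pos (oy ω) t ^ 4 ≤ 1 := by
      have := bt_sub_abs (oy ω (pos (0,t,true))) (oy ω (pos (0,t,false)))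
      rw [← Even.pow_abs (by decide)]
      exact pow_le_one₀ (abs_nonneg _) this
    exact mul_le_of_le_one_left (by positivity) this
end HFw

section HFx
variable {G W U ι : Type*} [Fintype G] [DecidableEq G] [Fintype W] [DecidableEq W] [Fintype U] [DecidableEq U] [Fintype ι] [DecidableEq ι] {r : ℕ}

/-- windows -/
structure HFW (Fu : Finset ι) (tt : ι → Fin (r+1) → W × U) : Prop extends HFL Fu tt where
  win : ∀ P ∈ Fu, ∀ j, (tt P j).1 = (tt P 0).1
  up : ∀ t, (Fu.filter (fun P => tt P 0 = t)).card ≤ Fintype.card U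
  lo : ∀ w, (Fintype.card U : ℝ) ^ 2 / (2 * r) ≤ ∑ u, ((Fu.filter (fun P => tt P 0 = (w, u))).card : ℝ)

variable {pos : Fin (r+1) × (W × U) × Bool ↪ G} {Fu : Finset ι} {tt : ι → Fin (r+1) → W × U}

/-- window factor -/
noncomputable def Fw (pos : Fin (r+1) × (W × U) × Bool ↪ G) (Fu : Finset ι) (tt : ι → Fin (r+1) → W × U) (θ : ℝ) (w : W) (ω : Om G (W × U) r → Bool) : ℝ :=
  ∏ u, |Real.cos (θ * gam pos (oy ω) (w, u) * Ww Fu tt pos (oy ω) (ob ω) (oc ω) (w, u) / 2)|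

lemma Fw_nonneg (θ : ℝ) (w : W) (ω) : 0 ≤ Fw pos Fu tt θ w ω := Finset.prod_nonneg fun _ _ => abs_nonneg _

/-- window support -/
def WS (pos : Fin (r+1) × (W × U) × Bool ↪ G) (w : W) : Finset (Om G (W × U) r) :=
  Finset.univ.biUnion fun u => blk0 pos (w, u) ∪ Finset.univ.biUnion fun j => blk pos j (w, u)

lemma WS_disj {w w' : W} (h : w ≠ w') : Disjoint (WS pos w) (WS pos w') := by
  have a0 : ∀ t t' : W × U, t ≠ t' → Disjoint (blk0 pos t) (blk0 pos t') := by
    intro t t' htt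
    rw [Finset.disjoint_left]; intro a ha hb
    simp only [blk0, Finset.mem_union, Finset.mem_singleton] at ha hb
    rcases ha with (ha | ha) <;> rcases hb with (hb | hb) <;> rw [ha] at hb <;> simp only [Sum.inl.injEq, EmbeddingLike.apply_eq_iff_eq, Prod.mk.injEq] at hb <;> exact htt hb.2.1
  simp only [WS, Finset.disjoint_biUnion_left, Finset.disjoint_biUnion_right, Finset.disjoint_union_left, Finset.disjoint_union_right]
  exact fun u _ => ⟨fun u' _ => ⟨a0 _ _ (by simp [h]), fun j _ => blk0_disj.symm⟩, fun j _ u' _ => ⟨blk0_disj, fun j' _ => blk_disj (by simp [h])⟩⟩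

lemma Fw_dep (H : HFW Fu tt) (θ : ℝ) (w : W) : DependsOn (Fw pos Fu tt θ w) (WS pos w : Set (Om G (W × U) r)) := by
  intro x y h
  have h0 : ∀ u, gam pos (oy x) (w, u) = gam pos (oy y) (w, u) := by
    intro u
    simp only [gam, oy]
    rw [h (Sum.inl (pos (0, (w,u), true))) (by simp only [WS, Finset.coe_biUnion]; simp [blk0]),
      h (Sum.inl (pos (0, (w,u), false))) (by simp only [WS, Finset.coe_biUnion]; simp [blk0])]
  have h1 : ∀ j u, Dw pos j (w, u) x = Dw pos j (w, u) y := by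
    intro j u
    refine Dw_dep j (w, u) fun i hi => h i ?_
    simp only [WS, Finset.coe_biUnion, Finset.coe_union, Set.mem_iUnion]
    exact ⟨u, by simp, Or.inr (by simp only [Set.mem_iUnion]; exact ⟨j, by simp, hi⟩)⟩
  unfold Fw
  refine Finset.prod_congr rfl fun u _ => ?_
  rw [h0]
  have : Ww Fu tt pos (oy x) (ob x) (oc x) (w, u) = Ww Fu tt pos (oy y) (ob y) (oc y) (w, u) := by
    unfold Ww
    refine Finset.sum_congr rfl fun P hP => Finset.prod_congr rfl fun j _ => ?_
    rw [Finset.mem_filter] at hP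
    rw [Del_eq, Del_eq]
    have : tt P j.succ = (w, (tt P j.succ).2) := by
      ext
      · rw [H.win P hP.1, hP.2]
      · rfl
    rw [this, h1]
  rw [this]

lemma HF4 (H : HFW Fu tt) {p : ℝ} (hp : 0 ≤ p ∧ p ≤ 1) {θ c : ℝ} (hc : ∀ w, Ex (qq p) (Fw pos Fu tt θ w) ≤ 1 - c) :
    Ex (qq p) (fun ω => ∏ t, |Real.cos (θ * gam pos (oy ω) t * Ww Fu tt pos (oy ω) (ob ω) (oc ω) t / 2)|) ≤ Real.exp (- (c * Fintype.card W)) := by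
  simp only [Fintype.prod_prod_type]
  have := Ex_prod_of_dep (qq p) Finset.univ (Fw pos Fu tt θ) (WS pos) (fun w _ => Fw_dep H θ w) (fun a _ b _ h => WS_disj h)
  simp only [Fw] at this
  rw [this]
  calc _ ≤ ∏ w : W, Real.exp (-c) := Finset.prod_le_prod (fun w _ => Ex_nonneg (qq_PQ hp) (Fw_nonneg θ w)) fun w _ => by
        refine (hc w).trans ?_
        have := Real.add_one_le_exp (-c); linarith
    _ = _ := by rw [Finset.prod_const, Finset.card_univ, ← Real.exp_nat_mul]; congr 1; ring

lemma HF3a (hr : 0 < r) (H : HFW Fu tt) {p : ℝ} (hp : 0 ≤ p ∧ p ≤ 1) (hU : 0 < Fintype.card U) {θ κ c1 : ℝ} (hκ : κ = |θ| * Fintype.card U)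
    (hc1 : c1 = (p * (1 - p)) ^ (r + 1) / (8 * r)) (hs : κ ^ 2 ≤ 4 * c1) (w : W) :
    Ex (qq p) (Fw pos Fu tt θ w) ≤ 1 - κ ^ 2 * c1 / 2 := by
  set F : ℝ := (Fintype.card U : ℝ) with hF
  have hF1 : 1 ≤ F := by rw [hF]; exact_mod_cast hU
  set x : U → (Om G (W × U) r → Bool) → ℝ := fun u ω => gam pos (oy ω) (w, u) * Ww Fu tt pos (oy ω) (ob ω) (oc ω) (w, u) with hx
  have pw : ∀ ω, Fw pos Fu tt θ w ω ≤ 1 - ∑ u, (θ ^ 2 / 8) * x u ω ^ 2 + ∑ u, (5 / 128 * F * θ ^ 4) * x u ω ^ 4 := by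
    intro ω
    have := prod_cos_le (fun u => θ * gam pos (oy ω) (w, u) * Ww Fu tt pos (oy ω) (ob ω) (oc ω) (w, u) / 2)
    unfold Fw
    refine this.trans ?_
    have e1 : ∑ u, (θ * gam pos (oy ω) (w, u) * Ww Fu tt pos (oy ω) (ob ω) (oc ω) (w, u) / 2) ^ 2 / 2 = ∑ u, (θ ^ 2 / 8) * x u ω ^ 2 :=
      Finset.sum_congr rfl fun u _ => by simp only [hx]; ring
    have e2 : ∑ u, (θ * gam pos (oy ω) (w, u) * Ww Fu tt pos (oy ω) (ob ω) (oc ω) (w, u) / 2) ^ 4 / 2 = θ ^ 4 / 32 * ∑ u, x u ω ^ 4 := by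
      rw [Finset.mul_sum]; exact Finset.sum_congr rfl fun u _ => by simp only [hx]; ring
    have e3 : ∑ u, (θ * gam pos (oy ω) (w, u) * Ww Fu tt pos (oy ω) (ob ω) (oc ω) (w, u) / 2) ^ 4 / 8 = θ ^ 4 / 128 * ∑ u, x u ω ^ 4 := by
      rw [Finset.mul_sum]; exact Finset.sum_congr rfl fun u _ => by simp only [hx]; ring
    rw [e1, e2, e3, ← Finset.mul_sum, ← Finset.mul_sum (a := 5 / 128 * F * θ ^ 4)]
    have h4 : 0 ≤ θ ^ 4 * ∑ u, x u ω ^ 4 := mul_nonneg (by positivity) (Finset.sum_nonneg fun u _ => by positivity)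
    nlinarith [mul_le_mul_of_nonneg_right hF1 h4]
  refine (Ex_mono (qq_PQ hp) pw).trans ?_
  rw [Ex_add, Ex_sub, Ex_const, Ex_sum, Ex_sum]
  simp only [Ex_smul]
  set N : U → ℝ := fun u => ((Fu.filter (fun P => tt P 0 = (w, u))).card : ℝ) with hN
  have m2 : ∀ u, Ex (qq p) (fun ω => x u ω ^ 2) = 2 * N u * (p * (1 - p)) ^ (r + 1) := fun u => (Ww_moments hr H.toHFL hp (w, u)).1
  have m4 : ∀ u, Ex (qq p) (fun ω => x u ω ^ 4) ≤ 3 * F ^ 2 := fun u => ((Ww_moments hr H.toHFL hp (w, u)).2).trans (by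
    have : ((Fu.filter (fun P => tt P 0 = (w, u))).card : ℝ) ≤ F := by rw [hF]; exact_mod_cast H.up (w, u)
    gcongr)
  simp only [m2]
  have hsk : 0 ≤ (p * (1 - p)) ^ (r + 1) := pow_nonneg (mul_nonneg hp.1 (by linarith [hp.2])) _
  have t1 : κ ^ 2 * c1 ≤ ∑ u, θ ^ 2 / 8 * (2 * N u * (p * (1 - p)) ^ (r + 1)) := by
    have e : ∑ u, θ ^ 2 / 8 * (2 * N u * (p * (1 - p)) ^ (r + 1)) = θ ^ 2 / 4 * (p * (1 - p)) ^ (r + 1) * ∑ u, N u := by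
      rw [Finset.mul_sum]; exact Finset.sum_congr rfl fun u _ => by ring
    rw [e, hκ, hc1, mul_pow, sq_abs]
    refine le_trans (le_of_eq ?_) (mul_le_mul_of_nonneg_left (H.lo w) (by positivity))
    have : (r : ℝ) ≠ 0 := by positivity
    field_simp; ring
  have t2 : ∑ u, 5 / 128 * F * θ ^ 4 * Ex (qq p) (fun ω => x u ω ^ 4) ≤ 15 / 128 * κ ^ 4 := by
    calc _ ≤ ∑ u : U, 5 / 128 * F * θ ^ 4 * (3 * F ^ 2) := Finset.sum_le_sum fun u _ => mul_le_mul_of_nonneg_left (m4 u) (by positivity)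
      _ = _ := by
        rw [Finset.sum_const, Finset.card_univ, nsmul_eq_mul, ← hF, hκ, mul_pow, Even.pow_abs (by decide)]; ring
  nlinarith [sq_nonneg κ, mul_le_mul_of_nonneg_left hs (sq_nonneg κ)]

lemma HF3b (hr : 0 < r) (H : HFW Fu tt) {p : ℝ} (hp : 0 ≤ p ∧ p ≤ 1) (hU : Fintype.card U = 1) {θ : ℝ} (hθ : |θ| ≤ Real.pi) (w : W) :
    Ex (qq p) (Fw pos Fu tt θ w) ≤ 1 - θ ^ 2 * (p * (1 - p)) ^ (r + 1) / (2 * r * Real.pi ^ 2) := by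
  obtain ⟨u0, hu0⟩ := Fintype.card_eq_one_iff.1 hU
  have hun : (Finset.univ : Finset U) = {u0} := by ext u; simp [hu0 u]
  have pw : ∀ ω, Fw pos Fu tt θ w ω ≤ 1 - θ ^ 2 / (2 * Real.pi ^ 2) * (gam pos (oy ω) (w, u0) * Ww Fu tt pos (oy ω) (ob ω) (oc ω) (w, u0)) ^ 2 := by
    intro ω
    simp only [Fw, hun, Finset.prod_singleton]
    have hg : |gam pos (oy ω) (w, u0)| ≤ 1 := bt_sub_abs _ _
    have hW : |Ww Fu tt pos (oy ω) (ob ω) (oc ω) (w, u0)| ≤ 1 := by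
      unfold Ww
      refine (Finset.abs_sum_le_sum_abs _ _).trans ?_
      simp only [Del_eq]
      refine (Finset.sum_le_card_nsmul _ _ 1 fun P _ => Zw_abs (pos := pos) (tt P) ω).trans ?_
      have := H.up (w, u0); rw [hU] at this
      rw [nsmul_eq_mul, mul_one]; exact_mod_cast this
    set g := gam pos (oy ω) (w, u0)
    set V := Ww Fu tt pos (oy ω) (ob ω) (oc ω) (w, u0)
    have hz : |θ * g * V / 2| ≤ Real.pi / 2 := by
      rw [abs_div, abs_mul, abs_mul, abs_two]
      have : |θ| * |g| * |V| ≤ Real.pi * 1 * 1 := by gcongr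
      linarith
    have := Real.cos_le_one_sub_mul_cos_sq (hz.trans (by linarith [Real.pi_pos]))
    rw [abs_of_nonneg (Real.cos_nonneg_of_neg_pi_div_two_le_of_le (abs_le.1 hz).1 (abs_le.1 hz).2)]
    refine this.trans (le_of_eq ?_)
    have := Real.pi_pos
    field_simp
  refine (Ex_mono (qq_PQ hp) pw).trans ?_
  rw [Ex_sub, Ex_const, Ex_smul, (Ww_moments hr H.toHFL hp (w, u0)).1]
  have hlo := H.lo w
  rw [hun, Finset.sum_singleton, hU] at hlo
  have hsk : 0 ≤ (p * (1 - p)) ^ (r + 1) := pow_nonneg (mul_nonneg hp.1 (by linarith [hp.2])) _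
  have := Real.pi_pos
  have h2 := mul_le_mul_of_nonneg_left hlo (show 0 ≤ θ ^ 2 / (2 * Real.pi ^ 2) * 2 * (p * (1 - p)) ^ (r + 1) by positivity)
  have e : θ ^ 2 / (2 * Real.pi ^ 2) * 2 * (p * (1 - p)) ^ (r + 1) * (((1 : ℕ) : ℝ) ^ 2 / (2 * r)) = θ ^ 2 * (p * (1 - p)) ^ (r + 1) / (2 * r * Real.pi ^ 2) := by
    have : (r : ℝ) ≠ 0 := by positivity
    push_cast; field_simp
  rw [e] at h2
  linarith
end HFx

section Geo
/-- label polynomial -/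
def cl (M l : ℕ) : ℕ := 2 * M ^ 2 * l + l ^ 2
/-- label -/
def lb (R j w : ℕ) (e : Bool) : ℕ := w + (if e then 1 + j else 0) * R
/-- offset -/
def of_ (M R F j w f : ℕ) (e : Bool) : ℕ := 2 * F * cl M (lb R j w e) + f
/-- position -/
def pn (M R F j w f : ℕ) (e : Bool) : ℕ := j * (6 * F * M ^ 3) + of_ M R F j w f e

lemma lb_lt {r R j w : ℕ} {e : Bool} (hj : j < r + 1) (hw : w < R) : lb R j w e < (r + 2) * R := by
  unfold lb
  have : (if e then 1 + j else 0) ≤ r + 1 := by split_ifs <;> omega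
  nlinarith [Nat.mul_le_mul_right R this]
lemma of_lt {M R F j w f : ℕ} {e : Bool} (hl : lb R j w e < M) (hf : f < F) : of_ M R F j w f e < 6 * F * M ^ 3 := by
  unfold of_ cl
  set l := lb R j w e
  obtain ⟨s, rfl⟩ : ∃ s, M = l + 1 + s := ⟨M - (l+1), by omega⟩
  have h1 : 2 * (l+1+s) ^ 2 * l + l ^ 2 + 1 ≤ 3 * (l+1+s)^3 := by nlinarith [Nat.zero_le (s*l), Nat.zero_le (s*l*l), Nat.zero_le (s*s*l), Nat.zero_le (s*s*s)]
  calc _ < 2 * F * (2 * (l+1+s) ^ 2 * l + l ^ 2) + 2 * F := by omega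
    _ = 2 * F * (2 * (l+1+s) ^ 2 * l + l ^ 2 + 1) := by ring
    _ ≤ 2 * F * (3 * (l+1+s)^3) := Nat.mul_le_mul_left _ h1
    _ = _ := by ring
lemma cl_inj {M l l' : ℕ} (h : cl M l = cl M l') : l = l' := by
  unfold cl at h
  rcases lt_trichotomy l l' with h' | h' | h'
  · nlinarith [Nat.mul_le_mul_left (2 * M^2) h'.le]
  · exact h'
  · nlinarith [Nat.mul_le_mul_left (2 * M^2) h'.le]
lemma lb_inj {R j j' w w' : ℕ} {e e' : Bool} (hw : w < R) (hw' : w' < R) (h : lb R j w e = lb R j' w' e') :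
    w = w' ∧ (if e then 1 + j else 0) = (if e' then 1 + j' else 0) := by
  unfold lb at h
  have h1 := congrArg (· % R) h
  have h2 := congrArg (· / R) h
  simp only [Nat.add_mul_mod_self_right, Nat.mod_eq_of_lt hw, Nat.mod_eq_of_lt hw'] at h1
  simp only [Nat.add_mul_div_right _ _ (by omega : 0 < R), Nat.div_eq_of_lt hw, Nat.div_eq_of_lt hw', zero_add] at h2
  exact ⟨h1, h2⟩
lemma pn_inj {M R F j j' w w' f f' : ℕ} {e e' : Bool} (hl : lb R j w e < M) (hl' : lb R j' w' e' < M) (hf : f < F) (hf' : f' < F)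
    (hw : w < R) (hw' : w' < R) (h : pn M R F j w f e = pn M R F j' w' f' e') : j = j' ∧ w = w' ∧ f = f' ∧ e = e' := by
  unfold pn at h
  have o1 := of_lt hl hf
  have o2 := of_lt hl' hf'
  set Dd := 6 * F * M ^ 3
  have hD : 0 < Dd := by omega
  have h1 := congrArg (· % Dd) h
  have h2 := congrArg (· / Dd) h
  simp only [Nat.mul_add_mod', Nat.mod_eq_of_lt o1, Nat.mod_eq_of_lt o2] at h1
  simp only [mul_comm _ Dd, Nat.mul_add_div hD, Nat.div_eq_of_lt o1, Nat.div_eq_of_lt o2, add_zero] at h2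
  subst h2
  unfold of_ at h1
  have h3 := congrArg (· % (2 * F)) h1
  have h4 := congrArg (· / (2 * F)) h1
  simp only [Nat.mul_add_mod, Nat.mod_eq_of_lt (by omega : f < 2 * F), Nat.mod_eq_of_lt (by omega : f' < 2 * F)] at h3
  simp only [Nat.mul_add_div (by omega : 2 * F > 0), Nat.div_eq_of_lt (by omega : f < 2 * F), Nat.div_eq_of_lt (by omega : f' < 2 * F), add_zero] at h4
  obtain ⟨h5, h6⟩ := lb_inj hw hw' (cl_inj h4)
  refine ⟨rfl, h5, h3, ?_⟩
  cases e <;> cases e' <;> simp at h6 ⊢ <;> omega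

/-- second differences -/
lemma sd_label {M F l0 l1 l2 f0 f1 f2 : ℕ} (h0 : l0 < M) (h1 : l1 < M) (h2 : l2 < M) (g0 : f0 < F) (g1 : f1 < F) (g2 : f2 < F)
    (h : (2 * F * cl M l0 + f0) + (2 * F * cl M l2 + f2) = 2 * (2 * F * cl M l1 + f1)) : l0 = l1 ∧ l1 = l2 := by
  have e1 : cl M l0 + cl M l2 = 2 * cl M l1 := by
    rcases lt_trichotomy (cl M l0 + cl M l2) (2 * cl M l1) with h' | h' | h'
    · have := Nat.mul_le_mul_left (2 * F) (Nat.succ_le_of_lt h'); simp only [Nat.succ_eq_add_one] at this; nlinarith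
    · exact h'
    · have := Nat.mul_le_mul_left (2 * F) (Nat.succ_le_of_lt h'); simp only [Nat.succ_eq_add_one] at this; nlinarith
  unfold cl at e1
  have b0 : l0 ^ 2 < M ^ 2 := Nat.pow_lt_pow_left h0 (by norm_num)
  have b1 : l1 ^ 2 < M ^ 2 := Nat.pow_lt_pow_left h1 (by norm_num)
  have b2 : l2 ^ 2 < M ^ 2 := Nat.pow_lt_pow_left h2 (by norm_num)
  have e2 : l0 + l2 = 2 * l1 := by
    rcases lt_trichotomy (l0 + l2) (2 * l1) with h' | h' | h'
    · have := Nat.mul_le_mul_left (2 * M ^ 2) (Nat.succ_le_of_lt h'); simp only [Nat.succ_eq_add_one] at this; nlinarith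
    · exact h'
    · have := Nat.mul_le_mul_left (2 * M ^ 2) (Nat.succ_le_of_lt h'); simp only [Nat.succ_eq_add_one] at this; nlinarith
  have e3 : l0 ^ 2 + l2 ^ 2 = 2 * l1 ^ 2 := by
    have : 2 * M ^ 2 * l0 + 2 * M ^ 2 * l2 = 2 * (2 * M ^ 2 * l1) := by rw [← mul_add, e2]; ring
    omega
  have e4 : ((l0:ℤ) - l1) ^ 2 = 0 := by
    zify at e2 e3
    have : (l2 : ℤ) = 2 * l1 - l0 := by linarith
    rw [this] at e3; nlinarith
  have e5 : (l0 : ℤ) = l1 := by have := pow_eq_zero_iff (two_ne_zero) |>.1 e4; linarith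
  omega

/-- index of progressions -/
abbrev API (n : ℕ) := ZMod n × {d : ℕ // d ∈ Finset.Icc 1 (n / 2)}
/-- points of progressions -/
def ptAP (n r : ℕ) (P : API n) (i : Fin (r+1)) : ZMod n := P.1 + (((i : ℕ) * P.2.1 : ℕ) : ZMod n)

/-- strictly monotone self maps -/
lemma fin_sm {k : ℕ} (g : Fin k → Fin k) (hg : StrictMono g) (i : Fin k) : g i = i := by
  have hs : Function.Surjective g := Finite.surjective_of_injective hg.injective
  have := Subsingleton.elim (hg.orderIsoOfSurjective g hs) (OrderIso.refl _)
  have h2 := congrArg (fun φ : Fin k ≃o Fin k => φ i) this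
  simpa using h2

lemma geo_full {r n R F M : ℕ} (hr : 2 ≤ r) (hM : M = (r + 2) * R) (hn : 2 * ((r + 1) * (6 * F * M ^ 3)) < n)
    (P : API n) (h : ∀ j : Fin (r+1), ∃ i : Fin (r+1), ∃ (w : Fin R) (f : Fin F) (e : Bool), ptAP n r P i = ((pn M R F j w f e : ℕ) : ZMod n)) :
    ∃ (w : Fin R) (f : Fin (r+1) → Fin F), ∀ i : Fin (r+1), ptAP n r P i = ((pn M R F i w (f i) false : ℕ) : ZMod n) := by
  choose I w f e hI using h
  set Dd := 6 * F * M ^ 3 with hDd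
  have olt : ∀ j : Fin (r+1), of_ M R F j (w j) (f j) (e j) < Dd := fun j => of_lt (hM ▸ lb_lt j.2 (w j).2) (f j).2
  set q : Fin (r+1) → ℕ := fun j => pn M R F j (w j) (f j) (e j) with hq
  have qe : ∀ j : Fin (r+1), q j = (j:ℕ) * Dd + of_ M R F j (w j) (f j) (e j) := fun j => rfl
  have qlt : ∀ j, q j < (r + 1) * Dd := by
    intro j; rw [qe]
    have := olt j
    have h2 : (j : ℕ) + 1 ≤ r + 1 := j.2
    nlinarith [Nat.mul_le_mul_right Dd h2]
  have qmono : ∀ j j' : Fin (r+1), q j < q j' → j ≤ j' := by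
    intro j j' h
    by_contra hc
    push Not at hc
    have h1 : (j' : ℕ) + 1 ≤ j := hc
    have := Nat.mul_le_mul_right Dd h1
    rw [qe, qe] at h; have := olt j'; nlinarith
  have hnz : NeZero n := ⟨by omega⟩
  have Iinj : Function.Injective I := by
    intro j j' hjj
    have h1 := hI j; have h2 := hI j'
    rw [hjj] at h1; rw [h1] at h2
    have h3 := (ZMod.natCast_eq_natCast_iff' _ _ _).1 h2
    have l1 := qlt j; have l2 := qlt j'
    simp only [hq] at l1 l2
    rw [Nat.mod_eq_of_lt (by omega), Nat.mod_eq_of_lt (by omega)] at h3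
    exact Fin.ext (pn_inj (hM ▸ lb_lt j.2 (w j).2) (hM ▸ lb_lt j'.2 (w j').2) (f j).2 (f j').2 (w j).2 (w j').2 h3).1
  have Isur : Function.Surjective I := Finite.surjective_of_injective Iinj
  choose g hg using Isur
  have ginj : Function.Injective g := by
    intro a b hab; rw [← hg a, ← hg b, hab]
  have hQ : ∀ i, ptAP n r P i = ((q (g i) : ℕ) : ZMod n) := by
    intro i; have := hI (g i); rw [hg] at this; exact this
  have dI := P.2.2
  rw [Finset.mem_Icc] at dI
  set d := P.2.1 with hd
  have step : ∀ (i : ℕ) (hi : i + 1 < r + 1), q (g ⟨i+1, hi⟩) = q (g ⟨i, by omega⟩) + d := by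
    intro i hi
    have h1 := hQ ⟨i+1, hi⟩
    have h2 := hQ ⟨i, by omega⟩
    have h3 : ((q (g ⟨i+1, hi⟩) : ℕ) : ZMod n) = ((q (g ⟨i, by omega⟩) + d : ℕ) : ZMod n) := by
      rw [← h1]; push_cast; rw [← h2]; simp only [ptAP]; push_cast; ring
    have l1 := qlt (g ⟨i+1, hi⟩); have l2 := qlt (g ⟨i, by omega⟩)
    have h4 := (ZMod.natCast_eq_natCast_iff' _ _ _).1 h3
    rw [Nat.mod_eq_of_lt (by omega), Nat.mod_eq_of_lt (by omega)] at h4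
    exact h4
  have qform : ∀ (i : ℕ) (hi : i < r + 1), q (g ⟨i, hi⟩) = q (g ⟨0, by omega⟩) + i * d := by
    intro i
    induction i with
    | zero => intro hi; simp
    | succ i ih => intro hi; rw [step i hi, ih (by omega)]; ring
  have gsm : StrictMono g := by
    intro i i' hii
    refine lt_of_le_of_ne (qmono _ _ ?_) (fun h => hii.ne (ginj h))
    have h1 := qform i i.2; have h2 := qform i' i'.2
    simp only [Fin.eta] at h1 h2
    rw [h1, h2]
    have : (i : ℕ) < i' := hii
    have := Nat.mul_lt_mul_of_pos_right this (by omega : 0 < d)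
    omega
  have gid : ∀ i, g i = i := fin_sm g gsm
  simp only [gid] at hQ step
  set lab : Fin (r+1) → ℕ := fun i => lb R i (w i) (e i) with hlab
  have lablt : ∀ i, lab i < M := fun i => hM ▸ lb_lt i.2 (w i).2
  have sd : ∀ (i : ℕ) (hi : i + 2 < r + 1), lab ⟨i, by omega⟩ = lab ⟨i+1, by omega⟩ ∧ lab ⟨i+1, by omega⟩ = lab ⟨i+2, hi⟩ := by
    intro i hi
    have s1 := step i (by omega)
    have s2 := step (i+1) hi
    simp only [qe] at s1 s2
    refine sd_label (M := M) (F := F) (lablt _) (lablt _) (lablt _) (f ⟨i, by omega⟩).2 (f ⟨i+1, by omega⟩).2 (f ⟨i+2, hi⟩).2 ?_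
    simp only [of_] at s1 s2
    nlinarith
  have laball : ∀ (i : ℕ) (hi : i < r + 1), lab ⟨i, hi⟩ = lab ⟨0, by omega⟩ := by
    intro i
    induction i using Nat.strong_induction_on with
    | _ i ih =>
      intro hi
      match i, hi, ih with
      | 0, hi, ih => rfl
      | 1, hi, ih => exact (sd 0 (by omega)).1.symm
      | (i+2), hi, ih => rw [← (sd i hi).2]; exact ih (i+1) (by omega) (by omega)
  have lab2 : ∀ i i' : Fin (r+1), lab i = lab i' := fun i i' => (laball i i.2).trans (laball i' i'.2).symm
  have ef : ∀ i, e i = false := by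
    intro i
    obtain ⟨i', hi'⟩ : ∃ i' : Fin (r+1), i' ≠ i := by
      by_cases h : i = ⟨0, by omega⟩
      · exact ⟨⟨1, by omega⟩, by rw [h]; simp⟩
      · exact ⟨⟨0, by omega⟩, fun h' => h h'.symm⟩
    have := (lb_inj (w i).2 (w i').2 (lab2 i i')).2
    have hne : (i' : ℕ) ≠ i := fun h => hi' (Fin.ext h)
    cases h1 : e i
    · rfl
    · rw [h1] at this
      cases h2 : e i' <;> rw [h2] at this <;> simp at this <;> omega
  refine ⟨w ⟨0, by omega⟩, f, fun i => ?_⟩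
  rw [hQ i]
  have hw := (lb_inj (w i).2 (w ⟨0, by omega⟩).2 (lab2 i ⟨0, by omega⟩)).1
  simp only [hq]
  rw [ef i, hw]
end Geo

section Geo2
/-- the embedding of positions -/
def posE {r n R F M : ℕ} (hM : M = (r + 2) * R) (hn : 2 * ((r + 1) * (6 * F * M ^ 3)) < n) : Fin (r+1) × (Fin R × Fin F) × Bool ↪ ZMod n where
  toFun z := ((pn M R F z.1 z.2.1.1 z.2.1.2 z.2.2 : ℕ) : ZMod n)
  inj' := by
    have lt : ∀ z : Fin (r+1) × (Fin R × Fin F) × Bool, pn M R F z.1 z.2.1.1 z.2.1.2 z.2.2 < n := by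
      rintro ⟨j, ⟨w, f⟩, e⟩
      have h1 := of_lt (M := M) (e := e) (j := j) (hM ▸ lb_lt j.2 w.2) f.2
      have h2 : (j : ℕ) + 1 ≤ r + 1 := j.2
      have := Nat.mul_le_mul_right (6 * F * M ^ 3) h2
      simp only [pn]; linarith
    intro z z' h
    have h3 := (ZMod.natCast_eq_natCast_iff' _ _ _).1 h
    rw [Nat.mod_eq_of_lt (lt z), Nat.mod_eq_of_lt (lt z')] at h3
    obtain ⟨j, ⟨w, f⟩, e⟩ := z
    obtain ⟨j', ⟨w', f'⟩, e'⟩ := z'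
    obtain ⟨h1, h2, h4, h5⟩ := pn_inj (hM ▸ lb_lt j.2 w.2) (hM ▸ lb_lt j'.2 w'.2) f.2 f'.2 w.2 w'.2 h3
    simp only [Prod.mk.injEq]
    exact ⟨Fin.ext h1, ⟨Fin.ext h2, Fin.ext h4⟩, h5⟩

lemma sum_fin_lower (F : ℕ) : (F : ℝ) ^ 2 / 2 ≤ ∑ u : Fin F, ((F : ℝ) - u) := by
  have h : ∀ F : ℕ, ∑ u ∈ Finset.range F, (u : ℝ) = F * (F - 1) / 2 := by
    intro F
    induction F with
    | zero => simp
    | succ F ih => rw [Finset.sum_range_succ, ih]; push_cast; ring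
  rw [Finset.sum_sub_distrib, Fin.sum_univ_eq_sum_range (fun u => (u : ℝ)), h]
  simp
  nlinarith [(Nat.cast_nonneg F : (0:ℝ) ≤ F)]

open Classical in
lemma geo {r n R F : ℕ} [NeZero n] (hr : 2 ≤ r) (hR : 0 < R) (hF : 0 < F) (hn : 2 * ((r + 1) * (6 * F * ((r + 2) * R) ^ 3)) < n)
    (hcop : ∀ j, 1 ≤ j → j ≤ r → Nat.Coprime j n) :
    ∃ (pos : Fin (r+1) × (Fin R × Fin F) × Bool ↪ ZMod n) (Fu : Finset (API n)) (tt : API n → Fin (r+1) → Fin R × Fin F),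
      HFS (ptAP n r) pos Fu tt ∧ HFW Fu tt := by
  set M := (r + 2) * R with hM
  let pos := posE hM hn
  have posd : ∀ j w f e, pos (j, (w, f), e) = ((pn M R F j w f e : ℕ) : ZMod n) := fun _ _ _ _ => rfl
  let Q : API n → Prop := fun P => ∃ (w : Fin R) (f : Fin (r+1) → Fin F), ∀ i : Fin (r+1), ptAP n r P i = pos (i, (w, f i), false)
  let Fu : Finset (API n) := Finset.univ.filter Q
  let tt : API n → Fin (r+1) → Fin R × Fin F := fun P => if h : Q P then fun i => (h.choose, h.choose_spec.choose i) else fun _ => (⟨0, hR⟩, ⟨0, hF⟩)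
  have ttp : ∀ P ∈ Fu, ∀ i, ptAP n r P i = pos (i, tt P i, false) := by
    intro P hP i
    have h : Q P := (Finset.mem_filter.1 hP).2
    have := h.choose_spec.choose_spec i
    simp only [tt, dif_pos h]; exact this
  have ttw : ∀ P ∈ Fu, ∀ i, (tt P i).1 = (tt P 0).1 := by
    intro P hP i
    have h : Q P := (Finset.mem_filter.1 hP).2
    simp only [tt, dif_pos h]
  have H1 : HFS (ptAP n r) pos Fu tt := by
    refine ⟨ttp, fun P hP => ?_⟩
    by_contra hc
    push Not at hc
    apply hP
    rw [Finset.mem_filter]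
    refine ⟨Finset.mem_univ _, ?_⟩
    refine geo_full hr hM hn P fun j => ?_
    obtain ⟨i, ⟨w, f⟩, e, h⟩ := hc j
    exact ⟨i, w, f, e, h⟩
  have H2 : HFL Fu tt := by
    refine ⟨fun P hP P' hP' h0 j hj => ?_⟩
    have a0 := (ttp P hP 0).trans (h0 ▸ (ttp P' hP' 0).symm)
    have a1 := (ttp P hP j.succ).trans (hj ▸ (ttp P' hP' j.succ).symm)
    simp only [ptAP] at a0 a1
    simp only [Fin.val_zero, zero_mul, Nat.cast_zero, add_zero] at a0
    rw [a0, add_right_inj] at a1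
    have hu : IsUnit (((j.succ : Fin (r+1)) : ℕ) : ZMod n) := (ZMod.isUnit_iff_coprime _ _).2 (hcop _ (by simp) (by have := j.succ.2; omega))
    push_cast at a1
    have a2 := hu.mul_left_cancel (by simpa using a1 : (((j.succ : Fin (r+1)) : ℕ) : ZMod n) * (P.2.1 : ZMod n) = (((j.succ : Fin (r+1)) : ℕ) : ZMod n) * (P'.2.1 : ZMod n))
    have a3 := (ZMod.natCast_eq_natCast_iff' _ _ _).1 a2
    have b1 := P.2.2; have b2 := P'.2.2
    rw [Finset.mem_Icc] at b1 b2
    rw [Nat.mod_eq_of_lt (by omega), Nat.mod_eq_of_lt (by omega)] at a3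
    exact Prod.ext a0 (Subtype.ext a3)
  refine ⟨pos, Fu, tt, H1, { toHFL := H2, win := ttw, up := ?_, lo := ?_ }⟩
  · intro t
    rw [Fintype.card_fin]
    refine (Finset.card_le_card_of_injOn (t := (Finset.univ : Finset (Fin F))) (fun P => (tt P ((⟨0, by omega⟩ : Fin r).succ)).2) (fun _ _ => Finset.mem_univ _) ?_).trans (by simp)
    intro P hP P' hP' h
    have hP := Finset.mem_filter.1 (Finset.mem_coe.1 hP)
    have hP' := Finset.mem_filter.1 (Finset.mem_coe.1 hP')
    refine H2.lin P hP.1 P' hP'.1 (hP.2.trans hP'.2.symm) ⟨0, by omega⟩ (Prod.ext ?_ h)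
    rw [ttw P hP.1, ttw P' hP'.1, hP.2, hP'.2]
  · intro w
    have key : ∀ u : Fin F, ((F : ℝ) - u) / r ≤ ((Fu.filter (fun P => tt P 0 = (w, u))).card : ℝ) := by
      intro u
      set N := (F - u + r - 1) / r with hN
      have hNr : F - u ≤ r * N := by
        have := Nat.div_add_mod (F - u + r - 1) r
        have h2 := Nat.mod_lt (F - u + r - 1) (by omega : 0 < r)
        rw [← hN] at this; omega
      have hNv : ∀ v < N, ∀ i ≤ r, (u : ℕ) + i * v < F := by
        intro v hv i hi
        have h1 : r * N ≤ F - u + r - 1 := Nat.mul_div_le _ _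
        have h2 : r * (v + 1) ≤ r * N := Nat.mul_le_mul_left _ hv
        have h3 : i * v ≤ r * v := Nat.mul_le_mul_right _ hi
        have := u.2
        rw [mul_add, mul_one] at h2
        omega
      have hcard : N ≤ (Fu.filter (fun P => tt P 0 = (w, u))).card := by
        have hdI : ∀ v : Fin N, 6 * F * M ^ 3 + v ∈ Finset.Icc 1 (n / 2) := by
          intro v
          have h1 := hNv v v.2 1 (by omega)
          have hM0 : 0 < M ^ 3 := by rw [hM]; positivity
          have h2 : F ≤ 6 * F * M ^ 3 := by nlinarith
          have h3 : 3 * (6 * F * M ^ 3) ≤ (r + 1) * (6 * F * M ^ 3) := Nat.mul_le_mul_right _ (by omega)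
          rw [Finset.mem_Icc]; omega
        let Pv : Fin N → API n := fun v => (pos (0, (w, u), false), ⟨_, hdI v⟩)
        have hpt : ∀ (v : Fin N) (i : Fin (r+1)), ptAP n r (Pv v) i = pos (i, (w, ⟨u + i * v, hNv v v.2 i (by have := i.2; omega)⟩), false) := by
          intro v i
          simp only [Pv, ptAP, posd, pn, of_, lb]
          push_cast; simp; ring
        have hmem : ∀ v, Pv v ∈ Fu := fun v => Finset.mem_filter.2 ⟨Finset.mem_univ _, w, _, hpt v⟩
        have := Finset.card_le_card_of_injOn (s := (Finset.univ : Finset (Fin N))) (t := Fu.filter (fun P => tt P 0 = (w, u))) Pv (fun v _ => ?_) ?_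
        · simpa using this
        · rw [Finset.mem_coe, Finset.mem_filter]
          refine ⟨hmem v, ?_⟩
          have h1 := (ttp _ (hmem v) 0).symm.trans (hpt v 0)
          have := pos.injective h1
          simp only [Prod.mk.injEq] at this
          rw [this.2.1]; simp
        · intro v _ v' _ h
          simp only [Pv, Prod.mk.injEq, Subtype.mk.injEq] at h
          exact Fin.ext (by omega)
      rw [div_le_iff₀ (by positivity)]
      have h1 : (F : ℝ) - u ≤ r * N := by
        have : F ≤ r * N + u := by omega
        have : (F : ℝ) ≤ r * N + u := by exact_mod_cast this
        linarith
      have h2 : (N : ℝ) ≤ ((Fu.filter (fun P => tt P 0 = (w, u))).card : ℝ) := by exact_mod_cast hcard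
      have hr0 : (0 : ℝ) ≤ r := Nat.cast_nonneg r
      nlinarith
    rw [Fintype.card_fin]
    calc (F : ℝ) ^ 2 / (2 * r) = ((F : ℝ) ^ 2 / 2) / r := by rw [div_div]
      _ ≤ (∑ u : Fin F, ((F : ℝ) - u)) / r := by gcongr; exact sum_fin_lower F
      _ = ∑ u : Fin F, ((F : ℝ) - u) / r := by rw [Finset.sum_div]
      _ ≤ _ := Finset.sum_le_sum fun u _ => by convert key u
end Geo2

section HFfin
open Classical in
lemma HFx {n r R F m : ℕ} [NeZero n] (hr : 2 ≤ r) (hR : 0 < R) (hF : 0 < F) (hn : 2 * ((r+1) * (6 * F * ((r+2)*R)^3)) < n)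
    (hcop : ∀ j, 1 ≤ j → j ≤ r → Nat.Coprime j n) (hm0 : 0 < m) (hm1 : m < n) {θ c : ℝ}
    (hE : ∀ (pos : Fin (r+1) × (Fin R × Fin F) × Bool ↪ ZMod n) (Fu : Finset (API n)) (tt : API n → Fin (r+1) → Fin R × Fin F), HFW Fu tt →
      ∀ w, Ex (qq ((m:ℝ)/n)) (Fw pos Fu tt θ w) ≤ 1 - c) :
    ‖Esl m (gf (pX (ptAP n r)) θ)‖ ^ (2^r) ≤ 2 * √(n:ℝ) * Real.exp (-(c * R)) := by
  obtain ⟨pos, Fu, tt, H1, H2⟩ := geo (n := n) hr hR hF hn hcop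
  have hcard : Fintype.card (ZMod n) = n := ZMod.card n
  have hp : (0:ℝ) ≤ (m:ℝ)/n ∧ (m:ℝ)/n ≤ 1 := by
    have : (0:ℝ) < n := by exact_mod_cast (by omega : 0 < n)
    exact ⟨by positivity, by rw [div_le_one this]; exact_mod_cast hm1.le⟩
  have h1 := HF1 H1 (m := m) (by rw [hcard]; exact hm1.le) θ
  have h2 := HF2 (G := ZMod n) (m := m) (T := Fin R × Fin F) (r := r) hm0 (by rw [hcard]; exact hm1)
    (fun y b b' => ∏ t, |Real.cos (θ * gam pos y t * Ww Fu tt pos y b b' t / 2)|) (fun _ _ _ => Finset.prod_nonneg fun _ _ => abs_nonneg _)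
  rw [hcard] at h2
  have h3 := HF4 H2 hp (hE pos Fu tt H2)
  rw [Fintype.card_fin] at h3
  refine h1.trans (h2.trans ?_)
  gcongr

lemma HFy {r : ℕ} (hr : 2 ≤ r) {s0 : ℝ} (hs0 : 0 < s0) (hs1 : s0 ≤ 1) : ∃ c > 0, ∀ (n m R : ℕ) [NeZero n] (θ : ℝ), 0 < m → m < n →
    s0 ≤ (m:ℝ)/n * (1 - (m:ℝ)/n) → (∀ j, 1 ≤ j → j ≤ r → Nat.Coprime j n) → 0 < R → 0 < |θ| → |θ| ≤ Real.pi →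
    48 * ((r:ℝ)+1) * ((r+2)*R)^3 < n * |θ| → ‖Esl m (gf (pX (ptAP n r)) θ)‖ ^ (2^r) ≤ 2 * √(n:ℝ) * Real.exp (-(c * R)) := by
  have hr0 : (2:ℝ) ≤ r := by exact_mod_cast hr
  set c1 : ℝ := s0 ^ (r+1) / (8 * r) with hc1
  have hc10 : 0 < c1 := by positivity
  have hc11 : c1 ≤ 1/4 := by
    rw [hc1, div_le_iff₀ (by positivity)]
    have := pow_le_one₀ hs0.le hs1 (n := r+1); linarith
  obtain ⟨η, hη⟩ : ∃ η, η = c1 := ⟨_, rfl⟩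
  have hη0 : 0 < η := hη ▸ hc10
  refine ⟨min (η^2 * c1 / 8) (η^2 * s0^(r+1) / (2 * r * Real.pi^2)), by positivity, ?_⟩
  intro n m R _ θ hm0 hm1 hp hcop hR hθ0 hθ1 hsz
  have hn0 : (0:ℝ) < n := by exact_mod_cast (by omega : 0 < n)
  have hp01 : (0:ℝ) ≤ (m:ℝ)/n ∧ (m:ℝ)/n ≤ 1 := ⟨by positivity, by rw [div_le_one hn0]; exact_mod_cast hm1.le⟩
  have hps : s0 ^ (r+1) ≤ ((m:ℝ)/n * (1 - (m:ℝ)/n)) ^ (r+1) := pow_le_pow_left₀ hs0.le hp _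
  have hR0 : (0:ℝ) < R := by exact_mod_cast hR
  have size : ∀ F : ℕ, (F:ℝ) * |θ| ≤ 4 → 2 * ((r+1) * (6 * F * ((r+2)*R)^3)) < n := by
    intro F hF
    have : (2:ℝ) * ((r+1) * (6 * F * ((r+2)*R)^3)) < n := by
      refine lt_of_mul_lt_mul_right ?_ hθ0.le
      refine lt_of_le_of_lt ?_ hsz
      have h0 : (0:ℝ) ≤ 12 * (r+1) * ((r+2)*R)^3 := by positivity
      nlinarith [mul_le_mul_of_nonneg_left hF h0]
    exact_mod_cast this
  rcases le_or_gt |θ| η with h | h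
  · set F := ⌊η / |θ|⌋₊ with hF
    have hF1 : 1 ≤ F := Nat.le_floor (by rw [Nat.cast_one, one_le_div hθ0]; exact h)
    have hF1' : (1:ℝ) ≤ F := by exact_mod_cast hF1
    have hFu : (F:ℝ) * |θ| ≤ η := by rw [← le_div_iff₀ hθ0]; exact Nat.floor_le (by positivity)
    have hFl : η / 2 ≤ F * |θ| := by
      have := Nat.lt_floor_add_one (η / |θ|)
      rw [div_lt_iff₀ hθ0, ← hF] at this
      nlinarith
    refine (HFx (F := F) (c := η^2 * c1 / 8) hr hR hF1 (size F (by linarith)) hcop hm0 hm1 ?_).trans ?_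
    · intro pos Fu tt H w
      have hc1p : c1 ≤ ((m:ℝ)/n * (1 - (m:ℝ)/n)) ^ (r+1) / (8 * r) := by rw [hc1]; gcongr
      have := HF3a (pos := pos) (by omega) H hp01 (by rw [Fintype.card_fin]; exact hF1) (θ := θ) rfl rfl (by
        rw [Fintype.card_fin]
        have : (|θ| * F)^2 ≤ η^2 := by gcongr; linarith
        nlinarith) w
      refine this.trans ?_
      rw [Fintype.card_fin]
      have h2 : (η/2)^2 ≤ (|θ| * F)^2 := by gcongr; linarith
      have := mul_le_mul h2 hc1p hc10.le (by positivity)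
      nlinarith
    · gcongr; exact min_le_left _ _
  · refine (HFx (F := 1) (c := η^2 * s0^(r+1) / (2 * r * Real.pi^2)) hr hR one_pos (size 1 (by rw [Nat.cast_one, one_mul]; linarith [Real.pi_le_four])) hcop hm0 hm1 ?_).trans ?_
    · intro pos Fu tt H w
      refine (HF3b (pos := pos) (by omega) H hp01 (by simp) hθ1 w).trans ?_
      have : η^2 * s0^(r+1) / (2 * r * Real.pi^2) ≤ θ^2 * ((m:ℝ)/n * (1 - (m:ℝ)/n)) ^ (r+1) / (2 * r * Real.pi^2) := by
        rw [← sq_abs θ]; gcongr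
      linarith
    · gcongr; exact min_le_right _ _

lemma HFz {r : ℕ} (hr : 2 ≤ r) {s0 δ : ℝ} (hs0 : 0 < s0) (hs1 : s0 ≤ 1) (hδ : 0 < δ) : ∀ᶠ n : ℕ in Filter.atTop, ∀ (m : ℕ) [NeZero n] (θ : ℝ), 0 < m → m < n →
    s0 ≤ (m:ℝ)/n * (1 - (m:ℝ)/n) → (∀ j, 1 ≤ j → j ≤ r → Nat.Coprime j n) → (n:ℝ)^(-1+δ) ≤ |θ| → |θ| ≤ Real.pi →
    ‖Esl m (gf (pX (ptAP n r)) θ)‖ ≤ 1 / (n:ℝ)^2 := by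
  obtain ⟨c, hc, H⟩ := HFy hr hs0 hs1
  obtain ⟨M, hM⟩ := exists_nat_gt (6/δ)
  have hx : Filter.Tendsto (fun n : ℕ => (n:ℝ)^(δ/6)) Filter.atTop Filter.atTop :=
    (tendsto_rpow_atTop (by positivity)).comp tendsto_natCast_atTop_atTop
  have e1 := hx.eventually_gt_atTop (48 * ((r:ℝ)+1) * (r+2)^3)
  have e2 : ∀ᶠ n : ℕ in Filter.atTop, 2 * Real.exp c * (((n:ℝ)^(δ/6)) ^ (M * (1 + 2 * 2^r)) * Real.exp (-(c * (n:ℝ)^(δ/6)))) ≤ 1 := by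
    have t0 := (Real.tendsto_pow_mul_exp_neg_atTop_nhds_zero (M * (1 + 2 * 2^r))).comp ((Filter.tendsto_const_mul_atTop_of_pos hc).2 hx)
    have t1 := t0.const_mul (2 * Real.exp c * (c ^ (M * (1 + 2 * 2^r)))⁻¹)
    rw [mul_zero] at t1
    filter_upwards [t1.eventually_le_const one_pos] with n hn
    refine le_trans (le_of_eq ?_) hn
    simp only [Function.comp, mul_pow]
    field_simp
  filter_upwards [e1, e2, Filter.eventually_ge_atTop 1] with n h1 h2 hn1 m _ θ hm0 hm1 hp hcop hθ hθ1
  have hn0 : (1:ℝ) ≤ n := by exact_mod_cast hn1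
  have hn0' : (0:ℝ) < n := by linarith
  set x : ℝ := (n:ℝ)^(δ/6) with hxd
  have hx1 : 1 ≤ x := Real.one_le_rpow hn0 (by positivity)
  have hθ0 : 0 < |θ| := lt_of_lt_of_le (Real.rpow_pos_of_pos hn0' _) hθ
  have hx6 : x ^ 6 = (n:ℝ)^δ := by rw [hxd, ← Real.rpow_natCast, ← Real.rpow_mul hn0'.le]; congr 1; push_cast; ring
  have hR := Nat.floor_le (show 0 ≤ x by linarith)
  have hRl := Nat.lt_floor_add_one x
  have hsz : 48 * ((r:ℝ)+1) * ((r+2)*⌊x⌋₊)^3 < n * |θ| := by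
    have a : (n:ℝ)^δ ≤ n * |θ| := by
      calc (n:ℝ)^δ = n * (n:ℝ)^(-1+δ) := by rw [Real.rpow_add hn0', Real.rpow_neg_one]; field_simp
        _ ≤ _ := by gcongr
    refine lt_of_lt_of_le ?_ a
    rw [← hx6]
    calc 48 * ((r:ℝ)+1) * ((r+2)*⌊x⌋₊)^3 ≤ 48 * ((r:ℝ)+1) * ((r+2)*x)^3 := by gcongr
      _ = (48 * ((r:ℝ)+1) * (r+2)^3) * x^3 := by ring
      _ < x * x^3 := by gcongr
      _ = x^4 := by ring
      _ ≤ x^6 := pow_le_pow_right₀ hx1 (by norm_num)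
  have key := H n m ⌊x⌋₊ θ hm0 hm1 hp hcop (Nat.floor_pos.2 hx1) hθ0 hθ1 hsz
  have hnx : (n:ℝ) ≤ x ^ M := by
    rw [hxd, ← Real.rpow_natCast, ← Real.rpow_mul hn0'.le]
    conv_lhs => rw [← Real.rpow_one (n:ℝ)]
    refine Real.rpow_le_rpow_of_exponent_le hn0 ?_
    rw [div_lt_iff₀ hδ] at hM; linarith
  have : ‖Esl m (gf (pX (ptAP n r)) θ)‖ ^ (2^r) ≤ (1/(n:ℝ)^2)^(2^r) := by
    refine key.trans ?_
    rw [one_div, inv_pow, ← one_div, le_div_iff₀ (by positivity), ← pow_mul]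
    refine le_trans ?_ h2
    have a1 : √(n:ℝ) ≤ n := by rw [Real.sqrt_le_left (by linarith)]; nlinarith
    have a2 : Real.exp (-(c * ⌊x⌋₊)) ≤ Real.exp c * Real.exp (-(c * x)) := by
      rw [← Real.exp_add]; apply Real.exp_le_exp.2; nlinarith
    calc _ ≤ 2 * (n:ℝ) * (Real.exp c * Real.exp (-(c * x))) * (n:ℝ)^(2*2^r) := by gcongr
      _ = 2 * Real.exp c * ((n:ℝ)^(1+2*2^r) * Real.exp (-(c * x))) := by ring
      _ ≤ 2 * Real.exp c * ((x^M)^(1+2*2^r) * Real.exp (-(c * x))) := by gcongr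
      _ = _ := by rw [← pow_mul]
  exact le_of_pow_le_pow_left₀ (by positivity) (by positivity) this

lemma kAP_pX {n r : ℕ} [NeZero n] (x : ZMod n → Bool) : (kAPcount (r+1) x : ℝ) = pX (ptAP n r) x := by
  simp only [kAPcount, pX, API, Fintype.sum_prod_type, ptAP, bt]
  push_cast
  refine Finset.sum_congr rfl fun a _ => ?_
  rw [← Finset.sum_coe_sort (Finset.Icc 1 (n/2))]
  refine Finset.sum_congr rfl fun d _ => ?_
  rw [Finset.prod_range]
end HFfin

section APs
variable {n r : ℕ} [NeZero n]

lemma zmod_cancel {u : ℕ} (hu : Nat.Coprime u n) {a b : ZMod n} (h : (u : ZMod n) * a = u * b) : a = b :=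
  ((ZMod.isUnit_iff_coprime u n).2 hu).mul_left_cancel h

lemma small_inj {d d' : ℕ} (hd : d ∈ Finset.Icc 1 (n/2)) (hd' : d' ∈ Finset.Icc 1 (n/2)) (h : (d : ZMod n) = d') : d = d' := by
  have h0 := NeZero.pos n
  rw [Finset.mem_Icc] at hd hd'
  rw [ZMod.natCast_eq_natCast_iff'] at h
  rwa [Nat.mod_eq_of_lt (by omega), Nat.mod_eq_of_lt (by omega)] at h

lemma small_ne {d : ℕ} (hd : d ∈ Finset.Icc 1 (n/2)) : (d : ZMod n) ≠ 0 := by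
  have h0 := NeZero.pos n
  rw [Finset.mem_Icc] at hd
  intro h
  rw [ZMod.natCast_eq_zero_iff] at h
  have := Nat.le_of_dvd (by omega) h
  omega

/-- pair differences determine the progression -/
lemma pt_pair (hcop : ∀ j, 1 ≤ j → j ≤ r → Nat.Coprime j n) {P P' : API n} {i j : Fin (r+1)} (hij : i ≠ j)
    (h1 : ptAP n r P i = ptAP n r P' i) (h2 : ptAP n r P j = ptAP n r P' j) : P = P' := by
  wlog hlt : i < j generalizing i j
  · exact this hij.symm h2 h1 (lt_of_le_of_ne (not_lt.1 hlt) hij.symm)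
  have hl : (i : ℕ) < j := hlt
  obtain ⟨u, hu⟩ := Nat.exists_eq_add_of_lt hl
  obtain ⟨a, d, hd⟩ := P
  obtain ⟨a', d', hd'⟩ := P'
  simp only [ptAP] at h1 h2
  rw [show (j:ℕ) = i + (u + 1) by omega] at h2
  push_cast at h1 h2
  have h3 : ((u + 1 : ℕ) : ZMod n) * d = ((u+1 : ℕ) : ZMod n) * d' := by push_cast; linear_combination h2 - h1
  have h4 := zmod_cancel (hcop _ (by omega) (by have := j.2; omega)) h3
  have h5 := small_inj hd hd' h4
  subst h5
  simp only [Prod.mk.injEq, Subtype.mk.injEq, and_true]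
  exact add_right_cancel h1

lemma pt_inj (hcop : ∀ j, 1 ≤ j → j ≤ r → Nat.Coprime j n) (P : API n) : Function.Injective (ptAP n r P) := by
  intro i j h
  by_contra hij
  wlog hlt : i < j generalizing i j
  · exact this h.symm (Ne.symm hij) (lt_of_le_of_ne (not_lt.1 hlt) (Ne.symm hij))
  have hl : (i : ℕ) < j := hlt
  obtain ⟨u, hu⟩ := Nat.exists_eq_add_of_lt hl
  obtain ⟨a, d, hd⟩ := P
  simp only [ptAP] at h
  rw [show (j:ℕ) = i + (u + 1) by omega] at h
  push_cast at h
  have h3 : ((u + 1 : ℕ) : ZMod n) * d = ((u+1 : ℕ) : ZMod n) * 0 := by push_cast; linear_combination -h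
  exact small_ne hd (zmod_cancel (hcop _ (by omega) (by have := j.2; omega)) h3)

/-- edge index of the centred expansion -/
abbrev EK (n r : ℕ) := API n × {T : Finset (Fin (r+1)) // 3 ≤ T.card}
/-- edges -/
def SK (n r : ℕ) (e : EK n r) : Finset (ZMod n) := e.2.1.image (ptAP n r e.1)
/-- weights -/
noncomputable def yK (n r : ℕ) (p : ℝ) (e : EK n r) : ℝ := p ^ (r + 1 - e.2.1.card)
/-- pair degree -/
def KK (r : ℕ) : ℕ := (r+1) * ((r+1) * 2^(r+1))

lemma HG_AP (hcop : ∀ j, 1 ≤ j → j ≤ r → Nat.Coprime j n) : HG (SK n r) (r+1) (KK r) := by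
  have hc : ∀ e, (SK n r e).card = e.2.1.card := fun e => Finset.card_image_of_injective _ (pt_inj hcop e.1)
  refine ⟨fun e => by rw [hc]; exact e.2.2, fun e => by rw [hc]; simpa using Finset.card_le_univ e.2.1, fun a b hab => ?_⟩
  have := Finset.card_le_card_of_forall_subsingleton (s := Finset.univ.filter fun e => a ∈ SK n r e ∧ b ∈ SK n r e)
    (t := (Finset.univ : Finset (Fin (r+1) × Fin (r+1) × Finset (Fin (r+1)))))
    (fun e z => ptAP n r e.1 z.1 = a ∧ ptAP n r e.1 z.2.1 = b ∧ e.2.1 = z.2.2) (fun e he => ?_) ?_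
  · refine this.trans (le_of_eq ?_)
    simp [KK]
  · have := (Finset.mem_filter.1 he).2
    simp only [SK, Finset.mem_image] at this
    obtain ⟨⟨i, _, hi⟩, ⟨j, _, hj⟩⟩ := this
    exact ⟨(i, j, e.2.1), Finset.mem_univ _, hi, hj, rfl⟩
  · rintro ⟨i, j, T⟩ _ e ⟨_, h1, h2, h3⟩ e' ⟨_, h1', h2', h3'⟩
    simp only at h1 h2 h3 h1' h2' h3'
    have hij : i ≠ j := by rintro rfl; exact hab (h1.symm.trans h2)
    exact Prod.ext (pt_pair hcop hij (h1.trans h1'.symm) (h2.trans h2'.symm)) (Subtype.ext (h3.trans h3'.symm))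

lemma sum_half (hodd : Odd n) (g : ZMod n → ℝ) (hg : ∀ e, g (-e) = g e) :
    2 * ∑ d ∈ Finset.Icc 1 (n/2), g d = ∑ e : ZMod n, g e - g 0 := by
  obtain ⟨h, hh⟩ := hodd
  have e0 : ∑ e : ZMod n, g e = ∑ i ∈ Finset.range n, g i := by
    symm
    refine Finset.sum_bij (fun i _ => (i : ZMod n)) (fun _ _ => Finset.mem_univ _) ?_ ?_ (fun _ _ => rfl)
    · intro a ha b hb hab
      rw [Finset.mem_range] at ha hb
      rw [ZMod.natCast_eq_natCast_iff', Nat.mod_eq_of_lt ha, Nat.mod_eq_of_lt hb] at hab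
      exact hab
    · intro b _
      exact ⟨b.val, Finset.mem_range.2 (ZMod.val_lt b), ZMod.natCast_zmod_val b⟩
  have e1 : Finset.Icc 1 (n/2) = Finset.Ico 1 (h+1) := by ext; simp; omega
  have e2 : ∑ d ∈ Finset.Ico 1 (h+1), g d = ∑ i ∈ Finset.range h, g ((i+1 : ℕ)) := by
    rw [Finset.sum_Ico_eq_sum_range]; simp [add_comm]
  have e3 : ∑ i ∈ Finset.range h, g ((h + i + 1 : ℕ)) = ∑ i ∈ Finset.range h, g ((i+1 : ℕ)) := by
    rw [← Finset.sum_range_reflect]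
    refine Finset.sum_congr rfl fun i hi => ?_
    rw [Finset.mem_range] at hi
    rw [← hg]
    congr 1
    have : (((h + (h - 1 - i) + 1) + (i + 1) : ℕ) : ZMod n) = 0 := by
      rw [show (h + (h - 1 - i) + 1) + (i + 1) = n by omega]; simp
    push_cast at this ⊢
    linear_combination -this
  have e4 : Finset.range n = Finset.range ((h + h) + 1) := by congr 1; omega
  rw [e0, e1, e2, e4, Finset.sum_range_succ', Finset.sum_range_add, Nat.cast_zero, e3]
  ring

lemma deg2 (hodd : Odd n) (hcop : ∀ j, 1 ≤ j → j ≤ r → Nat.Coprime j n) {i j : Fin (r+1)} (hij : i ≠ j) (f : ZMod n → ℝ) :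
    2 * ∑ P : API n, f (ptAP n r P i) * f (ptAP n r P j) = (∑ a, f a)^2 - ∑ a, f a ^ 2 := by
  wlog hlt : i < j generalizing i j
  · rw [← this hij.symm (lt_of_le_of_ne (not_lt.1 hlt) hij.symm)]
    simp only [mul_comm]
  have hl : (i : ℕ) < j := hlt
  obtain ⟨u, hu⟩ := Nat.exists_eq_add_of_lt hl
  set g : ZMod n → ℝ := fun e => ∑ a, f a * f (a + ((u+1 : ℕ) : ZMod n) * e) with hg
  have e1 : ∑ P : API n, f (ptAP n r P i) * f (ptAP n r P j) = ∑ d ∈ Finset.Icc 1 (n/2), g d := by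
    rw [Fintype.sum_prod_type_right, ← Finset.sum_coe_sort (Finset.Icc 1 (n/2))]
    refine Finset.sum_congr rfl fun d _ => ?_
    simp only [hg, ptAP]
    refine Fintype.sum_equiv (Equiv.addRight (((i : ℕ) * d.1 : ℕ) : ZMod n)) _ _ fun a => ?_
    simp only [Equiv.coe_addRight]
    rw [show (j:ℕ) = i + (u + 1) by omega]
    push_cast; ring_nf
  rw [e1, sum_half hodd g]
  · congr 1
    · have : ∑ e, g e = ∑ e, ∑ a, f a * f (a + e) := by
        have hb : Function.Bijective (fun e : ZMod n => ((u+1 : ℕ) : ZMod n) * e) :=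
          Finite.injective_iff_bijective.1 fun a b h => zmod_cancel (hcop _ (by omega) (by have := j.2; omega)) h
        exact Fintype.sum_bijective _ hb _ _ fun e => rfl
      rw [this, Finset.sum_comm, sq, Finset.sum_mul_sum]
      refine Finset.sum_congr rfl fun a _ => ?_
      exact Fintype.sum_equiv (Equiv.addLeft a) _ _ fun e => rfl
    · simp [hg, sq]
  · intro e
    simp only [hg]
    refine Fintype.sum_equiv (Equiv.addRight (- (((u+1 : ℕ) : ZMod n) * e))) _ _ fun a => ?_
    simp only [Equiv.coe_addRight]
    rw [mul_comm]; congr 2 <;> ring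

variable {m : ℕ} {p : ℝ}

lemma low_const (hodd : Odd n) (hcop : ∀ j, 1 ≤ j → j ≤ r → Nat.Coprime j n) (hp : p = (m:ℝ)/n) (T : Finset (Fin (r+1))) (hT : ¬ 3 ≤ T.card) :
    ∃ D : ℝ, ∀ x : ZMod n → Bool, cnt x = m → ∑ P : API n, ∏ i ∈ T, chi (fun _ => p) (ptAP n r P i) x = D := by
  have hs : ∀ x : ZMod n → Bool, cnt x = m → ∑ a, chi (fun _ => p) a x = 0 := fun x hx => sum_chi hx (by rw [ZMod.card]; exact hp)
  have hc : T.card = 0 ∨ T.card = 1 ∨ T.card = 2 := by omega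
  rcases hc with h | h | h
  · rw [Finset.card_eq_zero] at h
    subst h
    exact ⟨∑ P : API n, 1, fun x hx => by simp only [Finset.prod_empty]⟩
  · obtain ⟨i, rfl⟩ := Finset.card_eq_one.1 h
    refine ⟨0, fun x hx => ?_⟩
    simp only [Finset.prod_singleton]
    rw [Fintype.sum_prod_type_right]
    refine Finset.sum_eq_zero fun d _ => ?_
    rw [← hs x hx]
    exact Fintype.sum_equiv (Equiv.addRight (((i : ℕ) * d.1 : ℕ) : ZMod n)) _ _ fun a => rfl
  · obtain ⟨i, j, hij, rfl⟩ := Finset.card_eq_two.1 h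
    refine ⟨- (m * (1 - 2*p) + n * p^2) / 2, fun x hx => ?_⟩
    simp only [Finset.prod_pair hij]
    have h1 := deg2 hodd hcop hij (fun a => chi (fun _ => p) a x)
    rw [hs x hx] at h1
    have h2 : ∑ a, chi (fun _ => p) a x ^ 2 = m * (1 - 2*p) + n * p^2 := by
      have : ∀ a, chi (fun _ => p) a x ^ 2 = (if x a then (1:ℝ) else 0) * (1 - 2*p) + p^2 := by
        intro a; unfold chi; split_ifs <;> ring
      simp only [this]
      rw [Finset.sum_add_distrib, ← Finset.sum_mul, Finset.sum_boole, Finset.sum_const, Finset.card_univ, ZMod.card, nsmul_eq_mul]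
      rw [← hx, cnt]
    rw [h2] at h1
    linarith

lemma X_expand (hodd : Odd n) (hcop : ∀ j, 1 ≤ j → j ≤ r → Nat.Coprime j n) (hp : p = (m:ℝ)/n) :
    ∃ κ : ℝ, ∀ x : ZMod n → Bool, cnt x = m → pX (ptAP n r) x = κ + Yp p (SK n r) (yK n r p) x := by
  choose! D hD using low_const (r := r) (m := m) (p := p) hodd hcop hp
  refine ⟨∑ T : Finset (Fin (r+1)), if 3 ≤ T.card then 0 else p ^ (r+1-T.card) * D T, fun x hx => ?_⟩
  have e1 : pX (ptAP n r) x = ∑ T : Finset (Fin (r+1)), p ^ (r+1-T.card) * ∑ P : API n, ∏ i ∈ T, chi (fun _ => p) (ptAP n r P i) x := by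
    simp only [Finset.mul_sum]
    rw [Finset.sum_comm]
    unfold pX
    refine Finset.sum_congr rfl fun P _ => ?_
    have : ∀ i, bt (x (ptAP n r P i)) = chi (fun _ => p) (ptAP n r P i) x + p := by intro i; unfold bt chi; ring
    simp only [this]
    rw [Finset.prod_add, Finset.powerset_univ]
    refine Finset.sum_congr rfl fun T _ => ?_
    rw [Finset.prod_const, Finset.card_sdiff_of_subset (Finset.subset_univ _), Finset.card_univ, Fintype.card_fin, mul_comm]
  have e2 : Yp p (SK n r) (yK n r p) x = ∑ T : Finset (Fin (r+1)), if 3 ≤ T.card then p ^ (r+1-T.card) * ∑ P : API n, ∏ i ∈ T, chi (fun _ => p) (ptAP n r P i) x else 0 := by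
    unfold Yp
    rw [Fintype.sum_prod_type_right, ← Finset.sum_filter, ← Finset.sum_subtype_eq_sum_filter]
    simp only [Finset.subtype_univ]
    refine Finset.sum_congr rfl fun T _ => ?_
    rw [Finset.mul_sum]
    refine Finset.sum_congr rfl fun P _ => ?_
    simp only [yK, mon, SK]
    rw [Finset.prod_image fun a _ b _ h => pt_inj hcop P h]
  rw [e1, e2, ← Finset.sum_add_distrib]
  refine Finset.sum_congr rfl fun T _ => ?_
  split_ifs with h
  · ring
  · rw [hD T h x hx]; ring

lemma sum_y_sq (hr : 2 ≤ r) : (n : ℝ) * (n/2 : ℕ) ≤ ∑ e, yK n r p e ^ 2 := by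
  have h3 : 3 ≤ (Finset.univ : Finset (Fin (r+1))).card := by simp; omega
  rw [Fintype.sum_prod_type]
  calc (n : ℝ) * (n/2 : ℕ) = ∑ P : API n, (1:ℝ) := by simp [ZMod.card]
    _ ≤ _ := Finset.sum_le_sum fun P _ => by
      refine le_trans (le_of_eq ?_) (Finset.single_le_sum (f := fun T => yK n r p (P, T) ^ 2) (fun T _ => sq_nonneg _) (Finset.mem_univ ⟨Finset.univ, h3⟩))
      simp [yK]

lemma vv_bounds (hr : 2 ≤ r) {s0 : ℝ} (hs0 : 0 < s0) : ∃ c > 0, ∃ N0 : ℕ, ∀ (n m : ℕ) [NeZero n] (p q : ℝ), N0 ≤ n → SL (ZMod n) m p q → s0 ≤ p * (1-p) →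
    (∀ j, 1 ≤ j → j ≤ r → Nat.Coprime j n) → c * q^8 ≤ vv p q (SK n r) (yK n r p) ∧ vv p q (SK n r) (yK n r p) ≤ 2 * (KK r)^2 * q^8 := by
  set A : ℝ := (((KK r)^2 * (r+1)^4 : ℕ) : ℝ) with hA
  have hA0 : 0 ≤ A := by positivity
  set s := s0^(r+1) with hs
  have hs' : 0 < s := by positivity
  obtain ⟨N1, hN1⟩ := exists_nat_gt (2 * ((r:ℝ)+1) + 32 * A / s + 3)
  refine ⟨s/16, by positivity, N1, ?_⟩
  intro n m _ p q hn sl hps hcop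
  have hG := HG_AP (n := n) (r := r) hcop
  have hn1 : 2 * ((r:ℝ)+1) + 32 * A / s + 3 < n := lt_of_lt_of_le hN1 (by exact_mod_cast hn)
  have hq4 : q^4 = n := by rw [sl.hq, ZMod.card]
  have hp := sl.p01
  have hy : ∀ e, 0 ≤ yK n r p e ∧ yK n r p e ≤ 1 := fun e => ⟨pow_nonneg hp.1 _, pow_le_one₀ hp.1 hp.2⟩
  have hy1 : ∀ e, |yK n r p e| ≤ 1 := fun e => by rw [abs_of_nonneg (hy e).1]; exact (hy e).2
  have hAs : 0 ≤ 32 * A / s := by positivity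
  have hr0 : (0:ℝ) ≤ r := Nat.cast_nonneg r
  have hn0 : (0:ℝ) < n := by linarith
  constructor
  · have h1 := Gam_mean_lower hG hp hy
    rw [ZMod.card] at h1
    unfold vv
    rw [hq4, le_div_iff₀ hn0, show q^8 = (q^4)^2 by ring, hq4]
    refine le_trans ?_ h1
    rw [← hA]
    have a1 : (n:ℝ)/2 ≤ n - ((r+1:ℕ):ℝ) := by push_cast; linarith
    have a2 : s ≤ (p*(1-p))^(r+1) := pow_le_pow_left₀ hs0.le hps _
    have a3 : (n:ℝ) * (n/4) ≤ ∑ e, yK n r p e ^ 2 := by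
      refine le_trans ?_ (sum_y_sq hr)
      have : (n:ℝ) ≤ 2 * (n/2 : ℕ) + 1 := by exact_mod_cast (by omega : n ≤ 2 * (n/2) + 1)
      gcongr; linarith
    have a4 : (n:ℝ)/2 * s * (n * (n/4)) ≤ (n - ((r+1:ℕ):ℝ)) * (p*(1-p))^(r+1) * ∑ e, yK n r p e ^ 2 := by
      have : 0 ≤ (p*(1-p))^(r+1) := hs'.le.trans a2
      have : 0 ≤ (n:ℝ) - ((r+1:ℕ):ℝ) := by linarith
      gcongr
    have a5 : 16 * A ≤ s * n := by
      have : 32 * A / s < n := by linarith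
      rw [div_lt_iff₀ hs'] at this; nlinarith
    have a6 := mul_le_mul_of_nonneg_right a5 (sq_nonneg (n:ℝ))
    nlinarith
  · have h1 := le_of_abs_le (Gam_mean_upper hG hp (u := fun e => yK n r p e / (SK n r e).card) (u_le hG hy1) hy1)
    unfold vv
    rw [div_le_iff₀ (by rw [hq4]; exact hn0)]
    refine h1.trans (le_of_eq ?_)
    rw [← sl.hq]; ring
end APs

section L1
/-- the discretised normal density -/
noncomputable def gN (μ σ : ℝ) (z : ℤ) : ℝ := stdNormal (((z : ℝ) - μ) / σ) / σ
/-- constant -/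
noncomputable def cZ : ℝ := ∑' z : ℤ, 1 / (z : ℝ) ^ 2

lemma cZ_sum : Summable fun z : ℤ => 1 / (z : ℝ) ^ 2 := Real.summable_one_div_int_pow.2 one_lt_two
lemma cZ_nonneg : 0 ≤ cZ := tsum_nonneg fun z => by positivity

lemma exp_neg_le {t : ℝ} (ht : 0 < t) : Real.exp (-t) ≤ 1 / t := by
  rw [Real.exp_neg, ← one_div]
  exact one_div_le_one_div_of_le ht (by linarith [Real.add_one_le_exp t])

lemma gN_nonneg {μ σ : ℝ} (hσ : 0 < σ) (z : ℤ) : 0 ≤ gN μ σ z := by unfold gN stdNormal; positivity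

lemma gN_summable {μ σ : ℝ} (hσ : 0 < σ) : Summable (gN μ σ) := by
  set K : ℝ := (Real.sqrt (2 * Real.pi))⁻¹ / σ * Real.exp (μ^2 / (2 * σ^2)) with hK
  have hK0 : 0 ≤ K := by positivity
  refine Summable.of_nonneg_of_le (gN_nonneg hσ) (fun z => ?_) (((cZ_sum.mul_left (K * (4 * σ^2)))).add (hasSum_ite_eq (0:ℤ) K).summable)
  have h1 : gN μ σ z ≤ K * Real.exp (-((z:ℝ)^2 / (4 * σ^2))) := by
    have : Real.exp (-((((z:ℝ) - μ)/σ)^2)/2) ≤ Real.exp (μ^2 / (2 * σ^2)) * Real.exp (-((z:ℝ)^2 / (4 * σ^2))) := by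
      rw [← Real.exp_add]
      apply Real.exp_le_exp.2
      have : μ^2 / (2 * σ^2) + -((z:ℝ)^2 / (4 * σ^2)) - (-((((z:ℝ) - μ)/σ)^2)/2) = ((z:ℝ) - 2*μ)^2 / (4 * σ^2) := by field_simp; ring
      have h2 : 0 ≤ ((z:ℝ) - 2*μ)^2 / (4 * σ^2) := by positivity
      linarith
    unfold gN stdNormal
    rw [hK]
    calc _ = (Real.sqrt (2 * Real.pi))⁻¹ / σ * Real.exp (-((((z:ℝ) - μ)/σ)^2)/2) := by ring
      _ ≤ _ := by rw [mul_assoc]; gcongr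
  refine h1.trans ?_
  by_cases hz : z = 0
  · subst hz; simp
  · have hz' : (z:ℝ) ≠ 0 := by exact_mod_cast hz
    have := exp_neg_le (t := (z:ℝ)^2 / (4 * σ^2)) (by positivity)
    rw [if_neg hz, add_zero]
    calc _ ≤ K * (1 / ((z:ℝ)^2 / (4 * σ^2))) := by gcongr
      _ = _ := by field_simp

lemma gN_tsum {μ σ : ℝ} (hσ : 0 < σ) : |∑' z, gN μ σ z - 1| ≤ cZ / σ^2 := by
  have hpi := Real.pi_pos
  set a : ℝ := 2 * Real.pi * σ^2 with ha
  have ha0 : 0 < a := by positivity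
  have H := Complex.tsum_exp_neg_quadratic (a := (a : ℂ)) (by simpa using ha0) (Complex.I * μ)
  have ea : (a : ℂ) ^ (1/2 : ℂ) = ((Real.sqrt (2 * Real.pi) * σ : ℝ) : ℂ) := by
    have : Real.sqrt (2 * Real.pi) * σ = a ^ (1/2 : ℝ) := by
      rw [← Real.sqrt_eq_rpow, ha, Real.sqrt_mul (show 0 ≤ 2 * Real.pi by positivity) (σ^2), Real.sqrt_sq hσ.le]
    rw [this, Complex.ofReal_cpow ha0.le]; norm_num
  have e1 : ((∑' z, gN μ σ z : ℝ) : ℂ) = 1 / (a:ℂ)^(1/2 : ℂ) * ∑' n : ℤ, Complex.exp (-Real.pi / a * (n + Complex.I * (Complex.I * μ))^2) := by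
    rw [ea, ← tsum_mul_left, Complex.ofReal_tsum]
    congr 1; funext z
    unfold gN stdNormal
    push_cast
    have : -(Real.pi : ℂ) / a * (z + Complex.I * (Complex.I * μ))^2 = -((((z:ℂ) - μ)/σ)^2)/2 := by
      rw [← mul_assoc, Complex.I_mul_I, ha]
      push_cast
      have h1 : (Real.pi : ℂ) ≠ 0 := by exact_mod_cast hpi.ne'
      have h2 : (σ : ℂ) ≠ 0 := by exact_mod_cast hσ.ne'
      field_simp; ring
    rw [this]; ring
  rw [← H] at e1
  set f : ℤ → ℂ := fun n => Complex.exp (-Real.pi * a * n^2 + 2 * Real.pi * (Complex.I * μ) * n) with hf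
  have hfn : ∀ z : ℤ, ‖f z‖ = Real.exp (-(Real.pi * a * (z:ℝ)^2)) := by
    intro z
    rw [hf, Complex.norm_exp]
    congr 1
    have : (-Real.pi * a * (z:ℂ)^2 + 2 * Real.pi * (Complex.I * μ) * z) = ((-(Real.pi * a * (z:ℝ)^2) : ℝ) : ℂ) + ((2 * Real.pi * μ * z : ℝ) : ℂ) * Complex.I := by push_cast; ring
    rw [this, Complex.add_re, Complex.re_ofReal_mul, Complex.I_re, Complex.ofReal_re, mul_zero, add_zero]
  have hb : ∀ z : ℤ, ‖if z = 0 then 0 else f z‖ ≤ (1/σ^2) * (1 / (z:ℝ)^2) := by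
    intro z
    by_cases hz : z = 0
    · subst hz; simp
    · have hz' : (z:ℝ) ≠ 0 := by exact_mod_cast hz
      rw [if_neg hz, hfn]
      refine (exp_neg_le (by positivity)).trans ?_
      rw [← one_div_mul_one_div_rev, mul_comm]
      gcongr
      rw [ha]
      nlinarith [Real.pi_gt_three, sq_nonneg σ, mul_nonneg (sq_nonneg Real.pi) (sq_nonneg σ), mul_le_mul_of_nonneg_right (by nlinarith [Real.pi_gt_three] : (1:ℝ) ≤ Real.pi^2) (sq_nonneg σ)]
  have hs1 := (cZ_sum.mul_left (1/σ^2))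
  have hs2 : Summable fun z : ℤ => if z = 0 then 0 else f z := Summable.of_norm_bounded hs1 hb
  have hs3 : Summable f := by
    have := hs2.add (hasSum_ite_eq (0:ℤ) (f 0)).summable
    refine this.congr fun z => ?_
    by_cases hz : z = 0 <;> simp [hz]
  have e2 : ∑' z, f z = 1 + ∑' z, (if z = 0 then 0 else f z) := by
    rw [hs3.tsum_eq_add_tsum_ite 0]
    congr 1; simp [hf]
  have e3 : ((∑' z, gN μ σ z - 1 : ℝ) : ℂ) = ∑' z, (if z = 0 then 0 else f z) := by
    push_cast [e1]; rw [e2]; ring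
  rw [← Real.norm_eq_abs, ← Complex.norm_real, e3]
  refine (tsum_of_norm_bounded hs1.hasSum hb).trans (le_of_eq ?_)
  rw [tsum_mul_left, ← cZ]; ring

lemma l1_core {P : ℤ → ℝ} (hP : ∀ z, 0 ≤ P z) (hs : HasSum P 1) {μ σ D L : ℝ} (hσ : 1 ≤ σ) (hL : 0 ≤ L) (hD : ∀ z, |P z - gN μ σ z| ≤ D) :
    ∑' z, |P z - gN μ σ z| ≤ cZ / σ^2 + 2 * ((2 * L * σ + 1) * D + Real.exp (-(L^2/4)) * (2 * (1 + cZ))) := by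
  have hσ0 : 0 < σ := by linarith
  have hD0 : 0 ≤ D := (abs_nonneg _).trans (hD 0)
  have hg := gN_summable (μ := μ) hσ0
  set τ : ℝ := Real.sqrt 2 * σ with hτ
  have h2 : Real.sqrt 2 ^ 2 = 2 := Real.sq_sqrt (by norm_num)
  have hτ0 : 0 < τ := by positivity
  have hgt := gN_summable (μ := μ) hτ0
  set B : Finset ℤ := Finset.Icc ⌈μ - L * σ⌉ ⌊μ + L * σ⌋ with hB
  have hBc : (B.card : ℝ) ≤ 2 * L * σ + 1 := by
    rw [hB, Int.card_Icc]
    have h0 : 0 ≤ L * σ := by positivity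
    have : ((⌊μ + L * σ⌋ + 1 - ⌈μ - L * σ⌉).toNat : ℝ) = max ((⌊μ + L * σ⌋ + 1 - ⌈μ - L * σ⌉ : ℤ) : ℝ) 0 := by
      have := Int.toNat_eq_max (⌊μ + L * σ⌋ + 1 - ⌈μ - L * σ⌉)
      exact_mod_cast this
    rw [this]
    apply max_le
    · push_cast
      linarith [Int.floor_le (μ + L * σ), Int.le_ceil (μ - L * σ)]
    · linarith
  have key : ∀ z, |P z - gN μ σ z| ≤ (P z - gN μ σ z) + 2 * ((if z ∈ B then D else 0) + Real.exp (-(L^2/4)) * (Real.sqrt 2 * gN μ τ z)) := by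
    intro z
    have ht := gN_nonneg (μ := μ) hτ0 z
    have hgz := gN_nonneg (μ := μ) hσ0 z
    have h3 : 0 ≤ Real.exp (-(L^2/4)) * (Real.sqrt 2 * gN μ τ z) := by positivity
    by_cases hz : z ∈ B
    · rw [if_pos hz]
      have := hD z
      rcases abs_cases (P z - gN μ σ z) with h | h <;> linarith
    · rw [if_neg hz]
      have : gN μ σ z ≤ Real.exp (-(L^2/4)) * (Real.sqrt 2 * gN μ τ z) := by
        unfold gN stdNormal
        have hq : L^2 ≤ (((z:ℝ) - μ)/σ)^2 := by
          rw [hB, Finset.mem_Icc, not_and_or, not_le, not_le, Int.lt_ceil, Int.floor_lt] at hz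
          rw [div_pow, le_div_iff₀ (by positivity), ← mul_pow]
          have h0 : 0 ≤ L * σ := by positivity
          rcases hz with hz | hz
          · nlinarith
          · nlinarith
        have e : Real.exp (-(((z:ℝ) - μ)/σ)^2/2) ≤ Real.exp (-(L^2/4)) * Real.exp (-(((z:ℝ) - μ)/τ)^2/2) := by
          rw [← Real.exp_add]; apply Real.exp_le_exp.2
          have : (((z:ℝ) - μ)/τ)^2 = (((z:ℝ) - μ)/σ)^2 / 2 := by rw [hτ, div_pow, mul_pow, h2, div_pow]; field_simp
          rw [this]; linarith
        have hx : Real.sqrt 2 * ((Real.sqrt (2 * Real.pi))⁻¹ * Real.exp (-(((z:ℝ) - μ)/τ)^2/2) / τ) = (Real.sqrt (2 * Real.pi))⁻¹ * Real.exp (-(((z:ℝ) - μ)/τ)^2/2) / σ := by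
          rw [hτ]; field_simp
        rw [hx]
        calc _ ≤ (Real.sqrt (2 * Real.pi))⁻¹ * (Real.exp (-(L^2/4)) * Real.exp (-(((z:ℝ) - μ)/τ)^2/2)) / σ := by gcongr
          _ = _ := by ring
      have := hP z
      rcases abs_cases (P z - gN μ σ z) with h | h <;> linarith
  have hfin : HasSum (fun z => if z ∈ B then D else 0) (B.card * D) := by
    have := hasSum_sum_of_ne_finset_zero (L := .unconditional ℤ) (f := fun z => if z ∈ B then D else 0) (s := B) (fun z hz => if_neg hz)
    convert this using 1
    rw [Finset.sum_ite_mem]; simp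
  have hsum := (hs.sub hg.hasSum).add ((hfin.add ((hgt.hasSum.mul_left (Real.sqrt 2)).mul_left (Real.exp (-(L^2/4))))).mul_left 2)
  refine (Summable.tsum_le_tsum key (Summable.of_nonneg_of_le (fun _ => abs_nonneg _) key hsum.summable) hsum.summable).trans ?_
  rw [hsum.tsum_eq]
  have g1 := gN_tsum (μ := μ) hσ0
  have g2 := gN_tsum (μ := μ) hτ0
  rw [abs_le] at g1 g2
  have hZ := cZ_nonneg
  have c1 : cZ / τ^2 ≤ cZ := div_le_self hZ (by rw [hτ, mul_pow, h2]; nlinarith)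
  have c2 : Real.sqrt 2 * ∑' z, gN μ τ z ≤ 2 * (1 + cZ) := by
    have : Real.sqrt 2 ≤ 2 := by rw [Real.sqrt_le_left (by norm_num)]; norm_num
    have h0 : 0 ≤ ∑' z, gN μ τ z := tsum_nonneg fun z => gN_nonneg hτ0 z
    have : ∑' z, gN μ τ z ≤ 1 + cZ := by linarith
    gcongr
  have : (B.card : ℝ) * D ≤ (2 * L * σ + 1) * D := by gcongr
  have := mul_le_mul_of_nonneg_left c2 (Real.exp_pos (-(L^2/4))).le
  linarith
end L1

section Inv
variable {G : Type*} [Fintype G] [DecidableEq G] {m : ℕ}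

lemma int_exp (j : ℤ) : ∫ θ in (-Real.pi)..Real.pi, Complex.exp ((θ * (j:ℝ) : ℝ) * Complex.I) = if j = 0 then ((2 * Real.pi : ℝ) : ℂ) else 0 := by
  split_ifs with h
  · subst h; simp; ring
  · have hj : (j : ℂ) * Complex.I ≠ 0 := mul_ne_zero (by exact_mod_cast h) Complex.I_ne_zero
    have := integral_exp_mul_complex (a := -Real.pi) (b := Real.pi) hj
    have e : ∀ θ : ℝ, Complex.exp ((θ * (j:ℝ) : ℝ) * Complex.I) = Complex.exp ((j : ℂ) * Complex.I * θ) := by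
      intro θ; congr 1; push_cast; ring
    simp only [e]
    rw [this, div_eq_zero_iff]
    left
    rw [sub_eq_zero, Complex.exp_eq_exp_iff_exists_int]
    exact ⟨j, by push_cast; ring⟩

lemma gf_cont (f : (G → Bool) → ℝ) : Continuous fun θ => Esl m (gf f θ) := by
  unfold Esl gf; fun_prop

lemma inv_P (f : (G → Bool) → ℤ) (z : ℤ) :
    ∫ θ in (-Real.pi)..Real.pi, Esl m (gf (fun x => (f x : ℝ) - z) θ) = ((2 * Real.pi * Esl m (fun x => if f x = z then (1:ℝ) else 0) : ℝ) : ℂ) := by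
  simp only [Esl]
  rw [intervalIntegral.integral_smul, intervalIntegral.integral_finsetSum (fun x _ => by
    apply Continuous.intervalIntegrable; unfold gf; fun_prop)]
  have : ∀ x, ∫ θ in (-Real.pi)..Real.pi, gf (fun x => (f x : ℝ) - z) θ x = ((2 * Real.pi * (if f x = z then 1 else 0) : ℝ) : ℂ) := by
    intro x
    have := int_exp (f x - z)
    push_cast at this
    simp only [gf]
    push_cast
    rw [this]
    by_cases h : f x = z
    · simp [h]
    · simp [h, sub_eq_zero]
  simp only [this]
  rw [← Complex.ofReal_sum, ← Finset.mul_sum, Complex.real_smul, smul_eq_mul, ← Complex.ofReal_mul]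
  congr 1; ring

lemma gauss_inv {μ σ : ℝ} (hσ : 0 < σ) (z : ℤ) :
    ∫ θ : ℝ, Complex.exp (Complex.I * ((μ - z : ℝ) : ℂ) * θ) * Complex.exp (-((σ^2/2 : ℝ) : ℂ) * θ^2) = ((2 * Real.pi * gN μ σ z : ℝ) : ℂ) := by
  have hpi := Real.pi_pos
  rw [fourierIntegral_gaussian (by rw [Complex.ofReal_re]; positivity)]
  have e1 : ((Real.pi : ℂ) / ((σ^2/2 : ℝ) : ℂ)) ^ (1/2 : ℂ) = ((Real.sqrt (2 * Real.pi) / σ : ℝ) : ℂ) := by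
    have : Real.sqrt (2 * Real.pi) / σ = (Real.pi / (σ^2/2)) ^ (1/2 : ℝ) := by
      rw [← Real.sqrt_eq_rpow, show Real.pi / (σ^2/2) = (2 * Real.pi) / σ^2 by field_simp, Real.sqrt_div (by positivity), Real.sqrt_sq hσ.le]
    rw [this, Complex.ofReal_cpow (by positivity)]; norm_num
  have e2 : Complex.exp (-((μ - z : ℝ) : ℂ)^2 / (4 * ((σ^2/2 : ℝ) : ℂ))) = ((Real.exp (-(((z:ℝ) - μ)/σ)^2/2) : ℝ) : ℂ) := by
    rw [Complex.ofReal_exp]; congr 1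
    have h2 : (σ : ℂ) ≠ 0 := by exact_mod_cast hσ.ne'
    push_cast; field_simp; ring
  rw [e1, e2, ← Complex.ofReal_mul]
  congr 1
  unfold gN stdNormal
  have h3 : Real.sqrt (2 * Real.pi) ^ 2 = 2 * Real.pi := Real.sq_sqrt (by positivity)
  have : Real.sqrt (2 * Real.pi) ≠ 0 := by positivity
  field_simp
  exact h3

lemma inv_core (f : (G → Bool) → ℤ) {μ σ a B1 B2 : ℝ} (hσ : 0 < σ) (ha : 0 < a) (haπ : a ≤ Real.pi) (hB1 : 0 ≤ B1) (hB2 : 0 ≤ B2)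
    (h1 : ∀ θ, |θ| ≤ a → ‖Esl m (gf (fun x => (f x : ℝ) - μ) θ) - (Real.exp (-(σ^2 * θ^2 / 2)) : ℂ)‖ ≤ B1)
    (h2 : ∀ θ, a ≤ |θ| → |θ| ≤ Real.pi → ‖Esl m (gf (fun x => (f x : ℝ)) θ)‖ ≤ B2) (z : ℤ) :
    2 * Real.pi * |Esl m (fun x => if f x = z then (1:ℝ) else 0) - gN μ σ z| ≤ 2 * a * B1 + 2 * Real.pi * B2 + Real.exp (-(σ^2 * a^2 / 4)) * (4 / σ) := by
  have hpi := Real.pi_pos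
  set Gz : ℝ → ℂ := fun θ => Complex.exp (Complex.I * ((μ - z : ℝ) : ℂ) * θ) * Complex.exp (-((σ^2/2 : ℝ) : ℂ) * θ^2) with hGz
  set ψ : ℝ → ℂ := fun θ => Esl m (gf (fun x => (f x : ℝ) - z) θ) with hψ
  have hψc : Continuous ψ := gf_cont _
  have hGe : ∀ θ : ℝ, Gz θ = Complex.exp ((θ * (μ - z) : ℝ) * Complex.I) * (Real.exp (-(σ^2 * θ^2 / 2)) : ℂ) := by
    intro θ; simp only [hGz]; rw [Complex.ofReal_exp]; congr 2 <;> push_cast <;> ring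
  have hGn : ∀ θ : ℝ, ‖Gz θ‖ = Real.exp (-(σ^2 * θ^2 / 2)) := by
    intro θ; rw [hGe, norm_mul, Complex.norm_exp_ofReal_mul_I, one_mul, Complex.norm_real, Real.norm_of_nonneg (Real.exp_pos _).le]
  have hGi : Integrable Gz := by
    refine Integrable.mono' (integrable_exp_neg_mul_sq (b := σ^2/2) (by positivity)) (by apply Continuous.aestronglyMeasurable; simp only [hGz]; fun_prop) (ae_of_all _ fun θ => ?_)
    rw [hGn]; apply le_of_eq; congr 1; ring
  set Ψ : ℝ → ℂ := (Set.Ioc (-Real.pi) Real.pi).indicator ψ with hΨ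
  have hΨi : Integrable Ψ := by
    rw [hΨ, integrable_indicator_iff measurableSet_Ioc]
    exact (hψc.integrableOn_Icc).mono_set Set.Ioc_subset_Icc_self
  have eP : ∫ θ, Ψ θ = ((2 * Real.pi * Esl m (fun x => if f x = z then (1:ℝ) else 0) : ℝ) : ℂ) := by
    rw [hΨ, integral_indicator measurableSet_Ioc, ← intervalIntegral.integral_of_le (by linarith), hψ, inv_P]
  set E := Real.exp (-(σ^2 * a^2 / 4)) with hE
  set bd : ℝ → ℝ := fun θ => ((Set.Icc (-a) a).indicator (fun _ => B1) θ + (Set.Icc (-Real.pi) Real.pi).indicator (fun _ => B2) θ) + E * Real.exp (-(σ^2/4) * θ^2) with hbd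
  have i1 : Integrable ((Set.Icc (-a) a).indicator (fun _ => B1) : ℝ → ℝ) := by
    rw [integrable_indicator_iff measurableSet_Icc]; exact continuous_const.integrableOn_Icc
  have i2 : Integrable ((Set.Icc (-Real.pi) Real.pi).indicator (fun _ => B2) : ℝ → ℝ) := by
    rw [integrable_indicator_iff measurableSet_Icc]; exact continuous_const.integrableOn_Icc
  have i3 : Integrable fun θ : ℝ => E * Real.exp (-(σ^2/4) * θ^2) := (integrable_exp_neg_mul_sq (by positivity)).const_mul E
  have hbi : Integrable bd := (i1.add i2).add i3
  have ebd : ∫ θ, bd θ = 2 * a * B1 + 2 * Real.pi * B2 + E * Real.sqrt (Real.pi / (σ^2/4)) := by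
    simp only [hbd]
    rw [integral_add (by exact i1.add i2) i3, integral_add i1 i2, integral_indicator measurableSet_Icc, integral_indicator measurableSet_Icc, integral_const_mul, integral_gaussian]
    simp [Real.volume_real_Icc_of_le, ha.le, hpi.le]
    ring
  have pw : ∀ θ, ‖Ψ θ - Gz θ‖ ≤ bd θ := by
    intro θ
    have hE0 : 0 < E := Real.exp_pos _
    have n3 : 0 ≤ E * Real.exp (-(σ^2/4) * θ^2) := by positivity
    have n2 : 0 ≤ (Set.Icc (-Real.pi) Real.pi).indicator (fun _ => B2) θ := Set.indicator_nonneg (fun _ _ => hB2) _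
    have n1 : 0 ≤ (Set.Icc (-a) a).indicator (fun _ => B1) θ := Set.indicator_nonneg (fun _ _ => hB1) _
    have fac : ∀ c : ℝ, ψ θ = Complex.exp ((θ * (c - z) : ℝ) * Complex.I) * Esl m (gf (fun x => (f x : ℝ) - c) θ) := by
      intro c
      rw [← Esl_mul]; simp only [hψ]; congr 1; funext x
      simp only [gf]; rw [← Complex.exp_add]; congr 1; push_cast; ring
    have tail : a ≤ |θ| → ‖Gz θ‖ ≤ E * Real.exp (-(σ^2/4) * θ^2) := by
      intro h
      rw [hGn, hE, ← Real.exp_add]; apply Real.exp_le_exp.2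
      have : a^2 ≤ θ^2 := by rw [← sq_abs θ]; gcongr
      have := mul_le_mul_of_nonneg_left this (sq_nonneg σ)
      linarith
    simp only [hbd]
    rcases lt_or_ge |θ| a with h | h
    · have hlt := abs_lt.1 h
      have m1 : θ ∈ Set.Icc (-a) a := ⟨hlt.1.le, hlt.2.le⟩
      have m2 : θ ∈ Set.Ioc (-Real.pi) Real.pi := ⟨by linarith, by linarith⟩
      have : ‖Ψ θ - Gz θ‖ ≤ B1 := by
        rw [hΨ, Set.indicator_of_mem m2, fac μ, hGe, ← mul_sub, norm_mul, Complex.norm_exp_ofReal_mul_I, one_mul]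
        exact h1 θ h.le
      rw [Set.indicator_of_mem m1]; linarith
    · have t := tail h
      by_cases m2 : θ ∈ Set.Ioc (-Real.pi) Real.pi
      · have hθ : |θ| ≤ Real.pi := abs_le.2 ⟨m2.1.le, m2.2⟩
        have : ‖Ψ θ‖ ≤ B2 := by
          rw [hΨ, Set.indicator_of_mem m2, fac 0, norm_mul, Complex.norm_exp_ofReal_mul_I, one_mul]
          simpa using h2 θ h hθ
        rw [Set.indicator_of_mem (Set.Ioc_subset_Icc_self m2)]
        have := norm_sub_le (Ψ θ) (Gz θ)
        linarith
      · have : Ψ θ = 0 := by rw [hΨ, Set.indicator_of_notMem m2]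
        rw [this, zero_sub, norm_neg]; linarith
  have fin := norm_integral_le_of_norm_le hbi (ae_of_all _ pw)
  rw [integral_sub hΨi hGi, eP, hGz, gauss_inv hσ z, ← Complex.ofReal_sub, Complex.norm_real, Real.norm_eq_abs, ebd, ← mul_sub, abs_mul, abs_of_pos (by positivity : (0:ℝ) < 2 * Real.pi)] at fin
  refine fin.trans ?_
  have : Real.sqrt (Real.pi / (σ^2/4)) ≤ 4 / σ := by
    rw [Real.sqrt_le_left (by positivity), div_pow, show Real.pi / (σ^2/4) = (4 * Real.pi) / σ^2 by field_simp]
    gcongr; linarith [Real.pi_le_four]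
  have := mul_le_mul_of_nonneg_left this (Real.exp_pos (-(σ^2 * a^2 / 4))).le
  linarith

end Inv

section Fin1
/-- constant -/
def cF (r : ℕ) : ℕ := cL (r+1) (KK r) + (2 * cR (r+1) (KK r) + 1) + cV (r+1) (KK r)

lemma exp_neg_sub {u v : ℝ} (hu : 0 ≤ u) (hv : 0 ≤ v) : |Real.exp (-u) - Real.exp (-v)| ≤ |u - v| := by
  have key : ∀ u v : ℝ, 0 ≤ u → u ≤ v → |Real.exp (-u) - Real.exp (-v)| ≤ |u - v| := by
    intro u v hu huv
    have h1 : Real.exp (-v) ≤ Real.exp (-u) := Real.exp_le_exp.2 (by linarith)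
    rw [abs_of_nonneg (by linarith), abs_of_nonpos (by linarith)]
    have h2 : Real.exp (-v) = Real.exp (-u) * Real.exp (-(v-u)) := by rw [← Real.exp_add]; congr 1; ring
    have h3 : Real.exp (-u) ≤ 1 := Real.exp_le_one_iff.2 (by linarith)
    have h4 := Real.add_one_le_exp (-(v-u))
    have h5 := Real.exp_pos (-u)
    rw [h2]; nlinarith
  rcases le_total u v with h | h
  · exact key u v hu h
  · rw [abs_sub_comm, abs_sub_comm u v]; exact key v u hv h

lemma LF_X {n r m : ℕ} [NeZero n] {p q : ℝ} (hodd : Odd n) (hcop : ∀ j, 1 ≤ j → j ≤ r → Nat.Coprime j n) (sl : SL (ZMod n) m p q)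
    (hv : 0 ≤ vv p q (SK n r) (yK n r p)) {μ V : ℝ} (hμ : μ = Esl m (pX (ptAP n r))) (hV : V = Esl m (fun x => (pX (ptAP n r) x - μ)^2)) :
    |V - vv p q (SK n r) (yK n r p)| ≤ cV (r+1) (KK r) * q^7 ∧
    ∀ θ : ℝ, ‖Esl m (gf (fun x => pX (ptAP n r) x - μ) θ) - (Real.exp (-(V * θ^2/2)) : ℂ)‖ ≤ cF r * (|θ| * q^3 + |θ|^2 * q^7 + |θ|^4 * q^14) := by
  have hG := HG_AP (n := n) (r := r) hcop
  have hp := sl.p01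
  have hq := sl.q0
  have hy : ∀ e, |yK n r p e| ≤ 1 := fun e => by
    have h0 : 0 ≤ yK n r p e := pow_nonneg hp.1 _
    rw [abs_of_nonneg h0]; exact pow_le_one₀ hp.1 hp.2
  obtain ⟨κ, hκ⟩ := X_expand (r := r) (m := m) (p := p) hodd hcop (by rw [sl.hp, ZMod.card])
  set v := vv p q (SK n r) (yK n r p) with hvd
  set Y := Yp p (SK n r) (yK n r p) with hY
  set EY := Esl m Y with hEY
  have hμ2 : μ = κ + EY := by
    rw [hμ, Esl_congr (g := fun x => κ + Y x) hκ, Esl_add, Esl_const sl.m1.le]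
  have hV2 : V = Esl m (fun x => (Y x - EY)^2) := by
    rw [hV]; refine Esl_congr fun x hx => ?_
    rw [hκ x hx, hμ2]; ring
  have hvar : |V - v| ≤ cV (r+1) (KK r) * q^7 := by rw [hV2]; exact Y_var sl hG hy
  have hV0 : 0 ≤ V := by
    rw [hV]
    have := Esl_mono (m := m) (f := fun _ => 0) (g := fun x => (pX (ptAP n r) x - μ)^2) (fun x _ => sq_nonneg _)
    rwa [Esl_const sl.m1.le] at this
  refine ⟨hvar, fun θ => ?_⟩
  have e1 : Esl m (gf (fun x => pX (ptAP n r) x - μ) θ) = Complex.exp ((θ * (-EY) : ℝ) * Complex.I) * Esl m (gf Y θ) := by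
    rw [← Esl_mul]
    refine Esl_congr fun x hx => ?_
    simp only [gf]; rw [← Complex.exp_add, hκ x hx, hμ2]; congr 1; push_cast; ring
  have hphi := LF_phi sl hG hy hv θ
  rw [← hY, ← hvd] at hphi
  have hmean := Y_mean sl hG hy
  rw [← hY, ← hEY] at hmean
  have hn1 : ‖Esl m (gf Y θ)‖ ≤ 1 := by
    refine (Esl_norm_le m _).trans ?_
    simp only [gf_norm]; rw [Esl_const sl.m1.le]
  have b1 : ‖Complex.exp ((θ * (-EY) : ℝ) * Complex.I) - 1‖ ≤ |θ| * ((2 * cR (r+1) (KK r) + 1) * q^3) := by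
    have := Real.norm_exp_I_mul_ofReal_sub_one_le (x := θ * (-EY))
    rw [mul_comm Complex.I] at this
    refine this.trans ?_
    rw [Real.norm_eq_abs, abs_mul, abs_neg]; gcongr
  have b3 : ‖(Real.exp (-(v * θ^2/2)) : ℂ) - (Real.exp (-(V * θ^2/2)) : ℂ)‖ ≤ cV (r+1) (KK r) * q^7 * |θ|^2 := by
    rw [← Complex.ofReal_sub, Complex.norm_real, Real.norm_eq_abs]
    refine (exp_neg_sub (by positivity) (by positivity)).trans ?_
    rw [show v * θ^2/2 - V * θ^2/2 = -((V - v) * (θ^2/2)) by ring, abs_neg, abs_mul, abs_of_nonneg (by positivity : 0 ≤ θ^2/2), ← sq_abs θ]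
    have : |θ|^2/2 ≤ |θ|^2 := by have := sq_nonneg |θ|; linarith
    gcongr
  rw [e1]
  calc _ = ‖(Complex.exp ((θ * (-EY) : ℝ) * Complex.I) - 1) * Esl m (gf Y θ) + ((Esl m (gf Y θ) - (Real.exp (-(v * θ^2/2)) : ℂ)) + ((Real.exp (-(v * θ^2/2)) : ℂ) - (Real.exp (-(V * θ^2/2)) : ℂ)))‖ := by congr 1; ring
    _ ≤ |θ| * ((2 * cR (r+1) (KK r) + 1) * q^3) * 1 + (cL (r+1) (KK r) * (|θ| * (q ^ 3 + |θ| * q ^ 7 + |θ| ^ 3 * q ^ 14)) + cV (r+1) (KK r) * q^7 * |θ|^2) := by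
      refine (norm_add_le _ _).trans (add_le_add ?_ ((norm_add_le _ _).trans (add_le_add hphi b3)))
      rw [norm_mul]; gcongr
    _ ≤ _ := by
      simp only [cF]; push_cast
      have x1 : 0 ≤ |θ| * q^3 := by positivity
      have x2 : 0 ≤ |θ|^2 * q^7 := by positivity
      have x3 : 0 ≤ |θ|^4 * q^14 := by positivity
      have y1 : (0:ℝ) ≤ cL (r+1) (KK r) := Nat.cast_nonneg _
      have y2 : (0:ℝ) ≤ cR (r+1) (KK r) := Nat.cast_nonneg _
      have y3 : (0:ℝ) ≤ cV (r+1) (KK r) := Nat.cast_nonneg _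
      nlinarith [mul_nonneg y2 x2, mul_nonneg y2 x3, mul_nonneg y3 x1, mul_nonneg y3 x3]

lemma exp_small {b s : ℝ} (hb : 0 < b) (hs : 0 < s) : ∀ᶠ n : ℕ in Filter.atTop, Real.exp (-(b * ((n:ℝ)^s)^2)) ≤ 1 / n := by
  obtain ⟨M, hM⟩ := exists_nat_gt (1/s)
  have hx : Filter.Tendsto (fun n : ℕ => (n:ℝ)^s) Filter.atTop Filter.atTop :=
    (tendsto_rpow_atTop hs).comp tendsto_natCast_atTop_atTop
  have t0 := ((Real.tendsto_pow_mul_exp_neg_atTop_nhds_zero M).comp ((Filter.tendsto_const_mul_atTop_of_pos hb).2 hx)).const_mul ((b^M)⁻¹)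
  rw [mul_zero] at t0
  filter_upwards [t0.eventually_le_const one_pos, Filter.eventually_ge_atTop 1] with n hn hn1
  have hn0 : (1:ℝ) ≤ n := by exact_mod_cast hn1
  have h1 : 1 ≤ (n:ℝ)^s := Real.one_le_rpow hn0 hs.le
  simp only [Function.comp, mul_pow] at hn
  have hnx : (n:ℝ) ≤ ((n:ℝ)^s) ^ M := by
    rw [← Real.rpow_natCast, ← Real.rpow_mul (by linarith)]
    conv_lhs => rw [← Real.rpow_one (n:ℝ)]
    refine Real.rpow_le_rpow_of_exponent_le hn0 ?_
    rw [div_lt_iff₀ hs] at hM; linarith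
  rw [le_div_iff₀ (by linarith), mul_comm]
  calc (n:ℝ) * Real.exp (-(b * ((n:ℝ)^s)^2)) ≤ ((n:ℝ)^s) ^ M * Real.exp (-(b * (n:ℝ)^s)) := by
        gcongr; nlinarith
    _ ≤ 1 := by
      refine le_trans (le_of_eq ?_) hn
      field_simp

lemma P_hasSum {G : Type*} [Fintype G] [DecidableEq G] {m : ℕ} (hm : m ≤ Fintype.card G) (f : (G → Bool) → ℤ) :
    HasSum (fun z => Esl m (fun x => if f x = z then (1:ℝ) else 0)) 1 := by
  have h2 : HasSum (fun z => Esl m (fun x => if f x = z then (1:ℝ) else 0)) (Esl (G := G) m (fun _ => (1:ℝ))) := by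
    simp only [Esl, smul_eq_mul]
    refine HasSum.mul_left _ (hasSum_sum fun x _ => ?_)
    have := hasSum_ite_eq (f x) (1:ℝ)
    simpa only [eq_comm] using this
  rwa [Esl_const hm] at h2
end Fin1

section Fin2
lemma num_pt {q w σ C' cf E T B1 : ℝ} (hq : 1 ≤ q) (hw : 1 ≤ w) (hσ : 0 < σ) (hC : 0 ≤ C') (hσ1 : σ ≤ C' * q^4) (hcf : 0 ≤ cf)
    (hE0 : 0 ≤ E) (hE : E ≤ 1 / q^4) (hB : B1 = 3 * cf * (w^4/q))
    (hT : 2 * Real.pi * T ≤ 2 * (w/q^4) * B1 + 2 * Real.pi * (1/(q^4)^2) + E * (4/σ)) :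
    σ * T ≤ (3 * C' * cf + C' + 1) * (w^5/q) := by
  have hpi := Real.pi_gt_three
  have hq0 : 0 < q := by linarith
  have hw0 : 0 < w := by linarith
  have e1 : 1/q^4 ≤ w^5/q := by
    have h1 : 1 ≤ w^5 := one_le_pow₀ hw
    have h2 : q ≤ q^4 := by
      calc q = q^1 := (pow_one q).symm
        _ ≤ q^4 := pow_le_pow_right₀ hq (by norm_num)
    gcongr
  have x0 : 0 ≤ w^5/q := by positivity
  have a1 : σ * (2 * (w/q^4) * B1) ≤ 2 * Real.pi * (3 * C' * cf * (w^5/q)) := by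
    calc σ * (2 * (w/q^4) * B1) ≤ (C' * q^4) * (2 * (w/q^4) * B1) := by
          rw [hB]; gcongr
      _ = 2 * (3 * C' * cf * (w^5/q)) := by rw [hB]; field_simp
      _ ≤ _ := by
        have : 0 ≤ 3 * C' * cf * (w^5/q) := by positivity
        nlinarith
  have a2 : σ * (2 * Real.pi * (1/(q^4)^2)) ≤ 2 * Real.pi * (C' * (w^5/q)) := by
    calc σ * (2 * Real.pi * (1/(q^4)^2)) ≤ (C' * q^4) * (2 * Real.pi * (1/(q^4)^2)) := by gcongr
      _ = 2 * Real.pi * (C' * (1/q^4)) := by field_simp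
      _ ≤ _ := by gcongr
  have a3 : σ * (E * (4/σ)) ≤ 2 * Real.pi * (w^5/q) := by
    have : σ * (E * (4/σ)) = 4 * E := by field_simp
    rw [this]; nlinarith
  have := mul_le_mul_of_nonneg_left hT hσ.le
  have h2 : (2 * Real.pi) * (σ * T) ≤ (2 * Real.pi) * ((3 * C' * cf + C' + 1) * (w^5/q)) := by nlinarith
  exact le_of_mul_le_mul_left h2 (by linarith)

lemma num_l1 {q w σ c' C2 E T : ℝ} (hq : 1 ≤ q) (hw : 1 ≤ w) (hc : 0 < c') (hσ1 : 1 ≤ σ) (hσ : c' * q^4 ≤ σ) (hC2 : 0 ≤ C2)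
    (hE : E ≤ 1/q^4)
    (hT : T ≤ cZ / σ^2 + 2 * ((2 * w * σ + 1) * (C2 * (w^5/q) / σ) + E * (2 * (1 + cZ)))) :
    T ≤ (cZ / c'^2 + 6 * C2 + 4 * (1 + cZ)) * (w^6/q) := by
  have hq0 : 0 < q := by linarith
  have hw0 : 0 < w := by linarith
  have hz := cZ_nonneg
  have hσ0 : 0 < σ := by linarith
  have e1 : 1/q^4 ≤ w^6/q := by
    have h1 : 1 ≤ w^6 := one_le_pow₀ hw
    have h2 : q ≤ q^4 := by
      calc q = q^1 := (pow_one q).symm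
        _ ≤ q^4 := pow_le_pow_right₀ hq (by norm_num)
    gcongr
  have e2 : 1/(q^4)^2 ≤ 1/q^4 := by
    have h2 : 1 ≤ q^4 := one_le_pow₀ hq
    gcongr; nlinarith
  have a1 : cZ / σ^2 ≤ cZ / c'^2 * (w^6/q) := by
    calc cZ / σ^2 ≤ cZ / (c' * q^4)^2 := by gcongr
      _ = cZ / c'^2 * (1/(q^4)^2) := by field_simp
      _ ≤ _ := mul_le_mul_of_nonneg_left (e2.trans e1) (by positivity)
  have a2 : (2 * w * σ + 1) * (C2 * (w^5/q) / σ) ≤ 3 * C2 * (w^6/q) := by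
    have : 2 * w * σ + 1 ≤ 3 * w * σ := by nlinarith
    calc _ ≤ (3 * w * σ) * (C2 * (w^5/q) / σ) := by gcongr
      _ = _ := by field_simp
  have a3 : E * (2 * (1 + cZ)) ≤ (w^6/q) * (2 * (1+cZ)) := by gcongr; exact hE.trans e1
  linarith

lemma num_phi {q w t cf : ℝ} (hq1 : 1 ≤ q) (hw1 : 1 ≤ w) (hcf : 0 ≤ cf) (ht0 : 0 ≤ t) (ht : t ≤ w / q^4) :
    cf * (t * q^3 + t^2 * q^7 + t^4 * q^14) ≤ 3 * cf * (w^4/q) := by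
  have hq0 : 0 < q := by linarith
  have hw0 : 0 < w := by linarith
  have y1 : t * q^3 ≤ w^4/q := by
    calc t * q^3 ≤ (w/q^4) * q^3 := by gcongr
      _ = w^1/q := by field_simp
      _ ≤ _ := by gcongr <;> first | exact hw1 | norm_num
  have y2 : t^2 * q^7 ≤ w^4/q := by
    calc t^2 * q^7 ≤ (w/q^4)^2 * q^7 := by gcongr
      _ = w^2/q := by field_simp
      _ ≤ _ := by gcongr <;> first | exact hw1 | norm_num
  have y3 : t^4 * q^14 ≤ w^4/q := by
    calc t^4 * q^14 ≤ (w/q^4)^4 * q^14 := by gcongr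
      _ = w^4/q^2 := by field_simp
      _ ≤ _ := by gcongr; nlinarith
  calc cf * (t * q^3 + t^2 * q^7 + t^4 * q^14) ≤ cf * (w^4/q + w^4/q + w^4/q) := by gcongr
    _ = _ := by ring

lemma num_E {q w σ c' : ℝ} (hq1 : 1 ≤ q) (hw1 : 1 ≤ w) (hc : 0 < c') (hσl : c' * q^4 ≤ σ) :
    -(σ^2 * (w/q^4)^2 / 4) ≤ -(c'^2/4 * w^2) := by
  have hq0 : 0 < q := by linarith
  have hw0 : 0 < w := by linarith
  have : c' * w ≤ σ * (w/q^4) := by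
    calc c' * w = (c' * q^4) * (w/q^4) := by field_simp
      _ ≤ _ := by gcongr
  have h3 : (c' * w)^2 ≤ (σ * (w/q^4))^2 := by gcongr
  rw [mul_pow, mul_pow] at h3
  linarith

lemma num_sig {q c CV K v V σ : ℝ} (hq1 : 1 ≤ q) (hc : 0 < c) (hCV0 : 0 ≤ CV) (hq2 : 2 * CV / c ≤ q) (hv1 : c * q^8 ≤ v) (hv2 : v ≤ K * q^8)
    (hvar : |V - v| ≤ CV * q^7) (hσd : σ = Real.sqrt V) :
    0 ≤ V ∧ Real.sqrt (c/2) * q^4 ≤ σ ∧ σ ≤ Real.sqrt (K + CV) * q^4 := by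
  have hq0 : 0 < q := by linarith
  rw [abs_le] at hvar
  have hq78 : CV * q^7 ≤ (c/2) * q^8 := by
    rw [div_le_iff₀ hc] at hq2
    have : 0 ≤ q^7 := by positivity
    have h8 := mul_le_mul_of_nonneg_right hq2 this
    have h9 : q * c * q^7 = c * q^8 := by ring
    linarith
  have hVl : (c/2) * q^8 ≤ V := by linarith
  have hVu : V ≤ (K + CV) * q^8 := by
    have : q^7 ≤ q^8 := pow_le_pow_right₀ hq1 (by norm_num)
    have h8 := mul_le_mul_of_nonneg_left this hCV0
    have h9 : (K + CV) * q^8 = K * q^8 + CV * q^8 := by ring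
    linarith
  have hV0 : 0 ≤ V := le_trans (by positivity) hVl
  have hK : 0 ≤ K := by
    have := hv1.trans hv2
    have := le_of_mul_le_mul_right this (by positivity)
    linarith
  have hsq8 : Real.sqrt (q^8) = q^4 := by
    rw [show q^8 = (q^4)^2 by ring, Real.sqrt_sq (by positivity)]
  refine ⟨hV0, ?_, ?_⟩
  · rw [hσd, ← hsq8, ← Real.sqrt_mul (by positivity)]; exact Real.sqrt_le_sqrt hVl
  · rw [hσd, ← hsq8, ← Real.sqrt_mul (by positivity)]; exact Real.sqrt_le_sqrt hVu

set_option maxHeartbeats 400000 in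
lemma big_n {r : ℕ} (hr : 2 ≤ r) {s0 δ : ℝ} (hs0 : 0 < s0) (hs1 : s0 ≤ 1) (hδ : 0 < δ) (hδ1 : δ ≤ 1) : ∃ C > 0, ∀ᶠ n : ℕ in Filter.atTop, ∀ (m : ℕ) [NeZero n] (μ σ : ℝ),
    0 < m → m < n → s0 ≤ (m:ℝ)/n * (1 - (m:ℝ)/n) → Odd n → (∀ j, 1 ≤ j → j ≤ r → Nat.Coprime j n) →
    μ = Esl m (pX (ptAP n r)) → σ = Real.sqrt (Esl m (fun x => (pX (ptAP n r) x - μ)^2)) → ∀ f : (ZMod n → Bool) → ℤ, (∀ x, (f x : ℝ) = pX (ptAP n r) x) →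
    (∀ z : ℤ, |σ * Esl m (fun x => if f x = z then (1:ℝ) else 0) - stdNormal (((z:ℝ) - μ)/σ)| ≤ C * (((n:ℝ)^δ)^6 / (n:ℝ)^((1:ℝ)/4))) ∧
    ∑' z : ℤ, |Esl m (fun x => if f x = z then (1:ℝ) else 0) - stdNormal (((z:ℝ) - μ)/σ)/σ| ≤ C * (((n:ℝ)^δ)^6 / (n:ℝ)^((1:ℝ)/4)) := by
  obtain ⟨c, hc, N0, hvv⟩ := vv_bounds hr hs0
  set CV : ℝ := ((cV (r+1) (KK r) : ℕ) : ℝ) with hCV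
  have hCV0 : 0 ≤ CV := Nat.cast_nonneg _
  set c' := Real.sqrt (c/2) with hc'
  have hc'0 : 0 < c' := Real.sqrt_pos.2 (by linarith)
  set C' := Real.sqrt (2 * (KK r)^2 + CV) with hC'
  have hC'0 : 0 ≤ C' := Real.sqrt_nonneg _
  set cf : ℝ := ((cF r : ℕ) : ℝ) with hcf
  have hcf0 : 0 ≤ cf := Nat.cast_nonneg _
  set C2 := 3 * C' * cf + C' + 1 with hC2
  have hC20 : 0 < C2 := by positivity
  have hz := cZ_nonneg
  set C3 := cZ / c'^2 + 6 * C2 + 4 * (1 + cZ) with hC3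
  have hC30 : 0 < C3 := by positivity
  have hC23 : C2 ≤ C3 := by
    have : 0 ≤ cZ / c'^2 := by positivity
    rw [hC3]; linarith
  refine ⟨C3, hC30, ?_⟩
  have hx : Filter.Tendsto (fun n : ℕ => (n:ℝ)^((1:ℝ)/4)) Filter.atTop Filter.atTop :=
    (tendsto_rpow_atTop (by norm_num)).comp tendsto_natCast_atTop_atTop
  filter_upwards [HFz hr hs0 hs1 hδ, hx.eventually_ge_atTop (2 * CV / c), tendsto_natCast_atTop_atTop.eventually_ge_atTop (1/c'),
    exp_small (b := c'^2/4) (by positivity) hδ, exp_small (b := 1/4) (by norm_num) hδ, Filter.eventually_ge_atTop N0, Filter.eventually_ge_atTop 1]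
    with n hHF hq2 hn2 hE1 hE2 hN hn1
  intro m _ μ σ hm0 hm1 hps hodd hcop hμ hσd f hf
  have hn0 : (1:ℝ) ≤ n := by exact_mod_cast hn1
  have hnp : (0:ℝ) < n := by linarith
  set q := (n:ℝ)^((1:ℝ)/4) with hqd
  set w := (n:ℝ)^δ with hwd
  have hq1 : 1 ≤ q := Real.one_le_rpow hn0 (by norm_num)
  have hw1 : 1 ≤ w := Real.one_le_rpow hn0 hδ.le
  have hq0 : 0 < q := by linarith
  have hq4 : q^4 = n := by
    rw [hqd, ← Real.rpow_natCast, ← Real.rpow_mul hnp.le]; norm_num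
  have sl : SL (ZMod n) m ((m:ℝ)/n) q := ⟨hm0, by rwa [ZMod.card], by rw [ZMod.card], hq0, by rw [hq4, ZMod.card]⟩
  obtain ⟨hv1, hv2⟩ := hvv n m _ q hN sl hps hcop
  have hv0 : 0 ≤ vv ((m:ℝ)/n) q (SK n r) (yK n r ((m:ℝ)/n)) := le_trans (by positivity) hv1
  set V := Esl m (fun x => (pX (ptAP n r) x - μ)^2) with hV
  obtain ⟨hvar, hphi⟩ := LF_X hodd hcop sl hv0 hμ hV
  obtain ⟨hV0, hσl, hσu⟩ := num_sig hq1 hc hCV0 hq2 hv1 hv2 hvar hσd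
  rw [← hc'] at hσl
  rw [← hC'] at hσu
  clear hvv hvar hv1 hv2 hv0 hq2
  clear_value c' C' C3 V
  have hσ1 : 1 ≤ σ := by
    refine le_trans ?_ hσl
    rw [hq4]; rw [div_le_iff₀ hc'0] at hn2; linarith
  have hσ0 : 0 < σ := by linarith
  have hσ2 : σ^2 = V := by rw [hσd, Real.sq_sqrt hV0]
  have ha : (n:ℝ)^(-1+δ) = w / q^4 := by
    rw [hq4, Real.rpow_add hnp, Real.rpow_neg_one]; field_simp; rw [hwd]
  have ha1 : w / q^4 ≤ 1 := by
    rw [hq4, div_le_one hnp, hwd]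
    calc (n:ℝ)^δ ≤ (n:ℝ)^(1:ℝ) := Real.rpow_le_rpow_of_exponent_le hn0 hδ1
      _ = n := Real.rpow_one _
  have ha0 : 0 < w / q^4 := div_pos (by linarith) (pow_pos hq0 4)
  have hw0 : 0 < w := by linarith
  have hB10 : 0 ≤ 3 * cf * (w^4/q) := mul_nonneg (mul_nonneg (by norm_num) hcf0) (div_nonneg (pow_nonneg hw0.le 4) hq0.le)
  have hB20 : 0 ≤ 1/(q^4)^2 := one_div_nonneg.2 (sq_nonneg _)
  have h5q : 0 ≤ w^5/q := div_nonneg (pow_nonneg hw0.le 5) hq0.le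
  set a := w / q^4 with had
  set B1 := 3 * cf * (w^4/q) with hB1
  have hfe : (fun x => (f x : ℝ)) = pX (ptAP n r) := funext hf
  have h1 : ∀ θ, |θ| ≤ a → ‖Esl m (gf (fun x => (f x : ℝ) - μ) θ) - (Real.exp (-(σ^2 * θ^2 / 2)) : ℂ)‖ ≤ B1 := by
    intro θ hθ
    have h := hphi θ
    rw [hσ2]; simp only [hf]
    exact h.trans (num_phi hq1 hw1 hcf0 (abs_nonneg θ) hθ)
  have h2 : ∀ θ, a ≤ |θ| → |θ| ≤ Real.pi → ‖Esl m (gf (fun x => (f x : ℝ)) θ)‖ ≤ 1/(q^4)^2 := by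
    intro θ t1 t2
    rw [hfe, hq4]
    exact hHF m θ hm0 hm1 hps hcop (by rw [ha]; exact t1) t2
  have hEE : Real.exp (-(σ^2 * a^2 / 4)) ≤ 1/q^4 := by
    rw [hq4]
    refine le_trans (Real.exp_le_exp.2 ?_) hE1
    exact num_E hq1 hw1 hc'0 hσl
  have hpt : ∀ z : ℤ, σ * |Esl m (fun x => if f x = z then (1:ℝ) else 0) - gN μ σ z| ≤ C2 * (w^5/q) := by
    intro z
    have := inv_core f (μ := μ) hσ0 ha0 (ha1.trans (by linarith [Real.pi_gt_three])) hB10 hB20 h1 h2 z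
    exact num_pt hq1 hw1 hσ0 hC'0 hσu hcf0 (Real.exp_pos _).le hEE hB1 this
  refine ⟨fun z => ?_, ?_⟩
  · have e : σ * Esl m (fun x => if f x = z then (1:ℝ) else 0) - stdNormal (((z:ℝ) - μ)/σ) = σ * (Esl m (fun x => if f x = z then (1:ℝ) else 0) - gN μ σ z) := by
      rw [gN, mul_sub]; congr 1; field_simp
    rw [e, abs_mul, abs_of_pos hσ0]
    refine (hpt z).trans ?_
    have h56 : w^5 ≤ w^6 := pow_le_pow_right₀ hw1 (by norm_num)
    have h6q : w^5/q ≤ w^6/q := div_le_div_of_nonneg_right h56 hq0.le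
    have h5 : 0 ≤ w^5/q := h5q
    exact mul_le_mul hC23 h6q h5 hC30.le
  · have hP : ∀ z : ℤ, 0 ≤ Esl m (fun x => if f x = z then (1:ℝ) else 0) := by
      intro z
      have := Esl_mono (m := m) (f := fun _ => 0) (g := fun x => if f x = z then (1:ℝ) else 0) (fun x _ => by split_ifs <;> norm_num)
      rwa [Esl_const sl.m1.le] at this
    have hD : ∀ z : ℤ, |Esl m (fun x => if f x = z then (1:ℝ) else 0) - gN μ σ z| ≤ C2 * (w^5/q) / σ := by
      intro z; rw [le_div_iff₀ hσ0, mul_comm]; exact hpt z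
    have := l1_core hP (P_hasSum sl.m1.le f) hσ1 (by linarith : 0 ≤ w) hD
    rw [hC3]
    refine num_l1 hq1 hw1 hc'0 hσ1 hσl hC20.le ?_ this
    rw [hq4]
    refine le_trans (le_of_eq ?_) hE2
    congr 1; ring
end Fin2

section Fin3
lemma us_eq (n m : ℕ) [NeZero n] : uniformSubset n m = ((slc (ZMod n) m).card : ℝ≥0∞)⁻¹ • ∑ x ∈ slc (ZMod n) m, Measure.dirac x := by
  classical
  unfold uniformSubset finUniform
  congr 1
  · congr 2
    rw [Nat.card_eq_fintype_card, ← Set.toFinset_card]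
    congr 1; ext x; simp [mem_slc, cnt]
  · rw [slc, Finset.sum_filter]
    refine Finset.sum_congr rfl fun x _ => ?_
    by_cases h : cnt x = m
    · rw [if_pos h, Set.indicator_of_mem (by exact h), one_smul]
    · rw [if_neg h, Set.indicator_of_notMem (by exact h), zero_smul]

lemma us_int (n m : ℕ) [NeZero n] (X : (ZMod n → Bool) → ℝ) : ∫ x, X x ∂(uniformSubset n m) = Esl m X := by
  rw [us_eq, integral_smul_measure, integral_finsetSum_measure (fun i _ => Integrable.of_finite)]
  simp [Esl]

lemma us_prob (n m : ℕ) [NeZero n] (f : (ZMod n → Bool) → ℤ) (z : ℤ) :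
    (uniformSubset n m {x | f x = z}).toReal = Esl m (fun x => if f x = z then (1:ℝ) else 0) := by
  rw [us_eq]
  simp only [Measure.smul_apply, Measure.finsetSum_apply, smul_eq_mul, ENNReal.toReal_mul, Esl]
  rw [ENNReal.toReal_sum]
  · simp [Set.indicator, ENNReal.toReal_inv, apply_ite]
  · intro a _; simp [Set.indicator]; split_ifs <;> simp
end Fin3

theorem kAP_local_clt_slice
    (k : ℕ) (hk : 3 ≤ k) (lam ε : ℝ)
    (hlam : lam ∈ Set.Ioo (0 : ℝ) (1 / 2)) (hε : 0 < ε) :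
    ∃ C : ℝ, 0 < C ∧ ∀ (n : ℕ) [NeZero n], Nat.gcd n (Nat.factorial (k - 1)) = 1 →
      ∀ m : ℕ, (m : ℝ) / n ∈ Set.Ioo lam (1 - lam) →
      let μ := uniformSubset n m
      let X : (ZMod n → Bool) → ℝ := fun x => (kAPcount k x : ℝ)
      let μk := ∫ x, X x ∂μ
      let σk := Real.sqrt (∫ x, (X x - μk) ^ 2 ∂μ)
      (∀ z : ℤ, |σk * (μ {x | X x = (z : ℝ)}).toReal - stdNormal (((z : ℝ) - μk) / σk)|
          ≤ C * (n : ℝ) ^ (ε - 1 / 4)) ∧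
      (∑' z : ℤ, |(μ {x | X x = (z : ℝ)}).toReal - stdNormal (((z : ℝ) - μk) / σk) / σk|)
          ≤ C * (n : ℝ) ^ (ε - 1 / 4) := by
  obtain ⟨r, rfl⟩ : ∃ r, k = r + 1 := ⟨k - 1, by omega⟩
  have hr : 2 ≤ r := by omega
  obtain ⟨hl0, hl1⟩ := hlam
  have hs0 : 0 < lam * (1 - lam) := mul_pos hl0 (by linarith)
  have hs1 : lam * (1 - lam) ≤ 1 := by nlinarith
  set δ := min ε 1 / 6 with hδd
  have hδ : 0 < δ := by have := lt_min hε one_pos; positivity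
  have hδ1 : δ ≤ 1 := by have := min_le_right ε 1; rw [hδd]; linarith
  have hδε : δ * 6 ≤ ε := by have := min_le_left ε 1; rw [hδd]; linarith
  obtain ⟨C1, hC1, hbig⟩ := big_n hr hs0 hs1 hδ hδ1
  obtain ⟨N, hN⟩ := Filter.eventually_atTop.1 hbig
  -- small cases
  have hsmall : ∀ n m : ℕ, ∃ B : ℝ, 0 ≤ B ∧ ∀ [NeZero n], m ≤ n →
      (∀ z : ℤ, |Real.sqrt (∫ x, ((kAPcount (r+1) x : ℝ) - ∫ x, (kAPcount (r+1) x : ℝ) ∂(uniformSubset n m)) ^ 2 ∂(uniformSubset n m)) * (uniformSubset n m {x | (kAPcount (r+1) x : ℝ) = (z : ℝ)}).toReal - stdNormal (((z : ℝ) - ∫ x, (kAPcount (r+1) x : ℝ) ∂(uniformSubset n m)) / Real.sqrt (∫ x, ((kAPcount (r+1) x : ℝ) - ∫ x, (kAPcount (r+1) x : ℝ) ∂(uniformSubset n m)) ^ 2 ∂(uniformSubset n m)))|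
          ≤ B * (n : ℝ) ^ (ε - 1 / 4)) ∧
      (∑' z : ℤ, |(uniformSubset n m {x | (kAPcount (r+1) x : ℝ) = (z : ℝ)}).toReal - stdNormal (((z : ℝ) - ∫ x, (kAPcount (r+1) x : ℝ) ∂(uniformSubset n m)) / Real.sqrt (∫ x, ((kAPcount (r+1) x : ℝ) - ∫ x, (kAPcount (r+1) x : ℝ) ∂(uniformSubset n m)) ^ 2 ∂(uniformSubset n m))) / Real.sqrt (∫ x, ((kAPcount (r+1) x : ℝ) - ∫ x, (kAPcount (r+1) x : ℝ) ∂(uniformSubset n m)) ^ 2 ∂(uniformSubset n m))|)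
          ≤ B * (n : ℝ) ^ (ε - 1 / 4) := by
    intro n m
    by_cases h0 : n = 0
    · exact ⟨0, le_rfl, fun {h} _ => absurd h0 h.out⟩
    have : NeZero n := ⟨h0⟩
    set μk := ∫ x, (kAPcount (r+1) x : ℝ) ∂(uniformSubset n m) with hμk
    set σk := Real.sqrt (∫ x, ((kAPcount (r+1) x : ℝ) - μk) ^ 2 ∂(uniformSubset n m)) with hσk
    set S := ∑' z : ℤ, |(uniformSubset n m {x | (kAPcount (r+1) x : ℝ) = (z : ℝ)}).toReal - stdNormal (((z : ℝ) - μk) / σk) / σk| with hS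
    have hσ0 : 0 ≤ σk := Real.sqrt_nonneg _
    have hS0 : 0 ≤ S := tsum_nonneg fun z => abs_nonneg _
    have hnp : (0:ℝ) < n := by exact_mod_cast Nat.pos_of_ne_zero h0
    have hu : 0 < (n:ℝ) ^ (ε - 1/4) := Real.rpow_pos_of_pos hnp _
    refine ⟨(σk + 1 + S) / (n:ℝ) ^ (ε - 1/4), by positivity, fun {_} hm => ⟨fun z => ?_, ?_⟩⟩
    · rw [div_mul_cancel₀ _ hu.ne']
      have hP := us_prob n m (fun x => (kAPcount (r+1) x : ℤ)) z
      have hset : {x : ZMod n → Bool | (kAPcount (r+1) x : ℝ) = (z:ℝ)} = {x | ((kAPcount (r+1) x : ℕ) : ℤ) = z} := by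
        ext x; simp only [Set.mem_ofPred_eq]; rw [← Int.cast_inj (α := ℝ)]; simp
      have p0 : 0 ≤ (uniformSubset n m {x | (kAPcount (r+1) x : ℝ) = (z : ℝ)}).toReal := ENNReal.toReal_nonneg
      have p1 : (uniformSubset n m {x | (kAPcount (r+1) x : ℝ) = (z : ℝ)}).toReal ≤ 1 := by
        rw [hset, hP]
        refine (Esl_mono (g := fun _ => (1:ℝ)) fun x _ => by split_ifs <;> norm_num).trans ?_
        rw [Esl_const (by rwa [ZMod.card])]
      have s0 : 0 ≤ stdNormal (((z:ℝ) - μk)/σk) := by unfold stdNormal; positivity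
      have s1 : stdNormal (((z:ℝ) - μk)/σk) ≤ 1 := by
        unfold stdNormal
        have t1 : (Real.sqrt (2 * Real.pi))⁻¹ ≤ 1 := inv_le_one_of_one_le₀ (Real.one_le_sqrt.2 (by linarith [Real.pi_gt_three]))
        have t2 : Real.exp (-((((z:ℝ) - μk)/σk)^2)/2) ≤ 1 := Real.exp_le_one_iff.2 (by have := sq_nonneg (((z:ℝ) - μk)/σk); linarith)
        exact mul_le_one₀ t1 (Real.exp_pos _).le t2
      rw [abs_le]; constructor <;> nlinarith [mul_nonneg hσ0 p0, mul_le_mul_of_nonneg_left p1 hσ0]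
    · rw [div_mul_cancel₀ _ hu.ne']; linarith
  choose B hB0 hB using hsmall
  set CS := ∑ n ∈ Finset.range N, ∑ m ∈ Finset.range n, B n m with hCS
  have hCS0 : 0 ≤ CS := Finset.sum_nonneg fun n _ => Finset.sum_nonneg fun m _ => hB0 n m
  refine ⟨C1 + CS, by linarith, ?_⟩
  intro n _ hgcd m hmn μ X μk σk
  have h0 : n ≠ 0 := NeZero.ne n
  have hnp : (0:ℝ) < n := by exact_mod_cast Nat.pos_of_ne_zero h0
  have hn1 : (1:ℝ) ≤ n := by exact_mod_cast Nat.pos_of_ne_zero h0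
  have hu : 0 < (n:ℝ) ^ (ε - 1/4) := Real.rpow_pos_of_pos hnp _
  obtain ⟨hm1, hm2⟩ := hmn
  have hmlt : m < n := by
    have : (m:ℝ)/n < 1 := by linarith
    rw [div_lt_one hnp] at this; exact_mod_cast this
  rcases lt_or_ge n N with hlt | hge
  · have hle : B n m ≤ C1 + CS := by
      have e1 : B n m ≤ ∑ m ∈ Finset.range n, B n m := Finset.single_le_sum (f := fun m => B n m) (fun m _ => hB0 n m) (Finset.mem_range.2 hmlt)
      have e2 : ∑ m ∈ Finset.range n, B n m ≤ CS := Finset.single_le_sum (f := fun n => ∑ m ∈ Finset.range n, B n m) (fun n _ => Finset.sum_nonneg fun m _ => hB0 n m) (Finset.mem_range.2 hlt)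
      linarith
    have := hB n m hmlt.le
    have h2 := mul_le_mul_of_nonneg_right hle hu.le
    exact ⟨fun z => (this.1 z).trans h2, this.2.trans h2⟩
  · have hm0 : 0 < m := by
      rcases Nat.eq_zero_or_pos m with h | h
      · subst h; simp at hm1; linarith
      · exact h
    have hcop : ∀ j, 1 ≤ j → j ≤ r → Nat.Coprime j n := by
      intro j hj1 hj2
      have : Nat.Coprime n (Nat.factorial r) := hgcd
      exact (this.coprime_dvd_right (Nat.dvd_factorial hj1 hj2)).symm
    have hodd : Odd n := Nat.coprime_two_left.1 (hcop 2 (by norm_num) hr)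
    have hps : lam * (1 - lam) ≤ (m:ℝ)/n * (1 - (m:ℝ)/n) := by nlinarith
    have hX : X = pX (ptAP n r) := funext fun x => kAP_pX x
    have hμk : μk = Esl m (pX (ptAP n r)) := by
      show ∫ x, X x ∂(uniformSubset n m) = _
      rw [us_int, hX]
    have hσk : σk = Real.sqrt (Esl m (fun x => (pX (ptAP n r) x - μk)^2)) := by
      show Real.sqrt (∫ x, (X x - μk) ^ 2 ∂(uniformSubset n m)) = _
      rw [us_int n m (fun x => (X x - μk)^2), hX]
    have hP : ∀ z : ℤ, (μ {x | X x = (z:ℝ)}).toReal = Esl m (fun x : ZMod n → Bool => if ((kAPcount (r+1) x : ℕ) : ℤ) = z then (1:ℝ) else 0) := by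
      intro z
      rw [← us_prob n m (fun x => (kAPcount (r+1) x : ℤ)) z]
      congr 2
      ext x; simp only [Set.mem_ofPred_eq]; rw [← Int.cast_inj (α := ℝ)]; simp [X]
    obtain ⟨b1, b2⟩ := hN n hge m μk σk hm0 hmlt hps hodd hcop hμk hσk (fun x => (kAPcount (r+1) x : ℤ)) (fun x => by rw [← kAP_pX]; simp)
    have hfin : C1 * (((n:ℝ)^δ)^6 / (n:ℝ)^((1:ℝ)/4)) ≤ (C1 + CS) * (n:ℝ) ^ (ε - 1/4) := by
      have : ((n:ℝ)^δ)^6 / (n:ℝ)^((1:ℝ)/4) ≤ (n:ℝ) ^ (ε - 1/4) := by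
        rw [← Real.rpow_natCast, ← Real.rpow_mul hnp.le, ← Real.rpow_sub hnp]
        refine Real.rpow_le_rpow_of_exponent_le hn1 ?_
        push_cast; linarith
      calc _ ≤ C1 * (n:ℝ) ^ (ε - 1/4) := by gcongr
        _ ≤ _ := by gcongr; linarith
    refine ⟨fun z => ?_, ?_⟩
    · rw [hP z]; exact (b1 z).trans hfin
    · simp only [hP]; exact b2.trans hfin
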